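/- Probabilistic bound in expectation: in the stated setup, let Ω ∈ ℝ^{n×(k+ρ)} have independent standard Gaussian N(0,1) entries with oversampling ρ ≥ 2, assume γ_k < 1, and set C_e = √(k/(ρ−1)) + e·√((k+ρ)(n−k))/ρ. Then for j = 1,…,k the canonical angles satisfy E[sin θ_j] ≤ γ_j^{2q+1}·C_e / √(1 + γ_j^{4q+2}·C_e²) and E[sin ν_j] ≤ γ_j^{2q+2}·C_e / √(1 + γ_j^{4q+4}·C_e²), where θ_j (resp. ν_j) are the canonical angles between the column spaces of U_k and Û (resp. V_k and V̂), arranged increasingly. -/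

import Mathlib

open scoped ENNReal
open Matrix

/-- The `j`-th largest singular value (0-indexed) of a complex matrix,
obtained as the decreasingly sorted square roots of the eigenvalues of `Mᴴ * M`. -/
noncomputable def sval {m n : ℕ} (M : Matrix (Fin m) (Fin n) ℂ) (j : ℕ) : ℝ :=
  (List.insertionSort (· ≥ ·)
    ((List.ofFn (Matrix.isHermitian_conjTranspose_mul_self M).eigenvalues).map Real.sqrt)).getD j 0

/-- The Schatten-`p` norm (`p = ∞` gives the spectral norm). -/
noncomputable def schatten {m n : ℕ} (p : ℝ≥0∞) (M : Matrix (Fin m) (Fin n) ℂ) : ℝ :=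
  if p = ⊤ then sval M 0
  else (∑ j ∈ Finset.range n, sval M j ^ p.toReal) ^ (1 / p.toReal)

/-- Moore–Penrose pseudoinverse of a full-row-rank matrix. -/
noncomputable def rpinv {a b : ℕ} (M : Matrix (Fin a) (Fin b) ℂ) : Matrix (Fin b) (Fin a) ℂ :=
  Mᴴ * (M * Mᴴ)⁻¹

/-- Rectangular diagonal matrix with entries `σ (off), σ (off+1), …` on the diagonal. -/
noncomputable def diagRect (σ : ℕ → ℝ) (off a b : ℕ) : Matrix (Fin a) (Fin b) ℂ :=
  Matrix.of fun i j => if (i : ℕ) = (j : ℕ) then (σ (off + (i : ℕ)) : ℂ) else 0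

/-- The first `b` columns of a matrix with `b + c` columns. -/
def colsL {a b c : ℕ} (M : Matrix (Fin a) (Fin (b + c)) ℂ) : Matrix (Fin a) (Fin b) ℂ :=
  M.submatrix id (Fin.castAdd c)

/-- The last `c` columns of a matrix with `b + c` columns. -/
def colsR {a b c : ℕ} (M : Matrix (Fin a) (Fin (b + c)) ℂ) : Matrix (Fin a) (Fin c) ℂ :=
  M.submatrix id (Fin.natAdd b)

/-- The constant `C_e = √(k/(ρ−1)) + e·√((k+ρ)(n−k))/ρ`. -/
noncomputable def Ce (k ρ nk : ℕ) : ℝ :=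
  Real.sqrt ((k : ℝ) / ((ρ : ℝ) - 1)) +
    Real.exp 1 * Real.sqrt (((k : ℝ) + ρ) * nk) / ρ

set_option linter.unusedSectionVars false

section Calculus

variable {ι κ : Type*} [Fintype ι] [DecidableEq ι] [Fintype κ] [DecidableEq κ]

/-- Real symmetric orthogonal projections, viewed as complex matrices. -/
def symProj (ι : Type*) [Fintype ι] : Set (Matrix ι ι ℂ) :=
  {E | Eᵀ = E ∧ Eᴴ = E ∧ E * E = E}

/-- The resolvent `(Φ + ε)⁻¹`. -/
noncomputable def resv (ε : ℝ) (Φ : Matrix κ κ ℂ) : Matrix κ κ ℂ :=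
  (Φ + (ε : ℂ) • 1)⁻¹

/-- The regularized squared tangent matrix `(1 - Φ) (Φ + ε)⁻¹`. -/
noncomputable def tanSq (ε : ℝ) (Φ : Matrix κ κ ℂ) : Matrix κ κ ℂ :=
  ((1 + ε : ℝ) : ℂ) • resv ε Φ - 1

/-- The matrices `(Φ + ε)⁻¹ t ^ i`, where `t = tanSq ε Φ`. -/
noncomputable def resvPow (ε : ℝ) (Φ : Matrix κ κ ℂ) (i : ℕ) : Matrix κ κ ℂ :=
  resv ε Φ * tanSq ε Φ ^ i

/-- The power sums `tr (t ^ i)`, where `t = tanSq ε Φ`. -/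
noncomputable def powSum (ε : ℝ) (Φ : Matrix κ κ ℂ) (i : ℕ) : ℂ :=
  (tanSq ε Φ ^ i).trace

/-- Products of power sums. -/
noncomputable def powProd (ε : ℝ) (Φ : Matrix κ κ ℂ) : List ℕ → ℂ
  | [] => 1
  | j :: l => powSum ε Φ j * powProd ε Φ l

/-- The negative gradient of `powProd` with respect to `Φ`. -/
noncomputable def powGrad (ε : ℝ) (Φ : Matrix κ κ ℂ) : List ℕ → Matrix κ κ ℂ
  | [] => 0
  | j :: l => powSum ε Φ j • powGrad ε Φ l +
      ((j : ℂ) * powProd ε Φ l) • (resvPow ε Φ (j - 1) + resvPow ε Φ j)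

theorem resv_comm_tanSq (ε : ℝ) (Φ : Matrix κ κ ℂ) : Commute (resv ε Φ) (tanSq ε Φ) := by
  unfold tanSq
  exact ((Commute.refl _).smul_right _).sub_right (Commute.one_right _)

theorem smul_resv_mul_resvPow (ε : ℝ) (Φ : Matrix κ κ ℂ) (i : ℕ) :
    ((1 + ε : ℝ) : ℂ) • (resv ε Φ * resvPow ε Φ i) = resvPow ε Φ i + resvPow ε Φ (i + 1) := by
  have h : ((1 + ε : ℝ) : ℂ) • resv ε Φ = 1 + tanSq ε Φ := by simp [tanSq]
  rw [← smul_mul_assoc, h, add_mul, one_mul]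
  congr 1
  unfold resvPow
  rw [← mul_assoc, ← (resv_comm_tanSq ε Φ).eq, mul_assoc, ← pow_succ']

attribute [local instance] Matrix.linftyOpNormedRing Matrix.linftyOpNormedAlgebra

theorem hasDerivAt_resv {ε : ℝ} {f : ℝ → Matrix κ κ ℂ} {D : Matrix κ κ ℂ} {x : ℝ}
    (hf : HasDerivAt f D x) (hu : IsUnit (f x + (ε : ℂ) • 1)) :
    HasDerivAt (fun s => resv ε (f s)) (-(resv ε (f x) * D * resv ε (f x))) x := by
  unfold resv
  obtain ⟨u, hu⟩ := hu
  have h1 : HasDerivAt (fun s => f s + (ε : ℂ) • (1 : Matrix κ κ ℂ)) D x := hf.add_const _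
  have h2 := hasFDerivAt_ringInverse (𝕜 := ℝ) u
  rw [hu] at h2
  have h3 := h2.comp_hasDerivAt x h1
  simp only [Matrix.nonsing_inv_eq_ringInverse]
  have h4 : Ring.inverse (f x + (ε : ℂ) • 1) = (↑u⁻¹ : Matrix κ κ ℂ) := by
    rw [← hu, Ring.inverse_unit]
  rw [h4]
  exact h3.congr_deriv (by simp [ContinuousLinearMap.mulLeftRight_apply])

theorem hasDerivAt_tanSq {ε : ℝ} {f : ℝ → Matrix κ κ ℂ} {D : Matrix κ κ ℂ} {x : ℝ}
    (hf : HasDerivAt f D x) (hu : IsUnit (f x + (ε : ℂ) • 1)) :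
    HasDerivAt (fun s => tanSq ε (f s))
      (-(((1 + ε : ℝ) : ℂ) • (resv ε (f x) * D * resv ε (f x)))) x := by
  unfold tanSq
  have := ((hasDerivAt_resv hf hu).const_smul ((1 + ε : ℝ) : ℂ)).sub_const 1
  rwa [smul_neg] at this

theorem hasDerivAt_tanSq_pow {ε : ℝ} {f : ℝ → Matrix κ κ ℂ} {D : Matrix κ κ ℂ} {x : ℝ}
    (hf : HasDerivAt f D x) (hu : IsUnit (f x + (ε : ℂ) • 1)) (m : ℕ) :
    HasDerivAt (fun s => tanSq ε (f s) ^ m)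
      (-(((1 + ε : ℝ) : ℂ) • ∑ i ∈ Finset.range m,
        (resvPow ε (f x) i * D * resvPow ε (f x) (m - 1 - i)))) x := by
  induction m with
  | zero =>
    simp only [pow_zero]
    exact (hasDerivAt_const x (1 : Matrix κ κ ℂ)).congr_deriv (by simp)
  | succ m ih =>
    have h := ih.mul (hasDerivAt_tanSq hf hu)
    simp only [pow_succ]
    refine h.congr_deriv (Eq.symm ?_)
    rw [Finset.sum_range_succ, neg_mul, mul_neg, ← neg_add, smul_mul_assoc, mul_smul_comm,
      ← smul_add, Finset.sum_mul]
    refine congrArg (fun M => -(((1 + ε : ℝ) : ℂ) • M)) (congrArg₂ (· + ·) ?_ ?_)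
    · refine Finset.sum_congr rfl fun i hi => ?_
      have hi := Finset.mem_range.1 hi
      rw [show m + 1 - 1 - i = (m - 1 - i) + 1 by omega]
      simp only [resvPow, pow_succ, mul_assoc]
    · have : m + 1 - 1 - m = 0 := by omega
      rw [this]
      simp only [resvPow, pow_zero, mul_one, ((resv_comm_tanSq ε (f x)).pow_right m).eq, mul_assoc]

theorem hasDerivAt_resvPow {ε : ℝ} {f : ℝ → Matrix κ κ ℂ} {D : Matrix κ κ ℂ} {x : ℝ}
    (hf : HasDerivAt f D x) (hu : IsUnit (f x + (ε : ℂ) • 1)) (m : ℕ) :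
    HasDerivAt (fun s => resvPow ε (f s) m)
      (-((∑ i ∈ Finset.range (m + 1), resvPow ε (f x) i * D * resvPow ε (f x) (m - i)) +
        ∑ i ∈ Finset.range m, resvPow ε (f x) i * D * resvPow ε (f x) (m - 1 - i))) x := by
  have h := (hasDerivAt_resv hf hu).mul (hasDerivAt_tanSq_pow hf hu m)
  refine h.congr_deriv (Eq.symm ?_)
  rw [Finset.sum_range_succ', neg_mul, mul_neg, ← neg_add, mul_smul_comm, Finset.mul_sum,
    Finset.smul_sum]
  congr 1
  have h1 : ∀ i ∈ Finset.range m, ((1 + ε : ℝ) : ℂ) • (resv ε (f x) *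
      (resvPow ε (f x) i * D * resvPow ε (f x) (m - 1 - i))) =
      resvPow ε (f x) i * D * resvPow ε (f x) (m - 1 - i) +
      resvPow ε (f x) (i + 1) * D * resvPow ε (f x) (m - (i + 1)) := by
    intro i hi
    rw [← mul_assoc, ← mul_assoc, ← smul_mul_assoc, ← smul_mul_assoc, smul_resv_mul_resvPow,
      add_mul, add_mul, show m - (i + 1) = m - 1 - i by omega]
  rw [Finset.sum_congr rfl h1, Finset.sum_add_distrib]
  simp only [resvPow, pow_zero, mul_one, mul_assoc, Nat.sub_zero]
  abel

theorem hasDerivAt_trace {f : ℝ → Matrix κ κ ℂ} {D : Matrix κ κ ℂ} {x : ℝ}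
    (hf : HasDerivAt f D x) : HasDerivAt (fun s => (f s).trace) D.trace x :=
  (LinearMap.toContinuousLinearMap (Matrix.traceLinearMap κ ℝ ℂ)).hasFDerivAt.comp_hasDerivAt x hf

theorem hasDerivAt_powSum {ε : ℝ} {f : ℝ → Matrix κ κ ℂ} {D : Matrix κ κ ℂ} {x : ℝ}
    (hf : HasDerivAt f D x) (hu : IsUnit (f x + (ε : ℂ) • 1)) (m : ℕ) :
    HasDerivAt (fun s => powSum ε (f s) m)
      (-(m * (D * (resvPow ε (f x) (m - 1) + resvPow ε (f x) m)).trace)) x := by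
  have h := hasDerivAt_trace (hasDerivAt_tanSq_pow hf hu m)
  unfold powSum
  convert h using 1
  rw [trace_neg, trace_smul, trace_sum, Finset.smul_sum]
  congr 1
  cases m with
  | zero => simp
  | succ m =>
    have h1 : ∀ i ∈ Finset.range (m + 1), ((1 + ε : ℝ) : ℂ) •
        (resvPow ε (f x) i * D * resvPow ε (f x) (m + 1 - 1 - i)).trace =
        (D * (resvPow ε (f x) m + resvPow ε (f x) (m + 1))).trace := by
      intro i hi
      have hi := Finset.mem_range.1 hi
      rw [← smul_resv_mul_resvPow, mul_assoc, trace_mul_comm, mul_assoc, mul_smul_comm, trace_smul]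
      congr 3
      unfold resvPow
      rw [mul_assoc, ← mul_assoc _ (resv ε (f x)),
        ← ((resv_comm_tanSq ε (f x)).pow_right _).eq, mul_assoc, ← pow_add]
      congr 3
      omega
    rw [Finset.sum_congr rfl h1]
    simp

theorem hasDerivAt_powProd {ε : ℝ} {f : ℝ → Matrix κ κ ℂ} {D : Matrix κ κ ℂ} {x : ℝ}
    (hf : HasDerivAt f D x) (hu : IsUnit (f x + (ε : ℂ) • 1)) (l : List ℕ) :
    HasDerivAt (fun s => powProd ε (f s) l) (-(D * powGrad ε (f x) l).trace) x := by
  induction l with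
  | nil => simpa [powProd, powGrad] using hasDerivAt_const x (1 : ℂ)
  | cons j l ih =>
    have h := (hasDerivAt_powSum hf hu j).mul ih
    refine h.congr_deriv (Eq.symm ?_)
    simp only [powGrad, mul_add, trace_add, mul_smul_comm, trace_smul, smul_eq_mul]
    ring

end Calculus

section LoopIdentity

variable {ι κ : Type*} [Fintype ι] [DecidableEq ι] [Fintype κ] [DecidableEq κ]

/-- The generator of the rotation in the coordinate plane `(α, β)`. -/
def skewGen {R : Type*} [Ring R] (α β : ι) : Matrix ι ι R := single α β 1 - single β α 1

theorem trace_single_mul' (α β : ι) (X : Matrix ι ι ℂ) :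
    (single α β (1 : ℂ) * X).trace = X β α := by
  rw [Matrix.trace_single_mul]; simp

theorem trace_skewGen_mul (α β : ι) (X : Matrix ι ι ℂ) :
    (skewGen α β * X).trace = X β α - X α β := by
  simp [skewGen, sub_mul, trace_single_mul']

theorem trace_single_mul_mul_single_mul (α β γ δ : ι) (X Y : Matrix ι ι ℂ) :
    (single α β (1 : ℂ) * X * single γ δ 1 * Y).trace = X β γ * Y δ α := by
  rw [mul_assoc, mul_assoc, trace_single_mul', Matrix.mul_apply, Finset.sum_eq_single γ]
  · simp
  · intro x _ hx
    simp [Matrix.single_mul_apply_of_ne, hx]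
  · simp

theorem sum_trace_skewGen (X Y : Matrix ι ι ℂ) :
    ∑ α, ∑ β, (skewGen α β * X * skewGen α β * Y).trace =
      2 * ((Xᵀ * Y).trace - X.trace * Y.trace) := by
  have h : ∀ α β : ι, (skewGen α β * X * skewGen α β * Y).trace =
      (X β α * Y β α + X α β * Y α β) - (X β β * Y α α + X α α * Y β β) := by
    intro α β
    simp only [skewGen, sub_mul, mul_sub, trace_sub, trace_single_mul_mul_single_mul]
    ring
  simp only [h, Finset.sum_sub_distrib, Finset.sum_add_distrib]
  simp only [trace, diag, Matrix.mul_apply, transpose_apply, Finset.sum_mul_sum]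
  rw [Finset.sum_comm (f := fun x y => X x y * Y x y),
    Finset.sum_comm (f := fun x y => X x x * Y y y)]
  ring

theorem sum_trace_skewGen_mul_trace (X Y : Matrix ι ι ℂ) :
    ∑ α, ∑ β, (skewGen α β * X).trace * (skewGen α β * Y).trace =
      2 * ((Xᵀ * Y).trace - (X * Y).trace) := by
  have h : ∀ α β : ι, (skewGen α β * X).trace * (skewGen α β * Y).trace =
      (X β α * Y β α + X α β * Y α β) - (X β α * Y α β + X α β * Y β α) := by
    intro α β
    simp only [trace_skewGen_mul]
    ring
  simp only [h, Finset.sum_sub_distrib, Finset.sum_add_distrib]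
  simp only [trace, diag, Matrix.mul_apply, transpose_apply]
  rw [Finset.sum_comm (f := fun x y => X x y * Y x y),
    Finset.sum_comm (f := fun x y => X y x * Y x y)]
  ring

/-- The compression `Vᴴ E V`. -/
def compr (V : Matrix ι κ ℂ) (E : Matrix ι ι ℂ) : Matrix κ κ ℂ := Vᴴ * E * V

/-- The inflation `V A Vᴴ`. -/
def infl (V : Matrix ι κ ℂ) (A : Matrix κ κ ℂ) : Matrix ι ι ℂ := V * A * Vᴴ

/-- The transposed pairing appearing in the loop equations. -/
def twist (V : Matrix ι κ ℂ) (E : Matrix ι ι ℂ) (A B : Matrix κ κ ℂ) : ℂ :=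
  ((infl V A)ᵀ * E * infl V B * (1 - E)).trace

/-- The test function `tr (a E V P Vᴴ) T` fed into infinitesimal rotation invariance. -/
noncomputable def testFn (V : Matrix ι κ ℂ) (ε : ℝ) (m : ℕ) (l : List ℕ) (a E : Matrix ι ι ℂ) : ℂ :=
  (a * E * infl V (resvPow ε (compr V E) m)).trace * powProd ε (compr V E) l

/-- The derivative of `testFn` along the rotation generated by `a`. -/
noncomputable def testFnDeriv (V : Matrix ι κ ℂ) (ε : ℝ) (m : ℕ) (l : List ℕ)
    (a E : Matrix ι ι ℂ) : ℂ :=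
  ((a * (a * E - E * a) * infl V (resvPow ε (compr V E) m)).trace -
    ((∑ i ∈ Finset.range (m + 1), (a * E * infl V (resvPow ε (compr V E) i) * (a * E - E * a) *
      infl V (resvPow ε (compr V E) (m - i))).trace) +
    ∑ i ∈ Finset.range m, (a * E * infl V (resvPow ε (compr V E) i) * (a * E - E * a) *
      infl V (resvPow ε (compr V E) (m - 1 - i))).trace)) * powProd ε (compr V E) l -
  (a * E * infl V (resvPow ε (compr V E) m)).trace *
    ((a * E - E * a) * infl V (powGrad ε (compr V E) l)).trace

theorem trace_mul_infl (V : Matrix ι κ ℂ) (E : Matrix ι ι ℂ) (A : Matrix κ κ ℂ) :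
    (E * infl V A).trace = (compr V E * A).trace := by
  rw [infl, compr, ← Matrix.mul_assoc, trace_mul_comm, ← Matrix.mul_assoc, ← Matrix.mul_assoc]

section
attribute [local instance] Matrix.linftyOpNormedRing Matrix.linftyOpNormedAlgebra
attribute [local instance] Matrix.linftyOpNormedAddCommGroup Matrix.linftyOpNormedSpace

theorem hasDerivAt_testFn (V : Matrix ι κ ℂ) (ε : ℝ) (m : ℕ) (l : List ℕ) (a E : Matrix ι ι ℂ)
    {f : ℝ → Matrix ι ι ℂ} {x : ℝ} (hx : f x = E) (hf : HasDerivAt f (a * E - E * a) x)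
    (hu : IsUnit (compr V E + (ε : ℂ) • 1)) :
    HasDerivAt (fun s => testFn V ε m l a (f s)) (testFnDeriv V ε m l a E) x := by
  have hlin : HasDerivAt (fun s => compr V (f s)) (compr V (a * E - E * a)) x := by
    let L : Matrix ι ι ℂ →ₗ[ℝ] Matrix κ κ ℂ :=
      { toFun := compr V
        map_add' := fun A B => by simp [compr, Matrix.mul_add, Matrix.add_mul]
        map_smul' := fun c A => by simp [compr] }
    exact (LinearMap.toContinuousLinearMap L).hasFDerivAt.comp_hasDerivAt x hf
  have hu' : IsUnit (compr V (f x) + (ε : ℂ) • 1) := by rwa [hx]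
  have hP := hasDerivAt_resvPow hlin hu' m
  have hinf : ∀ {g : ℝ → Matrix κ κ ℂ} {D}, HasDerivAt g D x →
      HasDerivAt (fun s => infl V (g s)) (infl V D) x := by
    intro g D hg
    let L : Matrix κ κ ℂ →ₗ[ℝ] Matrix ι ι ℂ :=
      { toFun := infl V
        map_add' := fun A B => by simp [infl, Matrix.mul_add, Matrix.add_mul]
        map_smul' := fun c A => by simp [infl] }
    exact (LinearMap.toContinuousLinearMap L).hasFDerivAt.comp_hasDerivAt x hg
  have h1 := hasDerivAt_trace ((hf.const_mul a).mul (hinf hP))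
  have h2 := h1.mul (hasDerivAt_powProd hlin hu' l)
  refine h2.congr_deriv ?_
  simp only [Pi.mul_apply]
  rw [hx]
  have hD : ∀ A B : Matrix κ κ ℂ, infl V (A * compr V (a * E - E * a) * B) =
      infl V A * (a * E - E * a) * infl V B := by
    intro A B
    simp only [infl, compr, Matrix.mul_assoc]
  have hneg : ∀ A : Matrix κ κ ℂ, infl V (-A) = -infl V A := by intro A; simp [infl]
  have hadd : ∀ A B : Matrix κ κ ℂ, infl V (A + B) = infl V A + infl V B := by
    intro A B; simp [infl, Matrix.mul_add, Matrix.add_mul]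
  have hsum : ∀ (s : Finset ℕ) (F : ℕ → Matrix κ κ ℂ),
      infl V (∑ i ∈ s, F i) = ∑ i ∈ s, infl V (F i) := by
    intro s F; simp [infl, Matrix.mul_sum, Matrix.sum_mul]
  rw [hneg, hadd, hsum, hsum, ← trace_mul_infl]
  simp only [hD, trace_add, mul_neg, trace_neg, mul_add, Finset.mul_sum, trace_sum, testFnDeriv]
  simp only [mul_assoc]
  ring

end

/-- The sum over all coordinate planes of the derivatives of the test functions (halved). -/
noncomputable def loopFn (V : Matrix ι κ ℂ) (ε : ℝ) (m : ℕ) (l : List ℕ) (E : Matrix ι ι ℂ) : ℂ :=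
  (E.trace * (resvPow ε (compr V E) m).trace -
      Fintype.card ι * (compr V E * resvPow ε (compr V E) m).trace -
    ((∑ i ∈ Finset.range (m + 1), ((compr V E * resvPow ε (compr V E) i).trace *
      ((resvPow ε (compr V E) (m - i)).trace -
        (compr V E * resvPow ε (compr V E) (m - i)).trace) +
      twist V E (resvPow ε (compr V E) i) (resvPow ε (compr V E) (m - i)))) +
    ∑ i ∈ Finset.range m, ((compr V E * resvPow ε (compr V E) i).trace *
      ((resvPow ε (compr V E) (m - 1 - i)).trace -
        (compr V E * resvPow ε (compr V E) (m - 1 - i)).trace) +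
      twist V E (resvPow ε (compr V E) i) (resvPow ε (compr V E) (m - 1 - i))))) *
    powProd ε (compr V E) l -
  (twist V E (resvPow ε (compr V E) m) (powGrad ε (compr V E) l) +
    ((compr V E * (resvPow ε (compr V E) m * powGrad ε (compr V E) l)).trace -
      (compr V E * resvPow ε (compr V E) m * compr V E * powGrad ε (compr V E) l).trace))

theorem trace_infl {V : Matrix ι κ ℂ} (hV : Vᴴ * V = 1) (A : Matrix κ κ ℂ) :
    (infl V A).trace = A.trace := by
  rw [infl, Matrix.mul_assoc, trace_mul_comm, Matrix.mul_assoc, hV, mul_one]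

theorem twist_eq (V : Matrix ι κ ℂ) (E : Matrix ι ι ℂ) (A B : Matrix κ κ ℂ) :
    twist V E A B = ((infl V A)ᵀ * (E * infl V B)).trace -
      ((infl V A)ᵀ * E * infl V B * E).trace := by
  rw [twist, mul_sub, trace_sub, mul_one, mul_assoc]

theorem sum_testFnDeriv {V : Matrix ι κ ℂ} (hV : Vᴴ * V = 1) (ε : ℝ) (m : ℕ) (l : List ℕ)
    {E : Matrix ι ι ℂ} (hE : E ∈ symProj ι) :
    ∑ α, ∑ β, testFnDeriv V ε m l (skewGen α β) E = 2 * loopFn V ε m l E := by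
  obtain ⟨hT, -, hI⟩ := hE
  have h1 : ∀ X : Matrix ι ι ℂ, ∑ α, ∑ β,
      (skewGen α β * (skewGen α β * E - E * skewGen α β) * X).trace =
      2 * (E.trace * X.trace - Fintype.card ι * (E * X).trace) := by
    intro X
    have := sum_trace_skewGen (ι := ι) 1 (E * X)
    have h' := sum_trace_skewGen E X
    have e : ∀ α β, (skewGen α β * (skewGen α β * E - E * skewGen α β) * X).trace =
        (skewGen α β * 1 * skewGen α β * (E * X)).trace -
        (skewGen α β * E * skewGen α β * X).trace := by
      intro α β
      rw [← trace_sub]; congr 1; noncomm_ring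
    simp only [e, Finset.sum_sub_distrib, this, h']
    rw [hT, transpose_one, one_mul, trace_one]
    ring
  have h2 : ∀ A B : Matrix κ κ ℂ, ∑ α, ∑ β,
      (skewGen α β * E * infl V A * (skewGen α β * E - E * skewGen α β) * infl V B).trace =
      2 * ((compr V E * A).trace * (B.trace - (compr V E * B).trace) + twist V E A B) := by
    intro A B
    have h := sum_trace_skewGen (E * infl V A) (E * infl V B)
    have h' := sum_trace_skewGen (E * infl V A * E) (infl V B)
    have e : ∀ α β,
        (skewGen α β * E * infl V A * (skewGen α β * E - E * skewGen α β) * infl V B).trace =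
        (skewGen α β * (E * infl V A) * skewGen α β * (E * infl V B)).trace -
        (skewGen α β * (E * infl V A * E) * skewGen α β * infl V B).trace := by
      intro α β
      rw [← trace_sub]; congr 1; noncomm_ring
    simp only [e, Finset.sum_sub_distrib, h, h']
    rw [twist_eq, trace_infl hV, ← trace_mul_infl, ← trace_mul_infl]
    have t1 : (E * infl V A * E).trace = (E * infl V A).trace := by
      rw [trace_mul_comm, ← mul_assoc, hI]
    have t2 : ((E * infl V A)ᵀ * (E * infl V B)).trace = ((infl V A)ᵀ * (E * infl V B)).trace := by
      rw [transpose_mul, hT, mul_assoc, ← mul_assoc E E, hI]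
    have t3 : ((E * infl V A * E)ᵀ * infl V B).trace = ((infl V A)ᵀ * E * infl V B * E).trace := by
      rw [transpose_mul, transpose_mul, hT, trace_mul_comm ((infl V A)ᵀ * E * infl V B)]
      simp only [mul_assoc]
    rw [t1, t2, t3]
    ring
  have h3 : ∀ A B : Matrix κ κ ℂ, ∑ α, ∑ β, (skewGen α β * E * infl V A).trace *
      ((skewGen α β * E - E * skewGen α β) * infl V B).trace =
      2 * (twist V E A B + ((compr V E * (A * B)).trace - (compr V E * A * compr V E * B).trace)) := by
    intro A B
    have h := sum_trace_skewGen_mul_trace (E * infl V A) (E * infl V B)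
    have h' := sum_trace_skewGen_mul_trace (E * infl V A) (infl V B * E)
    have e : ∀ α β : ι, (skewGen α β * E * infl V A).trace *
        ((skewGen α β * E - E * skewGen α β) * infl V B).trace =
        (skewGen α β * (E * infl V A)).trace * (skewGen α β * (E * infl V B)).trace -
        (skewGen α β * (E * infl V A)).trace * (skewGen α β * (infl V B * E)).trace := by
      intro α β
      rw [← mul_sub, ← trace_sub, sub_mul, trace_sub, trace_sub, mul_assoc, mul_assoc, mul_assoc,
        trace_mul_comm E, mul_assoc]
    simp only [e, Finset.sum_sub_distrib, h, h']
    rw [twist_eq]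
    have t2 : ((E * infl V A)ᵀ * (E * infl V B)).trace = ((infl V A)ᵀ * (E * infl V B)).trace := by
      rw [transpose_mul, hT, mul_assoc, ← mul_assoc E E, hI]
    have t3 : ((E * infl V A)ᵀ * (infl V B * E)).trace = ((infl V A)ᵀ * E * infl V B * E).trace := by
      rw [transpose_mul, hT]
      simp only [mul_assoc]
    have t4 : (E * infl V A * (infl V B * E)).trace = (compr V E * (A * B)).trace := by
      rw [← trace_mul_infl, trace_mul_comm, mul_assoc, ← mul_assoc E E, hI, trace_mul_comm, mul_assoc]
      congr 2
      simp only [infl, Matrix.mul_assoc]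
      rw [← Matrix.mul_assoc Vᴴ V, hV, Matrix.one_mul]
    have t5 : (E * infl V A * (E * infl V B)).trace = (compr V E * A * compr V E * B).trace := by
      rw [← mul_assoc, trace_mul_infl]
      congr 1
      simp only [infl, compr, Matrix.mul_assoc]
    rw [t2, t3, t4, t5]
    ring
  have hs : ∀ (s : Finset ℕ) (F : ι → ι → ℕ → ℂ), ∑ α, ∑ β, ∑ i ∈ s, F α β i =
      ∑ i ∈ s, ∑ α, ∑ β, F α β i := by
    intro s F
    simp only [Finset.sum_comm (s := s)]
  simp only [testFnDeriv, Finset.sum_sub_distrib, ← Finset.sum_mul, Finset.sum_add_distrib]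
  rw [hs, hs, h1, h3]
  simp only [h2, ← Finset.mul_sum]
  rw [trace_infl hV, trace_mul_infl, loopFn]
  ring

end LoopIdentity

section TwistBound

variable {ι κ : Type*} [Fintype ι] [DecidableEq ι] [Fintype κ] [DecidableEq κ]

theorem conjTranspose_mul_self_apply_self {ι κ : Type*} [Fintype ι] (M : Matrix ι κ ℂ) (l : κ) :
    (Mᴴ * M) l l = ((∑ x, ‖M x l‖ ^ 2 : ℝ) : ℂ) := by
  rw [Matrix.mul_apply]
  push_cast
  refine Finset.sum_congr rfl fun x _ => ?_
  rw [conjTranspose_apply, Complex.star_def, Complex.conj_mul']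

theorem bessel_normalized {G : Matrix ι ι ℂ} (hG : G ∈ symProj ι) {Z : Matrix ι κ ℂ} {φ : κ → ℝ}
    (hφ : ∀ l, 0 ≤ φ l) (hZ : Zᴴ * G * Z = diagonal fun l => (φ l : ℂ)) :
    ∃ C : κ → κ → ℝ, (∀ l l', C l l' = C l' l) ∧ (∀ l, ∑ l', C l l' ^ 2 ≤ 1) ∧
      ∀ l l', ‖(Zᵀ * G * Z) l l'‖ = √(φ l) * √(φ l') * C l l' := by
  obtain ⟨hT, hH, hI⟩ := hG
  have hGZ : (G * Z)ᴴ * (G * Z) = diagonal fun l => (φ l : ℂ) := by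
    rw [conjTranspose_mul, hH, Matrix.mul_assoc, ← Matrix.mul_assoc G G, hI, ← Matrix.mul_assoc, hZ]
  set r : κ → ℂ := fun l => ((√(φ l))⁻¹ : ℝ) with hr
  set w : κ → ℂ := fun l => (√(φ l) : ℝ) with hw
  set B : Matrix ι κ ℂ := G * Z * diagonal r with hB
  have hBw : G * Z = B * diagonal w := by
    ext x l
    rw [hB, Matrix.mul_assoc, diagonal_mul_diagonal, Matrix.mul_diagonal]
    rcases eq_or_lt_of_le (hφ l) with h | h
    · have h1 := congrFun (congrFun hGZ l) l
      rw [conjTranspose_mul_self_apply_self, diagonal_apply_eq] at h1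
      have h2 : ∑ x, ‖(G * Z) x l‖ ^ 2 = 0 := by rw [h]; exact_mod_cast h1
      rw [Finset.sum_eq_zero_iff_of_nonneg (fun _ _ => by positivity)] at h2
      have h3 := h2 x (Finset.mem_univ x)
      have h4 : (G * Z) x l = 0 := by simpa using h3
      rw [h4, zero_mul]
    · have : √(φ l) ≠ 0 := (Real.sqrt_pos.2 h).ne'
      have h5 : r l * w l = 1 := by
        simp only [hr, hw]
        rw [← Complex.ofReal_mul, inv_mul_cancel₀ this, Complex.ofReal_one]
      rw [h5, mul_one]
  have hstar : star r = r := by ext l; simp [hr]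
  have hBB : Bᴴ * B = diagonal fun l => r l * φ l * r l := by
    rw [hB, conjTranspose_mul, diagonal_conjTranspose, hstar, Matrix.mul_assoc,
      ← Matrix.mul_assoc _ (G * Z), hGZ, diagonal_mul_diagonal, diagonal_mul_diagonal]
    simp only [mul_assoc]
  have hBe : B * (Bᴴ * B) = B := by
    rw [hBB, hB, Matrix.mul_assoc, diagonal_mul_diagonal]
    congr 2
    ext l
    simp only [hr]
    rcases eq_or_lt_of_le (hφ l) with h | h
    · simp [← h]
    · have h1 : (√(φ l))⁻¹ * ((√(φ l))⁻¹ * φ l * (√(φ l))⁻¹) = (√(φ l))⁻¹ := by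
        have h2 : √(φ l) ≠ 0 := (Real.sqrt_pos.2 h).ne'
        have h3 := Real.mul_self_sqrt h.le
        field_simp
        nlinarith
      exact_mod_cast h1
  have hHH : (B * Bᴴ) * (B * Bᴴ) = B * Bᴴ := by
    rw [Matrix.mul_assoc, ← Matrix.mul_assoc Bᴴ, ← Matrix.mul_assoc, hBe]
  refine ⟨fun l l' => ‖(Bᵀ * B) l l'‖, fun l l' => ?_, fun l => ?_, fun l l' => ?_⟩
  · have : (Bᵀ * B)ᵀ = Bᵀ * B := by rw [transpose_mul, transpose_transpose]
    change ‖(Bᵀ * B) l l'‖ = ‖(Bᵀ * B) l' l‖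
    rw [← this, transpose_apply, this]
  · set c : Matrix ι κ ℂ := Bᵀᴴ with hc
    have e1 : ((Bᴴ * c)ᴴ * (Bᴴ * c)) + ((1 - B * Bᴴ) * c)ᴴ * ((1 - B * Bᴴ) * c) = cᴴ * c := by
      have h1 : (1 - B * Bᴴ)ᴴ = 1 - B * Bᴴ := by simp
      have h2 : (1 - B * Bᴴ) * (1 - B * Bᴴ) = 1 - B * Bᴴ := by
        rw [sub_mul, mul_sub, mul_sub, hHH]; simp
      rw [conjTranspose_mul Bᴴ c, conjTranspose_mul _ c, h1, Matrix.mul_assoc, ← Matrix.mul_assoc Bᴴᴴ,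
        conjTranspose_conjTranspose B, Matrix.mul_assoc cᴴ, ← Matrix.mul_assoc (1 - B * Bᴴ), h2,
        ← Matrix.mul_add, ← Matrix.add_mul]
      simp
    have e2 := congrFun (congrFun e1 l) l
    rw [Matrix.add_apply, conjTranspose_mul_self_apply_self, conjTranspose_mul_self_apply_self,
      conjTranspose_mul_self_apply_self] at e2
    have e3 : (∑ x, ‖(Bᴴ * c) x l‖ ^ 2 : ℝ) + ∑ x, ‖(((1 - B * Bᴴ : Matrix ι ι ℂ)) * c) x l‖ ^ 2 =
      ∑ x, ‖c x l‖ ^ 2 := by exact_mod_cast e2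
    have e4 : (∑ x, ‖c x l‖ ^ 2 : ℝ) ≤ 1 := by
      have h1 := congrFun (congrFun hBB l) l
      rw [conjTranspose_mul_self_apply_self, diagonal_apply_eq] at h1
      have h2 : (∑ x, ‖B x l‖ ^ 2 : ℝ) = (√(φ l))⁻¹ * φ l * (√(φ l))⁻¹ := by
        simp only [hr] at h1
        exact_mod_cast h1
      have h3 : (√(φ l))⁻¹ * φ l * (√(φ l))⁻¹ ≤ 1 := by
        rcases eq_or_lt_of_le (hφ l) with h | h
        · simp [← h]
        · have h2 : √(φ l) ≠ 0 := (Real.sqrt_pos.2 h).ne'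
          have h3 := Real.mul_self_sqrt h.le
          apply le_of_eq
          field_simp
          nlinarith
      have h4 : ∀ x, ‖c x l‖ = ‖B x l‖ := fun x => by simp [hc]
      simp only [h4]
      linarith
    have e5 : ∀ l', ‖(Bᵀ * B) l l'‖ = ‖(Bᴴ * c) l' l‖ := by
      intro l'
      have : (Bᴴ * c) = (Bᵀ * B)ᴴ := (conjTranspose_mul Bᵀ B).symm
      rw [this, conjTranspose_apply, norm_star]
    simp only [e5]
    have : 0 ≤ ∑ x, ‖(((1 - B * Bᴴ : Matrix ι ι ℂ)) * c) x l‖ ^ 2 := Finset.sum_nonneg fun _ _ => by positivity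
    linarith
  · have e1 : Zᵀ * G * Z = diagonal w * (Bᵀ * B) * diagonal w := by
      have : Zᵀ * G * Z = (G * Z)ᵀ * (G * Z) := by
        rw [transpose_mul, hT, Matrix.mul_assoc, Matrix.mul_assoc, ← Matrix.mul_assoc G G, hI]
      rw [this, hBw, transpose_mul, diagonal_transpose]
      simp only [Matrix.mul_assoc]
    rw [e1, Matrix.mul_diagonal, Matrix.diagonal_mul]
    simp only [hw, norm_mul, Complex.norm_real, Real.norm_eq_abs, abs_of_nonneg (Real.sqrt_nonneg _)]
    ring

theorem sum_substochastic_le {C : κ → κ → ℝ} (hs : ∀ l l', C l l' = C l' l)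
    (hC : ∀ l, ∑ l', C l l' ^ 2 ≤ 1) {u : κ → ℝ} (hu : ∀ l, 0 ≤ u l) (a b : ℕ) :
    ∑ l, ∑ l', u l ^ a * u l' ^ b * C l l' ^ 2 ≤ ∑ l, u l ^ (a + b) := by
  have h1 : ∑ l, ∑ l', u l ^ a * u l' ^ b * C l l' ^ 2 =
      ∑ l, ∑ l', u l' ^ a * u l ^ b * C l l' ^ 2 := by
    rw [Finset.sum_comm]
    refine Finset.sum_congr rfl fun l _ => Finset.sum_congr rfl fun l' _ => ?_
    rw [hs]
  have h2 : ∑ l, ∑ l', u l' ^ (a + b) * C l l' ^ 2 = ∑ l, ∑ l', u l ^ (a + b) * C l l' ^ 2 := by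
    rw [Finset.sum_comm]
    refine Finset.sum_congr rfl fun l _ => Finset.sum_congr rfl fun l' _ => ?_
    rw [hs]
  have h3 : ∑ l, ∑ l', u l ^ (a + b) * C l l' ^ 2 ≤ ∑ l, u l ^ (a + b) := by
    refine Finset.sum_le_sum fun l _ => ?_
    rw [← Finset.mul_sum]
    exact mul_le_of_le_one_right (pow_nonneg (hu l) _) (hC l)
  have h4 : ∑ l, ∑ l', (u l ^ a * u l' ^ b + u l' ^ a * u l ^ b) * C l l' ^ 2 ≤
      ∑ l, ∑ l', (u l ^ (a + b) + u l' ^ (a + b)) * C l l' ^ 2 := by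
    refine Finset.sum_le_sum fun l _ => Finset.sum_le_sum fun l' _ => ?_
    refine mul_le_mul_of_nonneg_right ?_ (by positivity)
    have : 0 ≤ (u l ^ a - u l' ^ a) * (u l ^ b - u l' ^ b) := by
      rcases le_total (u l) (u l') with h | h
      · exact mul_nonneg_of_nonpos_of_nonpos (sub_nonpos.2 (pow_le_pow_left₀ (hu l) h _))
          (sub_nonpos.2 (pow_le_pow_left₀ (hu l) h _))
      · exact mul_nonneg (sub_nonneg.2 (pow_le_pow_left₀ (hu l') h _))
          (sub_nonneg.2 (pow_le_pow_left₀ (hu l') h _))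
    simp only [pow_add]
    nlinarith
  simp only [add_mul, Finset.sum_add_distrib] at h4
  linarith

theorem one_sub_mem_symProj {E : Matrix ι ι ℂ} (hE : E ∈ symProj ι) : 1 - E ∈ symProj ι := by
  obtain ⟨hT, hH, hI⟩ := hE
  refine ⟨by rw [transpose_sub, hT, transpose_one], by rw [conjTranspose_sub, hH, conjTranspose_one],
    ?_⟩
  rw [sub_mul, mul_sub, mul_sub, hI]; simp

theorem twist_diagonal {E : Matrix ι ι ℂ} (hE : E ∈ symProj ι) (Z : Matrix ι κ ℂ) (x y : κ → ℂ) :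
    twist Z E (diagonal x) (diagonal y) = ∑ l, ∑ l', x l * y l' *
      ((Zᵀ * E * Z) l l' * star ((Zᵀ * (1 - E : Matrix ι ι ℂ) * Z) l l')) := by
  have h1 : (Zᵀ * (1 - E) * Z)ᴴ = Zᴴ * (1 - E) * Zᴴᵀ := by
    obtain ⟨_, hH, _⟩ := one_sub_mem_symProj hE
    rw [conjTranspose_mul, conjTranspose_mul, hH, Matrix.mul_assoc]
    congr 1
  have h2 : twist Z E (diagonal x) (diagonal y) =
      ((diagonal x * (Zᵀ * E * Z)) * (diagonal y * (Zᵀ * (1 - E) * Z)ᴴ)).trace := by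
    rw [h1, twist, infl, infl, transpose_mul, transpose_mul, diagonal_transpose]
    simp only [Matrix.mul_assoc]
    rw [trace_mul_comm Zᴴᵀ]
    simp only [Matrix.mul_assoc]
  rw [h2]
  simp only [trace, diag, Matrix.mul_apply (M := diagonal x * _), Matrix.diagonal_mul,
    conjTranspose_apply]
  refine Finset.sum_congr rfl fun l _ => Finset.sum_congr rfl fun l' _ => ?_
  ring

theorem norm_twist_le {E : Matrix ι ι ℂ} (hE : E ∈ symProj ι) {Z : Matrix ι κ ℂ} (hZ1 : Zᴴ * Z = 1)
    {φ τ p : κ → ℝ} (hφ0 : ∀ l, 0 ≤ φ l) (hφ1 : ∀ l, φ l ≤ 1)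
    (hZ : Zᴴ * E * Z = diagonal fun l => (φ l : ℂ))
    (hp : ∀ l, 0 ≤ p l) (hpφ : ∀ l, p l * φ l ≤ 1) (hτ : ∀ l, τ l = p l * (1 - φ l)) (i j : ℕ) :
    ‖twist Z E (diagonal fun l => ((p l * τ l ^ i : ℝ) : ℂ))
      (diagonal fun l => ((p l * τ l ^ j : ℝ) : ℂ))‖ ≤ ∑ l, τ l ^ (i + j + 1) := by
  have hτ0 : ∀ l, 0 ≤ τ l := fun l => by
    rw [hτ]; exact mul_nonneg (hp l) (sub_nonneg.2 (hφ1 l))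
  have hZ' : Zᴴ * (1 - E) * Z = diagonal fun l => ((1 - φ l : ℝ) : ℂ) := by
    rw [Matrix.mul_sub, Matrix.sub_mul, Matrix.mul_one, hZ1, hZ, ← diagonal_one, diagonal_sub]
    simp
  obtain ⟨C, hCs, hC1, hC⟩ := bessel_normalized hE hφ0 hZ
  obtain ⟨C', hCs', hC1', hC'⟩ := bessel_normalized (one_sub_mem_symProj hE)
    (fun l => sub_nonneg.2 (hφ1 l)) hZ'
  set u : κ → ℝ := fun l => √(τ l) with hu
  have hu0 : ∀ l, 0 ≤ u l := fun l => Real.sqrt_nonneg _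
  have hu2 : ∀ l, u l ^ 2 = τ l := fun l => Real.sq_sqrt (hτ0 l)
  have hpu : ∀ l, p l * (√(φ l) * √(1 - φ l)) ≤ u l := by
    intro l
    apply Real.le_sqrt_of_sq_le
    rw [mul_pow, mul_pow, Real.sq_sqrt (hφ0 l), Real.sq_sqrt (sub_nonneg.2 (hφ1 l)), hτ]
    have : p l * (1 - φ l) * (p l * φ l) ≤ p l * (1 - φ l) * 1 :=
      mul_le_mul_of_nonneg_left (hpφ l) (mul_nonneg (hp l) (sub_nonneg.2 (hφ1 l)))
    nlinarith
  have hCn : ∀ l l', |C l l'| * |C' l l'| ≤ (C l l' ^ 2 + C' l l' ^ 2) / 2 := by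
    intro l l'
    rw [← sq_abs (C l l'), ← sq_abs (C' l l')]
    nlinarith [sq_nonneg (|C l l'| - |C' l l'|)]
  rw [twist_diagonal hE]
  have hterm : ∀ l l', ‖((p l * τ l ^ i : ℝ) : ℂ) * ((p l' * τ l' ^ j : ℝ) : ℂ) *
      ((Zᵀ * E * Z) l l' * star ((Zᵀ * (1 - E : Matrix ι ι ℂ) * Z) l l'))‖ ≤
      (u l ^ (2 * i + 1) * u l' ^ (2 * j + 1) * C l l' ^ 2 +
        u l ^ (2 * i + 1) * u l' ^ (2 * j + 1) * C' l l' ^ 2) / 2 := by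
    intro l l'
    have e1 : ‖((p l * τ l ^ i : ℝ) : ℂ) * ((p l' * τ l' ^ j : ℝ) : ℂ) *
      ((Zᵀ * E * Z) l l' * star ((Zᵀ * (1 - E : Matrix ι ι ℂ) * Z) l l'))‖ =
      (p l * τ l ^ i) * (p l' * τ l' ^ j) *
      ((√(φ l) * √(φ l') * |C l l'|) * (√(1 - φ l) * √(1 - φ l') * |C' l l'|)) := by
      rw [norm_mul, norm_mul, norm_mul, norm_star, Complex.norm_real, Complex.norm_real,
        ← abs_norm ((Zᵀ * E * Z) l l'), hC, ← abs_norm ((Zᵀ * (1 - E : Matrix ι ι ℂ) * Z) l l'), hC']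
      simp only [Real.norm_eq_abs, abs_mul, abs_pow, abs_of_nonneg (hp _), abs_of_nonneg (hτ0 _),
        abs_of_nonneg (Real.sqrt_nonneg _)]
    have e2 : (p l * τ l ^ i) * (p l' * τ l' ^ j) *
      ((√(φ l) * √(φ l') * |C l l'|) * (√(1 - φ l) * √(1 - φ l') * |C' l l'|)) =
      (τ l ^ i * τ l' ^ j) * ((p l * (√(φ l) * √(1 - φ l))) * (p l' * (√(φ l') * √(1 - φ l')))) *
      (|C l l'| * |C' l l'|) := by ring
    have e3 : (u l ^ (2 * i + 1) * u l' ^ (2 * j + 1) * C l l' ^ 2 +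
        u l ^ (2 * i + 1) * u l' ^ (2 * j + 1) * C' l l' ^ 2) / 2 =
        (τ l ^ i * τ l' ^ j) * (u l * u l') * ((C l l' ^ 2 + C' l l' ^ 2) / 2) := by
      rw [← hu2, ← hu2]; ring
    rw [e1, e2, e3]
    have := hp l
    have := hp l'
    have := hτ0 l
    have := hτ0 l'
    have := hu0 l
    have := hu0 l'
    refine mul_le_mul (mul_le_mul_of_nonneg_left (mul_le_mul (hpu l) (hpu l') (by positivity)
      (hu0 l)) (by positivity)) (hCn l l') (by positivity) (by positivity)
  have h1 := sum_substochastic_le hCs hC1 hu0 (2 * i + 1) (2 * j + 1)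
  have h2 := sum_substochastic_le hCs' hC1' hu0 (2 * i + 1) (2 * j + 1)
  have h3 : ∑ l, u l ^ (2 * i + 1 + (2 * j + 1)) = ∑ l, τ l ^ (i + j + 1) := by
    refine Finset.sum_congr rfl fun l _ => ?_
    rw [← hu2, ← pow_mul]; congr 1; ring
  refine (norm_sum_le _ _).trans ((Finset.sum_le_sum fun l _ => (norm_sum_le _ _).trans
    (Finset.sum_le_sum fun l' _ => hterm l l')).trans ?_)
  simp only [← Finset.sum_div, Finset.sum_add_distrib]
  linarith

end TwistBound

section LoopBound

variable {ι κ : Type*} [Fintype ι] [DecidableEq ι] [Fintype κ] [DecidableEq κ]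

/-- A real diagonal matrix with complex entries. -/
def diagR {κ : Type*} [DecidableEq κ] (d : κ → ℝ) : Matrix κ κ ℂ := diagonal fun l => (d l : ℂ)

theorem diagR_mul (d e : κ → ℝ) : diagR d * diagR e = diagR (fun l => d l * e l) := by
  simp [diagR, diagonal_mul_diagonal]

theorem diagR_pow (d : κ → ℝ) (i : ℕ) : diagR d ^ i = diagR (fun l => d l ^ i) := by
  simp [diagR, diagonal_pow, Pi.pow_def]

theorem diagR_add (d e : κ → ℝ) : diagR d + diagR e = diagR (fun l => d l + e l) := by
  simp [diagR, diagonal_add]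

theorem smul_diagR (c : ℝ) (d : κ → ℝ) : (c : ℂ) • diagR d = diagR (fun l => c * d l) := by
  simp [diagR, ← diagonal_smul, Pi.smul_def]

theorem diagR_one : diagR (fun _ : κ => 1) = 1 := by simp [diagR]

theorem trace_diagR (d : κ → ℝ) : (diagR d).trace = ((∑ l, d l : ℝ) : ℂ) := by
  simp [diagR, trace_diagonal]

theorem infl_mul_infl {V : Matrix ι κ ℂ} (hV : Vᴴ * V = 1) (A B : Matrix κ κ ℂ) :
    infl V A * infl V B = infl V (A * B) := by
  simp only [infl, Matrix.mul_assoc]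
  rw [← Matrix.mul_assoc Vᴴ V, hV, Matrix.one_mul]

theorem infl_add (V : Matrix ι κ ℂ) (A B : Matrix κ κ ℂ) : infl V (A + B) = infl V A + infl V B := by
  simp [infl, Matrix.mul_add, Matrix.add_mul]

theorem infl_smul (V : Matrix ι κ ℂ) (c : ℂ) (A : Matrix κ κ ℂ) : infl V (c • A) = c • infl V A := by
  simp [infl]

theorem infl_one {Y : Matrix κ κ ℂ} (hY : Y * Yᴴ = 1) : infl Y 1 = 1 := by simp [infl, hY]

theorem infl_pow {Y : Matrix κ κ ℂ} (hY : Yᴴ * Y = 1) (hY' : Y * Yᴴ = 1) (A : Matrix κ κ ℂ) (i : ℕ) :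
    infl Y A ^ i = infl Y (A ^ i) := by
  induction i with
  | zero => simp [infl_one hY']
  | succ i ih => rw [pow_succ, ih, infl_mul_infl hY, pow_succ]

/-- Real power sums. -/
def pS (τ : κ → ℝ) (i : ℕ) : ℝ := ∑ l, τ l ^ i

/-- Products of real power sums. -/
def pProd (τ : κ → ℝ) : List ℕ → ℝ
  | [] => 1
  | j :: l => pS τ j * pProd τ l

/-- Diagonal entries of `powGrad` in an eigenbasis. -/
def pGrad (p τ : κ → ℝ) : List ℕ → κ → ℝ
  | [] => 0
  | j :: l => fun x => pS τ j * pGrad p τ l x +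
      (j * pProd τ l) * (p x * τ x ^ (j - 1) + p x * τ x ^ j)

theorem pS_nonneg {τ : κ → ℝ} (hτ : ∀ l, 0 ≤ τ l) (i : ℕ) : 0 ≤ pS τ i :=
  Finset.sum_nonneg fun l _ => pow_nonneg (hτ l) i

theorem pProd_nonneg {τ : κ → ℝ} (hτ : ∀ l, 0 ≤ τ l) (l : List ℕ) : 0 ≤ pProd τ l := by
  induction l with
  | nil => exact zero_le_one
  | cons j l ih => exact mul_nonneg (pS_nonneg hτ j) ih

theorem pS_add_le {τ : κ → ℝ} (hτ : ∀ l, 0 ≤ τ l) (i j : ℕ) : pS τ (i + j) ≤ pS τ i * pS τ j := by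
  unfold pS
  rw [Finset.sum_mul_sum]
  refine Finset.sum_le_sum fun l _ => ?_
  rw [pow_add]
  exact Finset.single_le_sum (f := fun l' => τ l ^ i * τ l' ^ j)
    (fun l' _ => mul_nonneg (pow_nonneg (hτ l) i) (pow_nonneg (hτ l') j)) (Finset.mem_univ l)

/-- Diagonalization data for the compression `compr V E` of a projection. -/
structure SpecData (V : Matrix ι κ ℂ) (E : Matrix ι ι ℂ) (ε : ℝ) (Y : Matrix κ κ ℂ)
    (φ p τ : κ → ℝ) : Prop where
  orth : Yᴴ * Y = 1
  orth' : Y * Yᴴ = 1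
  eq : compr V E = infl Y (diagR φ)
  nonneg : ∀ l, 0 ≤ φ l
  le_one : ∀ l, φ l ≤ 1
  p_mul : ∀ l, p l * (φ l + ε) = 1
  p_nonneg : ∀ l, 0 ≤ p l
  p_mul_le : ∀ l, p l * φ l ≤ 1
  tau_eq : ∀ l, τ l = p l * (1 - φ l)
  tau_nonneg : ∀ l, 0 ≤ τ l

theorem exists_diagonalization {V : Matrix ι κ ℂ} (hV : Vᴴ * V = 1) {E : Matrix ι ι ℂ}
    (hE : E ∈ symProj ι) :
    ∃ (Y : Matrix κ κ ℂ) (φ : κ → ℝ), Yᴴ * Y = 1 ∧ Y * Yᴴ = 1 ∧ compr V E = infl Y (diagR φ) ∧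
      (∀ l, 0 ≤ φ l) ∧ ∀ l, φ l ≤ 1 := by
  obtain ⟨hT, hH, hI⟩ := hE
  have hΦ : (compr V E).IsHermitian := by
    unfold compr Matrix.IsHermitian
    rw [conjTranspose_mul, conjTranspose_mul, hH, conjTranspose_conjTranspose, Matrix.mul_assoc]
  set Y : Matrix κ κ ℂ := hΦ.eigenvectorUnitary.1 with hY
  have h1 : Yᴴ * Y = 1 := by
    have := (Matrix.mem_unitaryGroup_iff').1 hΦ.eigenvectorUnitary.2
    rwa [star_eq_conjTranspose] at this
  have h2 : Y * Yᴴ = 1 := by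
    have := (Matrix.mem_unitaryGroup_iff).1 hΦ.eigenvectorUnitary.2
    rwa [star_eq_conjTranspose] at this
  have h3 : compr V E = infl Y (diagR hΦ.eigenvalues) := by
    have := hΦ.spectral_theorem
    rw [Unitary.conjStarAlgAut_apply] at this
    exact this.trans rfl
  clear_value Y
  generalize hΦ.eigenvalues = ψ at h3
  have h4 : Yᴴ * (Vᴴ * E * V) * Y = diagR ψ := by
    rw [compr, infl] at h3
    calc Yᴴ * (Vᴴ * E * V) * Y = (Yᴴ * Y) * diagR ψ * (Yᴴ * Y) := by
          rw [h3]; simp only [Matrix.mul_assoc]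
      _ = _ := by rw [h1, Matrix.one_mul, Matrix.mul_one]
  have key : ∀ F : Matrix ι ι ℂ, Fᴴ = F → F * F = F →
      (F * (V * Y))ᴴ * (F * (V * Y)) = Yᴴ * (Vᴴ * F * V) * Y := by
    intro F hF hFF
    rw [conjTranspose_mul, hF, conjTranspose_mul]
    calc Yᴴ * Vᴴ * F * (F * (V * Y)) = Yᴴ * Vᴴ * (F * F) * (V * Y) := by
          simp only [Matrix.mul_assoc]
      _ = _ := by rw [hFF]; simp only [Matrix.mul_assoc]
  refine ⟨Y, ψ, h1, h2, h3, fun l => ?_, fun l => ?_⟩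
  · have h5 := congrFun (congrFun ((key E hH hI).trans h4) l) l
    rw [conjTranspose_mul_self_apply_self, diagR, diagonal_apply_eq] at h5
    rw [← Complex.ofReal_inj.1 h5]
    positivity
  · have h6 : Yᴴ * (Vᴴ * (1 - E) * V) * Y = 1 - diagR ψ := by
      rw [Matrix.mul_sub, Matrix.sub_mul, Matrix.mul_sub, Matrix.sub_mul, h4, Matrix.mul_one, hV,
        Matrix.mul_one, h1]
    have hE' := one_sub_mem_symProj (ι := ι) ⟨hT, hH, hI⟩
    have h5 := congrFun (congrFun ((key (1 - E) hE'.2.1 hE'.2.2).trans h6) l) l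
    rw [conjTranspose_mul_self_apply_self, diagR, Matrix.sub_apply, one_apply_eq,
      diagonal_apply_eq, ← Complex.ofReal_one, ← Complex.ofReal_sub] at h5
    rw [← sub_nonneg, ← Complex.ofReal_inj.1 h5]
    positivity

theorem SpecData.of_diagonalization {V : Matrix ι κ ℂ} {E : Matrix ι ι ℂ} {Y : Matrix κ κ ℂ}
    {φ : κ → ℝ} (h1 : Yᴴ * Y = 1) (h2 : Y * Yᴴ = 1) (h3 : compr V E = infl Y (diagR φ))
    (h4 : ∀ l, 0 ≤ φ l) (h5 : ∀ l, φ l ≤ 1) {ε : ℝ} (hε : 0 < ε) :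
    SpecData V E ε Y φ (fun l => (φ l + ε)⁻¹) fun l => (φ l + ε)⁻¹ * (1 - φ l) := by
  refine ⟨h1, h2, h3, h4, h5, fun l => ?_, fun l => ?_, fun l => ?_, fun l => rfl, fun l => ?_⟩ <;>
  have h6 : 0 < φ l + ε := add_pos_of_nonneg_of_pos (h4 l) hε
  · exact inv_mul_cancel₀ h6.ne'
  · positivity
  · rw [inv_mul_le_iff₀ h6]; linarith
  · have := sub_nonneg.2 (h5 l)
    positivity

theorem SpecData.exists_of_pos {V : Matrix ι κ ℂ} (hV : Vᴴ * V = 1) {E : Matrix ι ι ℂ}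
    (hE : E ∈ symProj ι) {ε : ℝ} (hε : 0 < ε) :
    ∃ Y φ p τ, SpecData V E ε Y φ p τ := by
  obtain ⟨Y, φ, h1, h2, h3, h4, h5⟩ := exists_diagonalization hV hE
  exact ⟨Y, φ, _, _, .of_diagonalization h1 h2 h3 h4 h5 hε⟩

namespace SpecData

variable {V : Matrix ι κ ℂ} {E : Matrix ι ι ℂ} {ε : ℝ} {Y : Matrix κ κ ℂ} {φ p τ : κ → ℝ}

theorem isUnit (h : SpecData V E ε Y φ p τ) :
    infl Y (diagR p) * (compr V E + (ε : ℂ) • 1) = 1 := by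
  rw [h.eq, ← infl_one h.orth', ← infl_smul, ← infl_add, infl_mul_infl h.orth, ← diagR_one,
    smul_diagR, diagR_add, diagR_mul]
  congr 2
  ext l
  have := h.p_mul l
  simp [this]

theorem resv_eq (h : SpecData V E ε Y φ p τ) : resv ε (compr V E) = infl Y (diagR p) :=
  Matrix.inv_eq_left_inv h.isUnit

theorem tanSq_eq (h : SpecData V E ε Y φ p τ) : tanSq ε (compr V E) = infl Y (diagR τ) := by
  rw [tanSq, h.resv_eq, ← infl_smul, smul_diagR, sub_eq_iff_eq_add, ← infl_one h.orth', ← infl_add,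
    ← diagR_one, diagR_add]
  congr 2
  ext l
  have h1 := h.p_mul l
  rw [h.tau_eq l]
  linarith

theorem tanSq_pow_eq (h : SpecData V E ε Y φ p τ) (i : ℕ) :
    tanSq ε (compr V E) ^ i = infl Y (diagR fun l => τ l ^ i) := by
  rw [h.tanSq_eq, infl_pow h.orth h.orth', diagR_pow]

theorem resvPow_eq (h : SpecData V E ε Y φ p τ) (i : ℕ) :
    resvPow ε (compr V E) i = infl Y (diagR fun l => p l * τ l ^ i) := by
  rw [resvPow, h.tanSq_pow_eq, h.resv_eq, infl_mul_infl h.orth, diagR_mul]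

theorem powSum_eq (h : SpecData V E ε Y φ p τ) (i : ℕ) :
    powSum ε (compr V E) i = (pS τ i : ℝ) := by
  rw [powSum, h.tanSq_pow_eq, trace_infl h.orth, trace_diagR, pS]

theorem powProd_eq (h : SpecData V E ε Y φ p τ) (l : List ℕ) :
    powProd ε (compr V E) l = (pProd τ l : ℝ) := by
  induction l with
  | nil => simp [powProd, pProd]
  | cons j l ih => rw [powProd, pProd, ih, h.powSum_eq, Complex.ofReal_mul]

theorem powGrad_eq (h : SpecData V E ε Y φ p τ) (l : List ℕ) :
    powGrad ε (compr V E) l = infl Y (diagR (pGrad p τ l)) := by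
  induction l with
  | nil => simp [powGrad, pGrad, diagR, infl]
  | cons j l ih =>
    rw [powGrad, ih, h.powSum_eq, h.powProd_eq, h.resvPow_eq, h.resvPow_eq, ← infl_add, diagR_add,
      ← Complex.ofReal_natCast, ← Complex.ofReal_mul, ← infl_smul, ← infl_smul, smul_diagR,
      smul_diagR, ← infl_add, diagR_add]
    rfl

theorem twist_infl (V : Matrix ι κ ℂ) (E : Matrix ι ι ℂ) (Y A B : Matrix κ κ ℂ) :
    twist V E (infl Y A) (infl Y B) = twist (V * Y) E A B := by
  simp only [twist, infl, conjTranspose_mul, Matrix.mul_assoc]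

theorem norm_twist_resvPow_le (h : SpecData V E ε Y φ p τ) (hV : Vᴴ * V = 1) (hE : E ∈ symProj ι)
    (i j : ℕ) :
    ‖twist V E (resvPow ε (compr V E) i) (resvPow ε (compr V E) j)‖ ≤ pS τ (i + j + 1) := by
  rw [h.resvPow_eq, h.resvPow_eq, twist_infl]
  refine norm_twist_le hE ?_ h.nonneg h.le_one ?_ h.p_nonneg h.p_mul_le h.tau_eq i j
  · rw [conjTranspose_mul, Matrix.mul_assoc, ← Matrix.mul_assoc Vᴴ, hV, Matrix.one_mul, h.orth]
  · have h1 := h.eq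
    rw [compr, infl] at h1
    rw [conjTranspose_mul]
    calc Yᴴ * Vᴴ * E * (V * Y) = Yᴴ * (Vᴴ * E * V) * Y := by simp only [Matrix.mul_assoc]
      _ = (Yᴴ * Y) * diagR φ * (Yᴴ * Y) := by rw [h1]; simp only [Matrix.mul_assoc]
      _ = _ := by rw [h.orth, Matrix.one_mul, Matrix.mul_one]; rfl

theorem twist_smul (V : Matrix ι κ ℂ) (E : Matrix ι ι ℂ) (c : ℂ) (A B : Matrix κ κ ℂ) :
    twist V E A (c • B) = c * twist V E A B := by
  simp [twist, infl_smul]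

theorem twist_add (V : Matrix ι κ ℂ) (E : Matrix ι ι ℂ) (A B C : Matrix κ κ ℂ) :
    twist V E A (B + C) = twist V E A B + twist V E A C := by
  simp [twist, infl_add, mul_add, add_mul]

/-- The factor controlling the contribution of the gradient of a product of power sums. -/
noncomputable def gradFactor (τ : κ → ℝ) (m : ℕ) : ℝ := pS τ (m + 1) + if m = 0 then 1 else pS τ m

theorem pS_add_pS_le (hτ : ∀ l, 0 ≤ τ l) (m j : ℕ) :
    pS τ (m + j) + pS τ (m + j + 1) ≤ gradFactor τ m * pS τ j := by
  have h1 := pS_add_le hτ (m + 1) j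
  rw [show m + 1 + j = m + j + 1 by ring] at h1
  have h2 := pS_add_le hτ m j
  unfold gradFactor
  split_ifs with hm
  · subst hm
    rw [zero_add] at *
    linarith
  · linarith

theorem norm_twist_powGrad_le (h : SpecData V E ε Y φ p τ) (hV : Vᴴ * V = 1) (hE : E ∈ symProj ι)
    (m : ℕ) (l : List ℕ) :
    ‖twist V E (resvPow ε (compr V E) m) (powGrad ε (compr V E) l)‖ ≤
      l.sum * gradFactor τ m * pProd τ l := by
  induction l with
  | nil => simp [powGrad, twist, infl]
  | cons j l ih =>
    rw [powGrad, twist_add, twist_smul, twist_smul, twist_add, h.powSum_eq, h.powProd_eq, pProd]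
    have h1 := h.norm_twist_resvPow_le hV hE m (j - 1)
    have h2 := h.norm_twist_resvPow_le hV hE m j
    have h3 := pS_add_pS_le h.tau_nonneg m j
    have hS := pS_nonneg h.tau_nonneg j
    have hP := pProd_nonneg h.tau_nonneg l
    have h4 : ‖(j : ℂ) * (pProd τ l : ℂ) * (twist V E (resvPow ε (compr V E) m)
        (resvPow ε (compr V E) (j - 1)) + twist V E (resvPow ε (compr V E) m)
        (resvPow ε (compr V E) j))‖ ≤ j * pProd τ l * (gradFactor τ m * pS τ j) := by
      rcases Nat.eq_zero_or_pos j with hj | hj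
      · simp [hj]
      · rw [norm_mul, norm_mul, Complex.norm_natCast, Complex.norm_real, Real.norm_of_nonneg hP]
        refine mul_le_mul_of_nonneg_left ((norm_add_le _ _).trans ?_) (by positivity)
        rw [show m + (j - 1) + 1 = m + j by omega] at h1
        linarith
    refine (norm_add_le _ _).trans ?_
    rw [norm_mul, Complex.norm_real, Real.norm_of_nonneg hS]
    have h5 := mul_le_mul_of_nonneg_left ih hS
    rw [List.sum_cons]
    rw [Nat.cast_add]
    nlinarith

theorem sum_pGrad_le (h : SpecData V E ε Y φ p τ) (m : ℕ) (l : List ℕ) :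
    ∑ x, (φ x * (p x * τ x ^ m) * (1 - φ x)) * pGrad p τ l x ≤
      l.sum * gradFactor τ m * pProd τ l := by
  induction l with
  | nil => simp [pGrad]
  | cons j l ih =>
    have hS := pS_nonneg h.tau_nonneg j
    have hP := pProd_nonneg h.tau_nonneg l
    have h3 := pS_add_pS_le h.tau_nonneg m j
    have h1 : ∑ x, (φ x * (p x * τ x ^ m) * (1 - φ x)) * pGrad p τ (j :: l) x =
        pS τ j * ∑ x, (φ x * (p x * τ x ^ m) * (1 - φ x)) * pGrad p τ l x +
        j * pProd τ l * ∑ x, (φ x * (p x * τ x ^ m) * (1 - φ x)) *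
          (p x * τ x ^ (j - 1) + p x * τ x ^ j) := by
      rw [Finset.mul_sum, Finset.mul_sum, ← Finset.sum_add_distrib]
      refine Finset.sum_congr rfl fun x _ => ?_
      simp only [pGrad]
      ring
    have h2 : j * pProd τ l * ∑ x, (φ x * (p x * τ x ^ m) * (1 - φ x)) *
          (p x * τ x ^ (j - 1) + p x * τ x ^ j) ≤ j * pProd τ l * (gradFactor τ m * pS τ j) := by
      rcases Nat.eq_zero_or_pos j with hj | hj
      · simp [hj]
      · refine mul_le_mul_of_nonneg_left (le_trans ?_ h3) (by positivity)
        unfold pS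
        rw [← Finset.sum_add_distrib]
        refine Finset.sum_le_sum fun x _ => ?_
        have ht := h.tau_nonneg x
        have e1 : (φ x * (p x * τ x ^ m) * (1 - φ x)) * (p x * τ x ^ (j - 1) + p x * τ x ^ j) =
            (p x * φ x) * (τ x ^ (m + j) + τ x ^ (m + j + 1)) := by
          obtain ⟨i, rfl⟩ : ∃ i, j = i + 1 := ⟨j - 1, by omega⟩
          have := h.tau_eq x
          simp only [Nat.add_sub_cancel]
          calc _ = (p x * φ x) * (τ x ^ m * τ x ^ i + τ x ^ m * τ x ^ i * τ x) * (p x * (1 - φ x)) := by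
                ring
            _ = _ := by rw [← this]; ring
        rw [e1]
        exact mul_le_of_le_one_left (by positivity) (h.p_mul_le x)
    have h5 := mul_le_mul_of_nonneg_left ih hS
    rw [h1, List.sum_cons, pProd]
    rw [Nat.cast_add]
    nlinarith

theorem le_re_loopFn (h : SpecData V E ε Y φ p τ) (hV : Vᴴ * V = 1) (hE : E ∈ symProj ι) {N : ℝ}
    (hN : E.trace = N) (hNn : N ≤ Fintype.card ι) (m : ℕ) (l : List ℕ) :
    (N * pS τ (m + 1) - (Fintype.card ι - N) * pS τ m -
      ((∑ i ∈ Finset.range (m + 1), (pS τ i * pS τ (m - i + 1) + pS τ (m + 1))) +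
        ∑ i ∈ Finset.range m, (pS τ i * pS τ (m - i) + pS τ m))) * pProd τ l -
      2 * l.sum * gradFactor τ m * pProd τ l ≤ (loopFn V ε m l E).re := by
  have htr : ∀ i, (resvPow ε (compr V E) i).trace = ((∑ x, p x * τ x ^ i : ℝ) : ℂ) := by
    intro i; rw [h.resvPow_eq, trace_infl h.orth, trace_diagR]
  have htrΦ : ∀ i, (compr V E * resvPow ε (compr V E) i).trace =
      ((∑ x, φ x * (p x * τ x ^ i) : ℝ) : ℂ) := by
    intro i
    rw [h.resvPow_eq, h.eq, infl_mul_infl h.orth, diagR_mul, trace_infl h.orth, trace_diagR]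
  have hdiff : ∀ i, (∑ x, p x * τ x ^ i) - ∑ x, φ x * (p x * τ x ^ i) = pS τ (i + 1) := by
    intro i
    rw [pS, ← Finset.sum_sub_distrib]
    refine Finset.sum_congr rfl fun x _ => ?_
    rw [pow_succ, h.tau_eq x]; ring
  have hΦle : ∀ i, ∑ x, φ x * (p x * τ x ^ i) ≤ pS τ i := by
    intro i
    refine Finset.sum_le_sum fun x _ => ?_
    have := pow_nonneg (h.tau_nonneg x) i
    calc φ x * (p x * τ x ^ i) = (p x * φ x) * τ x ^ i := by ring
      _ ≤ _ := mul_le_of_le_one_left this (h.p_mul_le x)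
  have hgrad : (compr V E * (resvPow ε (compr V E) m * powGrad ε (compr V E) l)).trace -
      (compr V E * resvPow ε (compr V E) m * compr V E * powGrad ε (compr V E) l).trace =
      ((∑ x, (φ x * (p x * τ x ^ m) * (1 - φ x)) * pGrad p τ l x : ℝ) : ℂ) := by
    rw [h.powGrad_eq, h.resvPow_eq, h.eq]
    simp only [infl_mul_infl h.orth, diagR_mul, trace_infl h.orth, trace_diagR]
    rw [← Complex.ofReal_sub, ← Finset.sum_sub_distrib]
    congr 1
    refine Finset.sum_congr rfl fun x _ => ?_
    ring
  have hsum : ∀ (a b : ℕ), ((((∑ x, φ x * (p x * τ x ^ a) : ℝ) : ℂ) *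
      (((∑ x, p x * τ x ^ b : ℝ) : ℂ) - ((∑ x, φ x * (p x * τ x ^ b) : ℝ) : ℂ)) +
      twist V E (resvPow ε (compr V E) a) (resvPow ε (compr V E) b))).re ≤
      pS τ a * pS τ (b + 1) + pS τ (a + b + 1) := by
    intro a b
    rw [← Complex.ofReal_sub, hdiff, ← Complex.ofReal_mul, Complex.add_re, Complex.ofReal_re]
    exact add_le_add (mul_le_mul_of_nonneg_right (hΦle a) (pS_nonneg h.tau_nonneg _))
      ((Complex.re_le_norm _).trans (h.norm_twist_resvPow_le hV hE a b))
  have hP := pProd_nonneg h.tau_nonneg l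
  have h1 : ∑ i ∈ Finset.range (m + 1), ((((∑ x, φ x * (p x * τ x ^ i) : ℝ) : ℂ) *
      (((∑ x, p x * τ x ^ (m - i) : ℝ) : ℂ) - ((∑ x, φ x * (p x * τ x ^ (m - i)) : ℝ) : ℂ)) +
      twist V E (resvPow ε (compr V E) i) (resvPow ε (compr V E) (m - i)))).re ≤
      ∑ i ∈ Finset.range (m + 1), (pS τ i * pS τ (m - i + 1) + pS τ (m + 1)) := by
    refine Finset.sum_le_sum fun i hi => ?_
    have := hsum i (m - i)
    rwa [show i + (m - i) + 1 = m + 1 by have := Finset.mem_range.1 hi; omega] at this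
  have h2 : ∑ i ∈ Finset.range m, ((((∑ x, φ x * (p x * τ x ^ i) : ℝ) : ℂ) *
      (((∑ x, p x * τ x ^ (m - 1 - i) : ℝ) : ℂ) -
        ((∑ x, φ x * (p x * τ x ^ (m - 1 - i)) : ℝ) : ℂ)) +
      twist V E (resvPow ε (compr V E) i) (resvPow ε (compr V E) (m - 1 - i)))).re ≤
      ∑ i ∈ Finset.range m, (pS τ i * pS τ (m - i) + pS τ m) := by
    refine Finset.sum_le_sum fun i hi => ?_
    have := hsum i (m - 1 - i)
    have hi := Finset.mem_range.1 hi
    rwa [show i + (m - 1 - i) + 1 = m by omega, show m - 1 - i + 1 = m - i by omega] at this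
  have h3 := (Complex.re_le_norm _).trans (h.norm_twist_powGrad_le hV hE m l)
  have h4 := h.sum_pGrad_le m l
  have h5 : N * pS τ (m + 1) - (Fintype.card ι - N) * pS τ m ≤
      N * (∑ x, p x * τ x ^ m) - Fintype.card ι * ∑ x, φ x * (p x * τ x ^ m) := by
    rw [← hdiff m]
    have := mul_le_mul_of_nonneg_left (hΦle m) (sub_nonneg.2 hNn)
    linarith
  rw [loopFn, hN, hgrad, h.powProd_eq]
  simp only [htr, htrΦ]
  rw [Complex.sub_re, Complex.re_mul_ofReal, Complex.sub_re, Complex.add_re, Complex.re_sum,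
    Complex.re_sum, Complex.sub_re, Complex.add_re, Complex.ofReal_re, ← Complex.ofReal_mul,
    ← Complex.ofReal_natCast, ← Complex.ofReal_mul, Complex.ofReal_re, Complex.ofReal_re]
  have h6 := mul_le_mul_of_nonneg_right (sub_le_sub h5 (add_le_add h1 h2)) hP
  linarith

end SpecData

end LoopBound

section Invariance

open MeasureTheory

variable {ι κ : Type*} [Fintype ι] [DecidableEq ι] [Fintype κ] [DecidableEq κ]

theorem isClosed_symProj : IsClosed (symProj ι) := by
  refine IsClosed.inter ?_ (IsClosed.inter ?_ ?_)
  · exact isClosed_eq (continuous_id.matrix_transpose) continuous_id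
  · exact isClosed_eq (continuous_id.matrix_conjTranspose) continuous_id
  · exact isClosed_eq (continuous_id.matrix_mul continuous_id) continuous_id

theorem norm_apply_le_of_mem_symProj {E : Matrix ι ι ℂ} (hE : E ∈ symProj ι) (i j : ι) :
    ‖E i j‖ ≤ 1 := by
  obtain ⟨-, hH, hI⟩ := hE
  have h1 := conjTranspose_mul_self_apply_self E j
  rw [hH, hI] at h1
  set s : ℝ := ∑ x, ‖E x j‖ ^ 2
  have h2 : ∀ x, ‖E x j‖ ^ 2 ≤ s := fun x =>
    Finset.single_le_sum (f := fun x => ‖E x j‖ ^ 2) (fun _ _ => by positivity) (Finset.mem_univ x)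
  have h3 := h2 j
  rw [h1, Complex.norm_real, Real.norm_eq_abs, sq_abs] at h3
  have h4 := h2 i
  have h5 : s ≤ 1 := by
    by_contra h
    nlinarith
  nlinarith [norm_nonneg (E i j)]

theorem isCompact_symProj : IsCompact (symProj ι) := by
  refine IsCompact.of_isClosed_subset
    (isCompact_univ_pi fun _ : ι => isCompact_univ_pi fun _ : ι =>
      isCompact_closedBall (0 : ℂ) 1) isClosed_symProj ?_
  intro E hE
  exact fun i _ j _ => mem_closedBall_zero_iff.2 (norm_apply_le_of_mem_symProj hE i j)

theorem isUnit_compr_add {V : Matrix ι κ ℂ} (hV : Vᴴ * V = 1) {E : Matrix ι ι ℂ}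
    (hE : E ∈ symProj ι) {ε : ℝ} (hε : 0 < ε) : IsUnit (compr V E + (ε : ℂ) • 1) := by
  obtain ⟨Y, φ, p, τ, h⟩ := SpecData.exists_of_pos hV hE hε
  exact IsUnit.of_mul_eq_one_right _ h.isUnit

section
attribute [local instance] Matrix.linftyOpNormedRing Matrix.linftyOpNormedAlgebra
attribute [local instance] Matrix.linftyOpNormedAddCommGroup Matrix.linftyOpNormedSpace

theorem continuous_compr (V : Matrix ι κ ℂ) : Continuous (compr V) :=
  (continuous_const.matrix_mul continuous_id).matrix_mul continuous_const

theorem continuousOn_resv {V : Matrix ι κ ℂ} (hV : Vᴴ * V = 1) {ε : ℝ} (hε : 0 < ε) :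
    ContinuousOn (fun E => resv ε (compr V E)) (symProj ι) := by
  intro E hE
  unfold resv
  simp only [Matrix.nonsing_inv_eq_ringInverse]
  obtain ⟨u, hu⟩ := isUnit_compr_add hV hE hε
  have h := NormedRing.inverse_continuousAt u
  rw [hu] at h
  refine ContinuousAt.continuousWithinAt ?_
  exact ContinuousAt.comp (f := fun E => compr V E + (ε : ℂ) • (1 : Matrix κ κ ℂ)) h
    ((continuous_compr V).add continuous_const).continuousAt
end

theorem continuousOn_tanSq {V : Matrix ι κ ℂ} (hV : Vᴴ * V = 1) {ε : ℝ} (hε : 0 < ε) :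
    ContinuousOn (fun E => tanSq ε (compr V E)) (symProj ι) := by
  unfold tanSq
  exact ((continuousOn_resv hV hε).const_smul ((1 + ε : ℝ) : ℂ)).sub continuousOn_const

theorem continuousOn_resvPow {V : Matrix ι κ ℂ} (hV : Vᴴ * V = 1) {ε : ℝ} (hε : 0 < ε) (i : ℕ) :
    ContinuousOn (fun E => resvPow ε (compr V E) i) (symProj ι) :=
  (continuousOn_resv hV hε).mul ((continuousOn_tanSq hV hε).pow i)

theorem ContinuousOn.matrix_trace' {X : Type*} [TopologicalSpace X] {s : Set X}
    {f : X → Matrix κ κ ℂ} (hf : ContinuousOn f s) : ContinuousOn (fun x => (f x).trace) s :=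
  (Continuous.matrix_trace continuous_id).comp_continuousOn hf

theorem continuousOn_powSum {V : Matrix ι κ ℂ} (hV : Vᴴ * V = 1) {ε : ℝ} (hε : 0 < ε) (i : ℕ) :
    ContinuousOn (fun E => powSum ε (compr V E) i) (symProj ι) :=
  ((continuousOn_tanSq hV hε).pow i).matrix_trace'

theorem continuousOn_powProd {V : Matrix ι κ ℂ} (hV : Vᴴ * V = 1) {ε : ℝ} (hε : 0 < ε)
    (l : List ℕ) : ContinuousOn (fun E => powProd ε (compr V E) l) (symProj ι) := by
  induction l with
  | nil => exact continuousOn_const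
  | cons j l ih => exact (continuousOn_powSum hV hε j).mul ih

theorem continuousOn_powGrad {V : Matrix ι κ ℂ} (hV : Vᴴ * V = 1) {ε : ℝ} (hε : 0 < ε)
    (l : List ℕ) : ContinuousOn (fun E => powGrad ε (compr V E) l) (symProj ι) := by
  induction l with
  | nil => exact continuousOn_const
  | cons j l ih =>
    exact ((continuousOn_powSum hV hε j).smul ih).add
      ((continuousOn_const.mul (continuousOn_powProd hV hε l)).smul
        ((continuousOn_resvPow hV hε (j - 1)).add (continuousOn_resvPow hV hε j)))

theorem continuousOn_infl {X : Type*} [TopologicalSpace X] {s : Set X} (V : Matrix ι κ ℂ)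
    {f : X → Matrix κ κ ℂ} (hf : ContinuousOn f s) : ContinuousOn (fun x => infl V (f x)) s := by
  have h : Continuous (infl V) :=
    (continuous_const.matrix_mul continuous_id).matrix_mul continuous_const
  exact h.comp_continuousOn hf

theorem continuousOn_testFn {V : Matrix ι κ ℂ} (hV : Vᴴ * V = 1) {ε : ℝ} (hε : 0 < ε) (m : ℕ)
    (l : List ℕ) (a : Matrix ι ι ℂ) : ContinuousOn (testFn V ε m l a) (symProj ι) := by
  unfold testFn
  exact ((continuousOn_const.mul continuousOn_id).mul
    (continuousOn_infl V (continuousOn_resvPow hV hε m))).matrix_trace'.mul (continuousOn_powProd hV hε l)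

theorem continuousOn_testFnDeriv {V : Matrix ι κ ℂ} (hV : Vᴴ * V = 1) {ε : ℝ} (hε : 0 < ε) (m : ℕ)
    (l : List ℕ) (a : Matrix ι ι ℂ) : ContinuousOn (testFnDeriv V ε m l a) (symProj ι) := by
  have hR := fun i => continuousOn_infl V (continuousOn_resvPow hV hε i)
  have hP := continuousOn_powProd hV hε l
  have hG := continuousOn_infl V (continuousOn_powGrad hV hε l)
  have hid : ContinuousOn (fun E : Matrix ι ι ℂ => E) (symProj ι) := continuousOn_id
  have ha : ContinuousOn (fun E : Matrix ι ι ℂ => a * E - E * a) (symProj ι) :=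
    (continuousOn_const.mul hid).sub (hid.mul continuousOn_const)
  have haE : ContinuousOn (fun E : Matrix ι ι ℂ => a * E) (symProj ι) := continuousOn_const.mul hid
  have hb : ∀ i j : ℕ, ContinuousOn (fun E : Matrix ι ι ℂ =>
      (a * E * infl V (resvPow ε (compr V E) i) * (a * E - E * a) *
        infl V (resvPow ε (compr V E) j)).trace) (symProj ι) := fun i j =>
    (((haE.mul (hR i)).mul ha).mul (hR j)).matrix_trace'
  unfold testFnDeriv
  exact (((continuousOn_const.mul ha).mul (hR m)).matrix_trace'.sub
    ((continuousOn_finsetSum _ fun i _ => hb i (m - i)).add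
      (continuousOn_finsetSum _ fun i _ => hb i (m - 1 - i)))).mul hP |>.sub
    ((haE.mul (hR m)).matrix_trace'.mul (ha.mul hG).matrix_trace')

/-- The one-parameter rotation group generated by `a`. -/
noncomputable def rot (a : Matrix ι ι ℝ) (θ : ℝ) : Matrix ι ι ℝ := NormedSpace.exp (θ • a)

theorem rot_zero (a : Matrix ι ι ℝ) : rot a 0 = 1 := by simp [rot]

theorem rot_mul_transpose {a : Matrix ι ι ℝ} (ha : aᵀ = -a) (θ : ℝ) :
    rot a θ * (rot a θ)ᵀ = 1 := by
  unfold rot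
  rw [← Matrix.exp_transpose, transpose_smul, ha, ← Matrix.exp_add_of_commute]
  · simp
  · simp [Commute, SemiconjBy]

/-- Conjugation by a real matrix. -/
def conjR (O : Matrix ι ι ℝ) (E : Matrix ι ι ℂ) : Matrix ι ι ℂ :=
  O.map (fun x => (x : ℂ)) * E * (O.map (fun x => (x : ℂ)))ᵀ

theorem map_ofReal_mul {α β γ : Type*} [Fintype β] (A : Matrix α β ℝ) (B : Matrix β γ ℝ) :
    (A * B).map (fun x => (x : ℂ)) = A.map (fun x => (x : ℂ)) * B.map (fun x => (x : ℂ)) :=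
  Matrix.map_mul (f := Complex.ofRealHom)

theorem conjR_mem_symProj {O : Matrix ι ι ℝ} (hO : O * Oᵀ = 1) {E : Matrix ι ι ℂ}
    (hE : E ∈ symProj ι) : conjR O E ∈ symProj ι := by
  obtain ⟨hT, hH, hI⟩ := hE
  have hct : (O.map (fun x => (x : ℂ)))ᴴ = (O.map (fun x => (x : ℂ)))ᵀ := by
    ext i j; simp
  have hct' : (O.map (fun x => (x : ℂ)))ᵀᴴ = O.map (fun x => (x : ℂ)) := by
    ext i j; simp
  have hOO : (O.map (fun x => (x : ℂ)))ᵀ * O.map (fun x => (x : ℂ)) = 1 := by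
    rw [← transpose_map, ← map_ofReal_mul, mul_eq_one_comm.1 hO]
    exact Matrix.map_one _ Complex.ofReal_zero Complex.ofReal_one
  refine ⟨?_, ?_, ?_⟩
  · rw [conjR, transpose_mul, transpose_mul, transpose_transpose, hT, Matrix.mul_assoc]
  · rw [conjR, conjTranspose_mul, conjTranspose_mul, hct', hH, hct, Matrix.mul_assoc]
  · unfold conjR
    set C := O.map (fun x => (x : ℂ))
    calc C * E * Cᵀ * (C * E * Cᵀ) = C * E * (Cᵀ * C) * E * Cᵀ := by simp only [Matrix.mul_assoc]
      _ = C * (E * E) * Cᵀ := by rw [hOO, Matrix.mul_one, Matrix.mul_assoc C E E]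
      _ = _ := by rw [hI]

section
attribute [local instance] Matrix.linftyOpNormedRing Matrix.linftyOpNormedAlgebra
attribute [local instance] Matrix.linftyOpNormedAddCommGroup Matrix.linftyOpNormedSpace

theorem hasDerivAt_rot (a : Matrix ι ι ℝ) (θ : ℝ) : HasDerivAt (rot a) (a * rot a θ) θ :=
  hasDerivAt_exp_smul_const' a θ

theorem hasDerivAt_conjR_rot {a : Matrix ι ι ℝ} (ha : aᵀ = -a) (E : Matrix ι ι ℂ) (θ : ℝ) :
    HasDerivAt (fun s => conjR (rot a s) E)
      (a.map (fun x => (x : ℂ)) * conjR (rot a θ) E -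
        conjR (rot a θ) E * a.map (fun x => (x : ℂ))) θ := by
  let L : Matrix ι ι ℝ →ₗ[ℝ] Matrix ι ι ℂ :=
    { toFun := fun M => M.map (fun x => (x : ℂ))
      map_add' := fun A B => by ext i j; simp
      map_smul' := fun c A => by ext i j; simp }
  let LT : Matrix ι ι ℝ →ₗ[ℝ] Matrix ι ι ℂ :=
    { toFun := fun M => (M.map (fun x => (x : ℂ)))ᵀ
      map_add' := fun A B => by ext i j; simp
      map_smul' := fun c A => by ext i j; simp }
  have h1 : HasDerivAt (fun s => L (rot a s)) (L (a * rot a θ)) θ :=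
    L.toContinuousLinearMap.hasFDerivAt.comp_hasDerivAt θ (hasDerivAt_rot a θ)
  have h2 : HasDerivAt (fun s => LT (rot a s)) (LT (a * rot a θ)) θ :=
    LT.toContinuousLinearMap.hasFDerivAt.comp_hasDerivAt θ (hasDerivAt_rot a θ)
  have h3 := (h1.mul_const E).mul h2
  refine h3.congr_deriv ?_
  have e1 : L (a * rot a θ) = a.map (fun x => (x : ℂ)) * (rot a θ).map (fun x => (x : ℂ)) :=
    map_ofReal_mul _ _
  have e2 : LT (a * rot a θ) =
      -(((rot a θ).map (fun x => (x : ℂ)))ᵀ * a.map (fun x => (x : ℂ))) := by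
    change ((a * rot a θ).map (fun x => (x : ℂ)))ᵀ = _
    rw [map_ofReal_mul, transpose_mul, ← transpose_map (M := a), ha]
    rw [show (-a).map (fun x => (x : ℂ)) = -(a.map (fun x => (x : ℂ))) by ext i j; simp,
      Matrix.mul_neg]
  rw [e1, e2]
  simp only [conjR, Matrix.mul_neg, sub_eq_add_neg, Matrix.mul_assoc]
  rfl

end

/-- A random projection whose law is invariant under real rotations. -/
structure RotInvariant {Ω : Type*} [MeasurableSpace Ω] (μ : Measure Ω) (P : Ω → Matrix ι ι ℂ) :
    Prop where
  mem : ∀ ω, P ω ∈ symProj ι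
  aesm : ∀ f : Matrix ι ι ℂ → ℂ, ContinuousOn f (symProj ι) →
    AEStronglyMeasurable (fun ω => f (P ω)) μ
  invariant : ∀ O : Matrix ι ι ℝ, O * Oᵀ = 1 → ∀ f : Matrix ι ι ℂ → ℂ,
    ContinuousOn f (symProj ι) → ∫ ω, f (conjR O (P ω)) ∂μ = ∫ ω, f (P ω) ∂μ

theorem continuous_conjR (O : Matrix ι ι ℝ) : Continuous (conjR O) :=
  (continuous_const.matrix_mul continuous_id).matrix_mul continuous_const

theorem RotInvariant.integrable {Ω : Type*} [MeasurableSpace Ω] {μ : Measure Ω}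
    [IsFiniteMeasure μ] {P : Ω → Matrix ι ι ℂ} (hP : RotInvariant μ P) {f : Matrix ι ι ℂ → ℂ}
    (hf : ContinuousOn f (symProj ι)) : Integrable (fun ω => f (P ω)) μ := by
  obtain ⟨C, hC⟩ := isCompact_symProj.exists_bound_of_continuousOn hf
  exact Integrable.of_bound (hP.aesm f hf) C (Filter.Eventually.of_forall fun ω => hC _ (hP.mem ω))

theorem RotInvariant.integral_testFnDeriv {Ω : Type*} [MeasurableSpace Ω] {μ : Measure Ω}
    [IsFiniteMeasure μ] {P : Ω → Matrix ι ι ℂ} (hP : RotInvariant μ P) {V : Matrix ι κ ℂ}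
    (hV : Vᴴ * V = 1) {ε : ℝ} (hε : 0 < ε) (m : ℕ) (l : List ℕ) {a : Matrix ι ι ℝ}
    (ha : aᵀ = -a) :
    ∫ ω, testFnDeriv V ε m l (a.map (fun x => (x : ℂ))) (P ω) ∂μ = 0 := by
  set a' := a.map (fun x => (x : ℂ))
  have hf := continuousOn_testFn hV hε m l a'
  have hg := continuousOn_testFnDeriv hV hε m l a'
  have hmem : ∀ θ ω, conjR (rot a θ) (P ω) ∈ symProj ι := fun θ ω =>
    conjR_mem_symProj (rot_mul_transpose ha θ) (hP.mem ω)
  have hcomp : ∀ θ (f : Matrix ι ι ℂ → ℂ), ContinuousOn f (symProj ι) →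
      ContinuousOn (fun E => f (conjR (rot a θ) E)) (symProj ι) := fun θ f hf =>
    hf.comp (continuous_conjR _).continuousOn
      fun E hE => conjR_mem_symProj (rot_mul_transpose ha θ) hE
  obtain ⟨C, hC⟩ := isCompact_symProj.exists_bound_of_continuousOn hg
  have key := hasDerivAt_integral_of_dominated_loc_of_deriv_le (μ := μ) (x₀ := (0 : ℝ))
    (s := Set.univ) (bound := fun _ => C)
    (F := fun θ ω => testFn V ε m l a' (conjR (rot a θ) (P ω)))
    (F' := fun θ ω => testFnDeriv V ε m l a' (conjR (rot a θ) (P ω)))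
    Filter.univ_mem
    (Filter.Eventually.of_forall fun θ => hP.aesm _ (hcomp θ _ hf))
    (hP.integrable (hcomp 0 _ hf)) (hP.aesm _ (hcomp 0 _ hg))
    (Filter.Eventually.of_forall fun ω θ _ => hC _ (hmem θ ω)) (integrable_const C)
    (Filter.Eventually.of_forall fun ω θ _ =>
      hasDerivAt_testFn V ε m l a' _ rfl (hasDerivAt_conjR_rot ha (P ω) θ)
        (isUnit_compr_add hV (hmem θ ω) hε))
  have hconst : (fun θ => ∫ ω, testFn V ε m l a' (conjR (rot a θ) (P ω)) ∂μ) =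
      fun _ => ∫ ω, testFn V ε m l a' (P ω) ∂μ :=
    funext fun θ => hP.invariant _ (rot_mul_transpose ha θ) _ hf
  have h0 := key.2
  rw [hconst] at h0
  have h1 := h0.unique (hasDerivAt_const _ _)
  simpa [rot_zero, conjR] using h1

theorem RotInvariant.integral_loopFn {Ω : Type*} [MeasurableSpace Ω] {μ : Measure Ω}
    [IsFiniteMeasure μ] {P : Ω → Matrix ι ι ℂ} (hP : RotInvariant μ P) {V : Matrix ι κ ℂ}
    (hV : Vᴴ * V = 1) {ε : ℝ} (hε : 0 < ε) (m : ℕ) (l : List ℕ) :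
    Integrable (fun ω => loopFn V ε m l (P ω)) μ ∧ ∫ ω, loopFn V ε m l (P ω) ∂μ = 0 := by
  have h1 : ∀ ω, loopFn V ε m l (P ω) =
      2⁻¹ * ∑ α, ∑ β, testFnDeriv V ε m l (skewGen α β) (P ω) := by
    intro ω
    rw [sum_testFnDeriv hV ε m l (hP.mem ω), ← mul_assoc]
    norm_num
  have hi : ∀ α β, Integrable (fun ω => testFnDeriv V ε m l (skewGen α β) (P ω)) μ := fun α β =>
    hP.integrable (continuousOn_testFnDeriv hV hε m l _)
  simp only [h1]
  constructor
  · exact (integrable_finsetSum _ fun α _ => integrable_finsetSum _ fun β _ => hi α β).const_mul _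
  · rw [integral_const_mul, integral_finsetSum _ fun α _ =>
      integrable_finsetSum _ fun β _ => hi α β]
    simp only [integral_finsetSum _ fun β _ => hi _ β]
    rw [Finset.sum_eq_zero, mul_zero]
    refine fun α _ => Finset.sum_eq_zero fun β _ => ?_
    have h2 : (skewGen α β : Matrix ι ι ℂ) = (skewGen α β : Matrix ι ι ℝ).map (fun x => (x : ℂ)) := by
      ext i j
      simp [skewGen, Matrix.single_apply]
      split_ifs <;> simp
    rw [h2]
    refine hP.integral_testFnDeriv hV hε m l ?_
    simp [skewGen]

/-- Existence of the regularized squared tangents together with the expected loop inequalities. -/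
theorem RotInvariant.exists_moments {Ω : Type*} [MeasurableSpace Ω] {μ : Measure Ω}
    [IsFiniteMeasure μ] {P : Ω → Matrix ι ι ℂ} (hP : RotInvariant μ P) {N : ℝ}
    (hN : ∀ᵐ ω ∂μ, (P ω).trace = N) (hNn : N ≤ Fintype.card ι) {V : Matrix ι κ ℂ}
    (hV : Vᴴ * V = 1) {ε : ℝ} (hε : 0 < ε) :
    ∃ τ : Ω → κ → ℝ, (∀ ω x, 0 ≤ τ ω x) ∧
      (∀ ω l, powProd ε (compr V (P ω)) l = (pProd (τ ω) l : ℝ)) ∧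
      (∀ l, Integrable (fun ω => pProd (τ ω) l) μ) ∧
      ∀ m l, ∃ f : Ω → ℝ, Integrable f μ ∧ ∫ ω, f ω ∂μ = 0 ∧ ∀ᵐ ω ∂μ,
        (N * pS (τ ω) (m + 1) - (Fintype.card ι - N) * pS (τ ω) m -
        ((∑ i ∈ Finset.range (m + 1), (pS (τ ω) i * pS (τ ω) (m - i + 1) + pS (τ ω) (m + 1))) +
        ∑ i ∈ Finset.range m, (pS (τ ω) i * pS (τ ω) (m - i) + pS (τ ω) m))) * pProd (τ ω) l -
        2 * l.sum * SpecData.gradFactor (τ ω) m * pProd (τ ω) l ≤ f ω := by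
  choose Y φ p τ h using fun ω => SpecData.exists_of_pos hV (hP.mem ω) hε
  refine ⟨τ, fun ω => (h ω).tau_nonneg, fun ω => (h ω).powProd_eq, fun l => ?_, fun m l => ?_⟩
  · have h1 := hP.integrable (continuousOn_powProd hV hε l)
    simp only [fun ω => (h ω).powProd_eq] at h1
    exact h1.re
  · obtain ⟨h1, h2⟩ := hP.integral_loopFn hV hε m l
    refine ⟨fun ω => (loopFn V ε m l (P ω)).re, h1.re, ?_, ?_⟩
    · have := integral_re h1
      simp only [RCLike.re_to_complex] at this
      rw [this, h2, Complex.zero_re]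
    · filter_upwards [hN] with ω hω
      exact (h ω).le_re_loopFn hV (hP.mem ω) hω hNn m l

end Invariance

section Recursion

theorem sum_range_catalan (r : ℕ) :
    ∑ i ∈ Finset.range (r + 1), (catalan i : ℝ) * catalan (r - i) = catalan (r + 1) := by
  rw [catalan_succ, Finset.sum_range]
  push_cast
  rfl

theorem catalan_le_succ (r : ℕ) : (catalan r : ℝ) ≤ catalan (r + 1) := by
  rw [← sum_range_catalan r]
  have := Finset.single_le_sum (f := fun i => (catalan i : ℝ) * catalan (r - i))
    (fun i _ => by positivity) (Finset.mem_range.2 (Nat.succ_pos r))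
  simpa using this

/-- The Catalan-type majorant. -/
noncomputable def catBound (c X Θ : ℝ) (m : ℕ) : ℝ := c * catalan (m - 1) * X * Θ ^ (m - 1)

theorem catBound_nonneg {c X Θ : ℝ} (hc : 0 ≤ c) (hX : 0 ≤ X) (hΘ : 0 ≤ Θ) (m : ℕ) :
    0 ≤ catBound c X Θ m := by unfold catBound; positivity

theorem catBound_step {c s x : ℝ} (hc : 0 < c) (hs : 0 ≤ s) (hx : 0 ≤ x) (r : ℕ) :
    s * catBound c (x / c ^ 2) (1 + s / c + x / c ^ 2) (r + 1) +
      ∑ i ∈ Finset.range (r + 1), catBound c (x / c ^ 2) (1 + s / c + x / c ^ 2) (i + 1) *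
        catBound c (x / c ^ 2) (1 + s / c + x / c ^ 2) (r - i + 1) +
      ∑ i ∈ Finset.range r, catBound c (x / c ^ 2) (1 + s / c + x / c ^ 2) (i + 1) *
        catBound c (x / c ^ 2) (1 + s / c + x / c ^ 2) (r - i) ≤
      c * catBound c (x / c ^ 2) (1 + s / c + x / c ^ 2) (r + 2) := by
  set X := x / c ^ 2 with hX
  set σ := s / c with hσ
  have hX0 : 0 ≤ X := by positivity
  have hσ0 : 0 ≤ σ := by positivity
  set Θ := 1 + σ + X with hΘ
  have hΘ0 : 0 < Θ := by positivity
  have e1 : ∑ i ∈ Finset.range (r + 1), catBound c X Θ (i + 1) * catBound c X Θ (r - i + 1) =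
      c ^ 2 * X ^ 2 * Θ ^ r * catalan (r + 1) := by
    rw [← sum_range_catalan, Finset.mul_sum]
    refine Finset.sum_congr rfl fun i hi => ?_
    have hi := Finset.mem_range.1 hi
    have : Θ ^ r = Θ ^ i * Θ ^ (r - i) := by rw [← pow_add]; congr 1; omega
    simp only [catBound, Nat.add_sub_cancel, this]
    ring
  have e2 : ∑ i ∈ Finset.range r, catBound c X Θ (i + 1) * catBound c X Θ (r - i) ≤
      c ^ 2 * X * Θ ^ r * catalan r := by
    rcases r with _ | t
    · simp; positivity
    · have h1 : ∑ i ∈ Finset.range (t + 1), catBound c X Θ (i + 1) * catBound c X Θ (t + 1 - i) =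
          c ^ 2 * X ^ 2 * Θ ^ t * catalan (t + 1) := by
        rw [← sum_range_catalan, Finset.mul_sum]
        refine Finset.sum_congr rfl fun i hi => ?_
        have hi := Finset.mem_range.1 hi
        have : Θ ^ t = Θ ^ i * Θ ^ (t - i) := by rw [← pow_add]; congr 1; omega
        simp only [catBound, Nat.add_sub_cancel, this, show t + 1 - i - 1 = t - i by omega]
        ring
      rw [h1, pow_succ Θ t]
      have h2 : X ≤ Θ := by rw [hΘ]; linarith
      calc c ^ 2 * X ^ 2 * Θ ^ t * catalan (t + 1) = (c ^ 2 * X * Θ ^ t * catalan (t + 1)) * X := by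
            ring
        _ ≤ (c ^ 2 * X * Θ ^ t * catalan (t + 1)) * Θ :=
            mul_le_mul_of_nonneg_left h2 (by positivity)
        _ = _ := by ring
  have hs' : s = σ * c := by rw [hσ]; field_simp
  rw [e1]
  refine (add_le_add le_rfl e2).trans ?_
  simp only [catBound, Nat.add_sub_cancel, show r + 2 - 1 = r + 1 by omega]
  have h3 := catalan_le_succ r
  have h4 : σ * catalan r + X * catalan (r + 1) + catalan r ≤ Θ * catalan (r + 1) := by
    rw [hΘ]; nlinarith
  have h5 := mul_le_mul_of_nonneg_left h4 (show 0 ≤ c ^ 2 * X * Θ ^ r by positivity)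
  rw [hs', pow_succ Θ r]
  nlinarith

/-- Moment bounds from loop inequalities, by induction on `2 * sum - length`. -/
theorem le_prod_catBound {c s x : ℝ} (hc : 0 < c) (hs : 0 ≤ s) (hx : 0 ≤ x) {D : ℕ}
    {e : List ℕ → ℝ} (he0 : e [] ≤ 1)
    (he1 : ∀ l : List ℕ, 1 + l.sum ≤ D → c * e (1 :: l) ≤ x * e l)
    (he2 : ∀ (r : ℕ) (l : List ℕ), r + 2 + l.sum ≤ D → c * e ((r + 2) :: l) ≤
      s * e ((r + 1) :: l) + ∑ i ∈ Finset.range (r + 1), e ((i + 1) :: (r - i + 1) :: l) +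
        ∑ i ∈ Finset.range r, e ((i + 1) :: (r - i) :: l))
    (l : List ℕ) (hl : ∀ m ∈ l, 1 ≤ m) (hD : l.sum ≤ D) :
    e l ≤ (l.map (catBound c (x / c ^ 2) (1 + s / c + x / c ^ 2))).prod := by
  induction hn : 2 * l.sum - l.length using Nat.strong_induction_on generalizing l with
  | _ n ih =>
  have hlen : ∀ l : List ℕ, (∀ m ∈ l, 1 ≤ m) → l.length ≤ l.sum := by
    intro l hl
    induction l with
    | nil => simp
    | cons a l ih =>
      have h1 := ih fun m hm => hl m (List.mem_cons_of_mem _ hm)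
      have h2 := hl a List.mem_cons_self
      simp only [List.length_cons, List.sum_cons]; omega
  have hprod : ∀ l : List ℕ,
      0 ≤ (l.map (catBound c (x / c ^ 2) (1 + s / c + x / c ^ 2))).prod := by
    intro l
    refine List.prod_nonneg fun a ha => ?_
    obtain ⟨m, -, rfl⟩ := List.mem_map.1 ha
    exact catBound_nonneg hc.le (by positivity) (by positivity) m
  rcases l with _ | ⟨a, l⟩
  · simpa using he0
  have ha := hl a List.mem_cons_self
  have hl' : ∀ m ∈ l, 1 ≤ m := fun m hm => hl m (List.mem_cons_of_mem _ hm)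
  have hll := hlen l hl'
  simp only [List.sum_cons, List.length_cons] at hn hD
  rw [List.map_cons, List.prod_cons, ← mul_le_mul_iff_right₀ hc]
  obtain rfl | ⟨r, rfl⟩ : a = 1 ∨ ∃ r, a = r + 2 := by
    rcases a with _ | _ | a
    · omega
    · exact Or.inl rfl
    · exact Or.inr ⟨a, rfl⟩
  · have h1 := ih _ (by omega) l hl' (by omega) rfl
    refine (he1 l hD).trans ((mul_le_mul_of_nonneg_left h1 hx).trans_eq ?_)
    simp only [catBound, Nat.sub_self, catalan_zero, pow_zero]
    field_simp
    simp
  · have h1 := ih _ (by simp; omega) ((r + 1) :: l)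
      (by simpa using hl') (by simp; omega) rfl
    have h2 : ∀ i ∈ Finset.range (r + 1), e ((i + 1) :: (r - i + 1) :: l) ≤ _ := fun i hi =>
      have hi' := Finset.mem_range.1 hi
      ih _ (by simp; omega) ((i + 1) :: (r - i + 1) :: l)
        (by simpa using hl') (by simp; omega) rfl
    have h3 : ∀ i ∈ Finset.range r, e ((i + 1) :: (r - i) :: l) ≤ _ := fun i hi =>
      have hi' := Finset.mem_range.1 hi
      ih _ (by simp; omega) ((i + 1) :: (r - i) :: l)
        (by simp; exact ⟨by omega, hl'⟩) (by simp; omega) rfl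
    refine (he2 r l hD).trans ((add_le_add (add_le_add (mul_le_mul_of_nonneg_left h1 hs)
      (Finset.sum_le_sum h2)) (Finset.sum_le_sum h3)).trans ?_)
    have h4 := mul_le_mul_of_nonneg_right (catBound_step hc hs hx r) (hprod l)
    simp only [List.map_cons, List.prod_cons, ← mul_assoc, ← Finset.sum_mul]
    rw [← add_mul, ← add_mul]
    exact h4

end Recursion

section Moments

open MeasureTheory

variable {ι κ : Type*} [Fintype ι] [DecidableEq ι] [Fintype κ] [DecidableEq κ]

theorem pS_zero (τ : κ → ℝ) : pS τ 0 = Fintype.card κ := by simp [pS]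

theorem RotInvariant.moment_le {Ω : Type*} [MeasurableSpace Ω] {μ : Measure Ω}
    [IsProbabilityMeasure μ] {P : Ω → Matrix ι ι ℂ} (hP : RotInvariant μ P) {k ρ n₂ D : ℕ}
    (hι : Fintype.card ι = k + n₂) (hκ : Fintype.card κ = k) (hk : 1 ≤ k) (hρ : 2 ≤ ρ)
    (hn : ρ ≤ n₂) (hD : 1 ≤ D) (hDρ : 2 * D - 1 < ρ)
    (hN : ∀ᵐ ω ∂μ, (P ω).trace = ((k + ρ : ℝ) : ℂ)) {V : Matrix ι κ ℂ}
    (hV : Vᴴ * V = 1) {ε : ℝ} (hε : 0 < ε) :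
    ∃ τ : Ω → κ → ℝ, (∀ ω x, 0 ≤ τ ω x) ∧
      (∀ ω i, powSum ε (compr V (P ω)) i = (pS (τ ω) i : ℝ)) ∧
      Integrable (fun ω => pS (τ ω) D) μ ∧
      ∫ ω, pS (τ ω) D ∂μ ≤ ((ρ : ℝ) - 2 * D + 1) * catalan (D - 1) *
        (((k + ρ : ℝ) * n₂) / ((ρ : ℝ) - 2 * D + 1) ^ 2) ^ D := by
  obtain ⟨τ, h0, hpow, hint, hloop⟩ := hP.exists_moments hN
    (by rw [hι]; push_cast; have : (ρ : ℝ) ≤ n₂ := by exact_mod_cast hn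
        linarith) hV hε
  have hsing : ∀ ω i, pProd (τ ω) [i] = pS (τ ω) i := fun ω i => by simp [pProd]
  refine ⟨τ, h0, fun ω i => ?_, ?_, ?_⟩
  · have := hpow ω [i]
    rw [hsing] at this
    simpa [powProd] using this
  · simpa [hsing] using hint [D]
  set c : ℝ := (ρ : ℝ) - 2 * D + 1 with hc
  set y : ℝ := (n₂ : ℝ) - ρ with hy
  set s : ℝ := y + k + 2 * D - 3 with hs
  set x : ℝ := k * y + 2 * (D - 1) with hx
  have hy0 : 0 ≤ y := sub_nonneg.2 (by exact_mod_cast hn)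
  have hk1 : (1 : ℝ) ≤ k := by exact_mod_cast hk
  have hρ2 : (2 : ℝ) ≤ ρ := by exact_mod_cast hρ
  have hD1 : (1 : ℝ) ≤ D := by exact_mod_cast hD
  have hc0 : 0 < c := by
    have : (2 * D : ℝ) < ρ + 1 := by exact_mod_cast (show 2 * D < ρ + 1 by omega)
    rw [hc]; linarith
  have hs0 : 0 ≤ s := by rw [hs]; linarith
  have hx0 : 0 ≤ x := by rw [hx]; nlinarith
  set e : List ℕ → ℝ := fun l => ∫ ω, pProd (τ ω) l ∂μ with he
  have hnn : ∀ l, 0 ≤ e l := fun l => integral_nonneg fun ω => pProd_nonneg (h0 ω) l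
  have key := le_prod_catBound hc0 hs0 hx0 (D := D) (e := e) ?_ ?_ ?_ [D] (by simpa using hD)
    (by simp)
  · simp only [List.map_cons, List.map_nil, List.prod_cons, List.prod_nil, mul_one] at key
    simp only [he, hsing] at key
    refine key.trans ?_
    have hΘ : 1 + s / c + x / c ^ 2 ≤ ((k + ρ : ℝ) * n₂) / c ^ 2 := by
      rw [show 1 + s / c + x / c ^ 2 = (c ^ 2 + s * c + x) / c ^ 2 by field_simp]
      gcongr
      rw [show (n₂ : ℝ) = y + ρ by rw [hy]; ring, hs, hx, hc]
      nlinarith [mul_nonneg (sub_nonneg.2 hD1) (show 0 ≤ (ρ : ℝ) + y + k - 3 by linarith)]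
    have hX : x / c ^ 2 ≤ 1 + s / c + x / c ^ 2 := by
      have : 0 ≤ s / c := by positivity
      linarith
    replace hX := hX.trans hΘ
    generalize ((k + ρ : ℝ) * n₂) / c ^ 2 = Z at *
    unfold catBound
    have h1 : (0 : ℝ) ≤ x / c ^ 2 := by positivity
    calc c * catalan (D - 1) * (x / c ^ 2) * (1 + s / c + x / c ^ 2) ^ (D - 1)
        ≤ c * catalan (D - 1) * Z * Z ^ (D - 1) := by
          generalize x / c ^ 2 = X at *
          have := h1.trans hX
          gcongr
      _ = _ := by
          rw [mul_assoc, ← pow_succ', Nat.sub_add_cancel hD]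
  · simp [he, pProd]
  · intro l hl
    obtain ⟨f, hf, hf0, hle⟩ := hloop 0 l
    have h1 : ∫ ω, ((ρ - 1 - 2 * l.sum) * pProd (τ ω) (1 :: l) -
        (k * y + 2 * l.sum) * pProd (τ ω) l) ∂μ ≤ 0 := by
      rw [← hf0]
      refine integral_mono_ae (((hint _).const_mul _).sub ((hint _).const_mul _)) hf ?_
      filter_upwards [hle] with ω hω
      refine le_trans (le_of_eq ?_) hω
      simp only [zero_add, Finset.range_one, Finset.sum_singleton, Finset.range_zero,
        Finset.sum_empty, pS_zero, hκ, SpecData.gradFactor, if_true, pProd, hι]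
      rw [hy]; push_cast
      ring
    rw [integral_sub ((hint _).const_mul _) ((hint _).const_mul _), integral_const_mul,
      integral_const_mul] at h1
    have h2 : (1 + l.sum : ℝ) ≤ D := by exact_mod_cast hl
    have h3 := mul_le_mul_of_nonneg_right (show c ≤ ρ - 1 - 2 * (l.sum : ℝ) by rw [hc]; linarith)
      (hnn (1 :: l))
    have h4 := mul_le_mul_of_nonneg_right (show k * y + 2 * (l.sum : ℝ) ≤ x by rw [hx]; linarith)
      (hnn l)
    simp only [he] at h3 h4 ⊢
    linarith
  · intro r l hl
    obtain ⟨f, hf, hf0, hle⟩ := hloop (r + 1) l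
    have i1 : Integrable (fun ω => ∑ i ∈ Finset.range (r + 1),
        pProd (τ ω) ((i + 1) :: (r - i + 1) :: l)) μ := integrable_finsetSum _ fun i _ => hint _
    have i2 : Integrable (fun ω => ∑ i ∈ Finset.range r,
        pProd (τ ω) ((i + 1) :: (r - i) :: l)) μ := integrable_finsetSum _ fun i _ => hint _
    have i3 : Integrable (fun ω => (ρ - (r + 2) - 2 * l.sum) * pProd (τ ω) ((r + 2) :: l) -
        (y + k + (r + 1) + 2 * l.sum) * pProd (τ ω) ((r + 1) :: l)) μ :=
      ((hint _).const_mul _).sub ((hint _).const_mul _)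
    have i4 : Integrable (fun ω => (ρ - (r + 2) - 2 * l.sum) * pProd (τ ω) ((r + 2) :: l) -
        (y + k + (r + 1) + 2 * l.sum) * pProd (τ ω) ((r + 1) :: l) -
        ∑ i ∈ Finset.range (r + 1), pProd (τ ω) ((i + 1) :: (r - i + 1) :: l)) μ := i3.sub i1
    have h1 : ∫ ω, ((ρ - (r + 2) - 2 * l.sum) * pProd (τ ω) ((r + 2) :: l) -
        (y + k + (r + 1) + 2 * l.sum) * pProd (τ ω) ((r + 1) :: l) -
        ∑ i ∈ Finset.range (r + 1), pProd (τ ω) ((i + 1) :: (r - i + 1) :: l) -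
        ∑ i ∈ Finset.range r, pProd (τ ω) ((i + 1) :: (r - i) :: l)) ∂μ ≤ 0 := by
      rw [← hf0]
      refine integral_mono_ae (i4.sub i2) hf ?_
      filter_upwards [hle] with ω hω
      refine le_trans (le_of_eq ?_) hω
      simp only [SpecData.gradFactor, Nat.succ_ne_zero, if_false, pProd, hι]
      have s1 : ∑ i ∈ Finset.range (r + 1 + 1), pS (τ ω) i * pS (τ ω) (r + 1 - i + 1) =
          (∑ i ∈ Finset.range (r + 1), pS (τ ω) (i + 1) * pS (τ ω) (r - i + 1)) +
            k * pS (τ ω) (r + 2) := by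
        rw [Finset.sum_range_succ', pS_zero, hκ]
        simp only [Nat.add_sub_add_right, Nat.sub_zero]
      have s2 : ∑ i ∈ Finset.range (r + 1), pS (τ ω) i * pS (τ ω) (r + 1 - i) =
          (∑ i ∈ Finset.range r, pS (τ ω) (i + 1) * pS (τ ω) (r - i)) +
            k * pS (τ ω) (r + 1) := by
        rw [Finset.sum_range_succ', pS_zero, hκ]
        simp only [Nat.add_sub_add_right, Nat.sub_zero]
      rw [Finset.sum_add_distrib, Finset.sum_add_distrib, Finset.sum_const, Finset.sum_const, s1, s2]
      simp only [Finset.card_range, nsmul_eq_mul, ← mul_assoc, ← Finset.sum_mul]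
      rw [hy]; push_cast
      ring
    rw [integral_sub i4 i2, integral_sub i3 i1,
      integral_sub ((hint _).const_mul _) ((hint _).const_mul _), integral_const_mul,
      integral_const_mul, integral_finsetSum _ fun i _ => hint _,
      integral_finsetSum _ fun i _ => hint _] at h1
    have h2 : (r + 2 + l.sum : ℝ) ≤ D := by exact_mod_cast hl
    have hr : (0 : ℝ) ≤ r := Nat.cast_nonneg r
    have h3 := mul_le_mul_of_nonneg_right
      (show c ≤ ρ - (r + 2) - 2 * (l.sum : ℝ) by rw [hc]; linarith) (hnn ((r + 2) :: l))
    have h4 := mul_le_mul_of_nonneg_right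
      (show y + k + (r + 1) + 2 * (l.sum : ℝ) ≤ s by rw [hs]; linarith) (hnn ((r + 1) :: l))
    simp only [he] at h3 h4 ⊢
    linarith

end Moments

section Numerics

theorem catalan_le_four_pow (n : ℕ) : catalan n ≤ 4 ^ n := by
  rw [catalan_eq_centralBinom_div]
  refine (Nat.div_le_self _ _).trans ?_
  rw [Nat.centralBinom_eq_two_mul_choose]
  refine (Nat.choose_le_two_pow _ _).trans_eq ?_
  rw [pow_mul]
  norm_num

theorem sq_le_two_pow_sub {L : ℕ} (hL : 8 ≤ L) :
    (4 * (L : ℝ) - 1) ^ 2 ≤ 9 / 2 * (2 ^ L - 4 * L + 1) := by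
  induction L, hL using Nat.le_induction with
  | base => norm_num
  | succ L hL ih =>
    have h : (8 : ℝ) ≤ L := by exact_mod_cast hL
    rw [pow_succ (2 : ℝ) L]
    push_cast
    nlinarith

theorem two_pow_mul_exp_le {L : ℕ} (hL : 8 ≤ L) :
    (2 : ℝ) ^ (5 * L - 1) * Real.exp (9 / 2) ≤ Real.exp (4 * L) := by
  have he := Real.exp_one_gt_d9
  induction L, hL using Nat.le_induction with
  | base =>
    have h1 : (2 : ℝ) ^ 78 ≤ Real.exp 1 ^ 55 :=
      le_trans (by norm_num) (pow_le_pow_left₀ (by norm_num : (0 : ℝ) ≤ 2.7182818283) he.le 55)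
    have h2 : (2 : ℝ) ^ 39 ≤ Real.exp (55 / 2) := by
      refine le_of_sq_le_sq ?_ (Real.exp_pos _).le
      rw [← pow_mul, ← Real.exp_nat_mul]
      rw [← Real.exp_nat_mul] at h1
      refine h1.trans_eq ?_
      norm_num
    calc (2 : ℝ) ^ (5 * 8 - 1) * Real.exp (9 / 2) ≤ Real.exp (55 / 2) * Real.exp (9 / 2) := by
          gcongr
      _ = _ := by rw [← Real.exp_add]; norm_num
  | succ L hL ih =>
    have h1 : (32 : ℝ) ≤ Real.exp 4 := by
      have : Real.exp 4 = Real.exp 1 ^ 4 := by rw [← Real.exp_nat_mul]; norm_num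
      rw [this]
      exact le_trans (by norm_num) (pow_le_pow_left₀ (by norm_num : (0 : ℝ) ≤ 2.7182818283) he.le 4)
    have h2 : (2 : ℝ) ^ (5 * (L + 1) - 1) = 32 * 2 ^ (5 * L - 1) := by
      rw [show 5 * (L + 1) - 1 = 5 + (5 * L - 1) by omega, pow_add]; norm_num
    rw [h2, show (4 * ((L + 1 : ℕ) : ℝ)) = 4 + 4 * L by push_cast; ring, Real.exp_add, mul_assoc]
    exact mul_le_mul h1 ih (by positivity) (by positivity)

/-- A moment order for which the Catalan bound is absorbed by the factor `e ^ (2 * m)`. -/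
theorem exists_moment_order {ρ : ℕ} (hρ : 2 ≤ ρ) :
    ∃ m : ℕ, 1 ≤ m ∧ 2 * m - 1 < ρ ∧
      (catalan (m - 1) : ℝ) * (ρ : ℝ) ^ (2 * m) ≤
        Real.exp 1 ^ (2 * m) * ((ρ : ℝ) - 2 * m + 1) ^ (2 * m - 1) := by
  have he := Real.exp_one_gt_d9
  have small : ∀ (m a N : ℕ), 2 * m - 1 < ρ → 1 ≤ m → catalan (m - 1) = a →
      (N : ℝ) ≤ 2.7182818283 ^ (2 * m) → a * ρ ^ (2 * m) ≤ N * (ρ - (2 * m - 1)) ^ (2 * m - 1) →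
      (catalan (m - 1) : ℝ) * (ρ : ℝ) ^ (2 * m) ≤
        Real.exp 1 ^ (2 * m) * ((ρ : ℝ) - 2 * m + 1) ^ (2 * m - 1) := by
    intro m a N hm hm1 ha hN h
    have hcast : ((ρ - (2 * m - 1) : ℕ) : ℝ) = (ρ : ℝ) - 2 * m + 1 := by
      rw [Nat.cast_sub hm.le, Nat.cast_sub (by omega)]; push_cast; ring
    rw [ha, ← hcast]
    calc (a : ℝ) * (ρ : ℝ) ^ (2 * m) ≤ N * ((ρ - (2 * m - 1) : ℕ) : ℝ) ^ (2 * m - 1) := by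
          exact_mod_cast h
      _ ≤ _ := by
          gcongr
          exact hN.trans (pow_le_pow_left₀ (by norm_num) he.le _)
  rcases lt_or_ge ρ 256 with h256 | h256
  · rcases lt_or_ge ρ 7 with h7 | h7
    · refine ⟨1, le_rfl, by omega, ?_⟩
      have h1 : (2 : ℝ) ≤ ρ := by exact_mod_cast hρ
      have h2 : (ρ : ℝ) ≤ 6 := by exact_mod_cast (show ρ ≤ 6 by omega)
      have h3 : (7.38 : ℝ) ≤ Real.exp 1 ^ 2 :=
        le_trans (by norm_num) (pow_le_pow_left₀ (by norm_num : (0 : ℝ) ≤ 2.7182818283) he.le 2)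
      have h4 : (ρ : ℝ) ^ 2 ≤ Real.exp 1 ^ 2 * (ρ - 1) := by
        refine le_trans ?_ (mul_le_mul_of_nonneg_right h3 (by linarith))
        nlinarith
      rw [show (ρ : ℝ) - 1 = ρ - 2 * (1 : ℕ) + 1 by push_cast; ring] at h4
      simpa using h4
    · rcases lt_or_ge ρ 30 with h30 | h30
      · refine ⟨2, by norm_num, by omega, small 2 1 54 (by omega) (by norm_num) (by simp)
          (by norm_num) ?_⟩
        interval_cases ρ <;> norm_num
      · rcases lt_or_ge ρ 100 with h100 | h100
        · refine ⟨3, by norm_num, by omega, small 3 2 403 (by omega) (by norm_num)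
            (by simp [catalan_two])
            (by norm_num) ?_⟩
          interval_cases ρ <;> norm_num
        · refine ⟨4, by norm_num, by omega, small 4 5 2980 (by omega) (by norm_num)
            (by simp [catalan_three]) (by norm_num) ?_⟩
          interval_cases ρ <;> norm_num
  · set L := Nat.log 2 ρ with hL
    have hL8 : 8 ≤ L := by
      rw [hL]; exact Nat.le_log_of_pow_le (by norm_num) (by simpa using h256)
    have hlow : 2 ^ L ≤ ρ := Nat.pow_log_le_self 2 (by omega)
    have hup : ρ < 2 ^ (L + 1) := Nat.lt_pow_succ_log_self (by norm_num) ρ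
    have hlowR : (2 : ℝ) ^ L ≤ ρ := by exact_mod_cast hlow
    have hupR : (ρ : ℝ) ≤ 2 ^ (L + 1) := by exact_mod_cast hup.le
    have hLR : (8 : ℝ) ≤ L := by exact_mod_cast hL8
    have hsq := sq_le_two_pow_sub hL8
    have hcpos : 0 < (ρ : ℝ) - 4 * L + 1 := by nlinarith
    have hlt : 4 * L - 1 < ρ := by
      have h : ((4 * L : ℕ) : ℝ) < ((ρ + 1 : ℕ) : ℝ) := by push_cast; linarith
      have := Nat.cast_lt.1 h
      omega
    refine ⟨2 * L, by omega, by omega, ?_⟩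
    rw [show (ρ : ℝ) - 2 * (2 * L : ℕ) + 1 = (ρ : ℝ) - 4 * L + 1 by push_cast; ring,
      show 2 * (2 * L) = 4 * L by ring]
    set c := (ρ : ℝ) - 4 * L + 1 with hc
    have h1 : (ρ : ℝ) ≤ c * Real.exp ((4 * L - 1) / c) := by
      have := Real.add_one_le_exp ((4 * (L : ℝ) - 1) / c)
      calc (ρ : ℝ) = c * ((4 * L - 1) / c + 1) := by rw [hc] at hcpos ⊢; field_simp; ring
        _ ≤ _ := mul_le_mul_of_nonneg_left this hcpos.le
    have h2 : (ρ : ℝ) ^ (4 * L - 1) ≤ c ^ (4 * L - 1) * Real.exp (9 / 2) := by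
      refine (pow_le_pow_left₀ (Nat.cast_nonneg _) h1 _).trans ?_
      rw [mul_pow, ← Real.exp_nat_mul]
      gcongr
      rw [Nat.cast_sub (by omega), mul_div_assoc', div_le_iff₀ hcpos]
      push_cast
      calc (4 * (L : ℝ) - 1) * (4 * L - 1) = (4 * L - 1) ^ 2 := by ring
        _ ≤ _ := hsq
        _ ≤ _ := by rw [hc]; linarith
    have h3 : (catalan (2 * L - 1) : ℝ) ≤ 4 ^ (2 * L - 1) := by
      exact_mod_cast catalan_le_four_pow _
    have h4 := two_pow_mul_exp_le hL8
    calc (catalan (2 * L - 1) : ℝ) * (ρ : ℝ) ^ (4 * L)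
        = catalan (2 * L - 1) * ρ * (ρ : ℝ) ^ (4 * L - 1) := by
          rw [mul_assoc, ← pow_succ', Nat.sub_add_cancel (by omega)]
      _ ≤ 4 ^ (2 * L - 1) * 2 ^ (L + 1) * (c ^ (4 * L - 1) * Real.exp (9 / 2)) := by gcongr
      _ = (2 ^ (5 * L - 1) * Real.exp (9 / 2)) * c ^ (4 * L - 1) := by
          rw [show (4 : ℝ) = 2 ^ 2 by norm_num, ← pow_mul, ← pow_add,
            show 2 * (2 * L - 1) + (L + 1) = 5 * L - 1 by omega]
          ring
      _ ≤ Real.exp (4 * L) * c ^ (4 * L - 1) := by gcongr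
      _ = _ := by rw [← Real.exp_nat_mul]; push_cast; rw [mul_one]

end Numerics

section SingularValues

/-- The squared Euclidean norm of a complex vector. -/
noncomputable def nsq {α : Type*} [Fintype α] (z : α → ℂ) : ℝ := ∑ x, ‖z x‖ ^ 2

theorem nsq_nonneg {α : Type*} [Fintype α] (z : α → ℂ) : 0 ≤ nsq z :=
  Finset.sum_nonneg fun _ _ => by positivity

theorem star_dotProduct_self {α : Type*} [Fintype α] (z : α → ℂ) :
    star z ⬝ᵥ z = (nsq z : ℂ) := by
  simp only [dotProduct, nsq, Pi.star_apply, Complex.ofReal_sum, Complex.ofReal_pow]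
  exact Finset.sum_congr rfl fun x _ => Complex.conj_mul' (z x)

theorem nsq_mulVec {α β : Type*} [Fintype α] [Fintype β] (M : Matrix α β ℂ) (z : β → ℂ) :
    (nsq (M *ᵥ z) : ℂ) = star z ⬝ᵥ ((Mᴴ * M) *ᵥ z) := by
  rw [← star_dotProduct_self, star_mulVec, ← mulVec_mulVec, dotProduct_mulVec (star z)]

theorem nsq_mulVec_of_isometry {α β : Type*} [Fintype α] [Fintype β] [DecidableEq β]
    {M : Matrix α β ℂ} (hM : Mᴴ * M = 1) (z : β → ℂ) : nsq (M *ᵥ z) = nsq z := by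
  have h := nsq_mulVec M z
  rw [hM, one_mulVec, star_dotProduct_self] at h
  exact_mod_cast h

theorem length_lt_card_of_lt_sval {m n : ℕ} (M : Matrix (Fin m) (Fin n) ℂ) {t : ℕ} (ht : t < n)
    {s : ℝ} (h : s < sval M t) :
    t < (Finset.univ.filter fun i =>
      s < Real.sqrt ((Matrix.isHermitian_conjTranspose_mul_self M).eigenvalues i)).card := by
  set f := (Matrix.isHermitian_conjTranspose_mul_self M).eigenvalues
  set l := List.insertionSort (· ≥ ·) ((List.ofFn f).map Real.sqrt) with hl
  have hlen : l.length = n := by simp [hl]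
  have hsval : sval M t = l[t] := by
    rw [sval, List.getD_eq_getElem _ _ (by rw [hlen]; exact ht)]
  have hsort : l.Pairwise (· ≥ ·) := List.pairwise_insertionSort _ _
  have h1 : ∀ x ∈ l.take (t + 1), s < x := by
    intro x hx
    obtain ⟨i, hi, rfl⟩ := List.mem_iff_getElem.1 hx
    rw [List.getElem_take]
    have hi' : i ≤ t := by simp at hi; omega
    refine lt_of_lt_of_le (hsval ▸ h) ?_
    rcases hi'.eq_or_lt with rfl | hlt
    · exact le_rfl
    · exact List.pairwise_iff_getElem.1 hsort i t _ _ hlt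
  have h2 : t + 1 ≤ l.countP (fun x => decide (s < x)) := by
    have h3 : (l.take (t + 1)).countP (fun x => decide (s < x)) = t + 1 := by
      rw [List.countP_eq_length.2 (by simpa using h1)]
      simp; omega
    rw [← h3]
    exact (List.take_sublist _ _).countP_le
  rw [hl, (List.perm_insertionSort _ _).countP_eq, List.countP_map, List.ofFn_eq_map,
    List.countP_map] at h2
  refine Nat.lt_of_lt_of_le (Nat.lt_succ_self t) (h2.trans (le_of_eq ?_))
  rw [List.countP_eq_length_filter]
  rfl

/-- An upper bound on a singular value from a bound on a coordinate subspace. -/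
theorem sval_le {m n : ℕ} (M : Matrix (Fin m) (Fin n) ℂ) {j : ℕ} (hj : j < n) {s : ℝ} (hs : 0 ≤ s)
    (h : ∀ z : Fin n → ℂ, (∀ i : Fin n, j < i → z i = 0) → nsq (M *ᵥ z) ≤ s ^ 2 * nsq z) :
    sval M (n - 1 - j) ≤ s := by
  by_contra hlt
  rw [not_le] at hlt
  have hcard := length_lt_card_of_lt_sval M (by omega) hlt
  set hH := Matrix.isHermitian_conjTranspose_mul_self M
  set lam := hH.eigenvalues
  set I := Finset.univ.filter fun i => s < Real.sqrt (lam i)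
  set Y : Matrix (Fin n) (Fin n) ℂ := hH.eigenvectorUnitary.1 with hY
  have h1 : Yᴴ * Y = 1 := by
    have := (Matrix.mem_unitaryGroup_iff').1 hH.eigenvectorUnitary.2
    rwa [star_eq_conjTranspose] at this
  have h3 : Mᴴ * M = Y * diagonal (fun i => (lam i : ℂ)) * Yᴴ := by
    have := hH.spectral_theorem
    rw [Unitary.conjStarAlgAut_apply] at this
    exact this.trans rfl
  let ext : (I → ℂ) →ₗ[ℂ] (Fin n → ℂ) :=
    { toFun := fun c i => if hi : i ∈ I then c ⟨i, hi⟩ else 0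
      map_add' := fun c d => by ext i; by_cases hi : i ∈ I <;> simp [hi]
      map_smul' := fun r c => by ext i; by_cases hi : i ∈ I <;> simp [hi] }
  let F : (I → ℂ) →ₗ[ℂ] ({i : Fin n // j < i} → ℂ) :=
    (LinearMap.funLeft ℂ ℂ Subtype.val) ∘ₗ Matrix.toLin' Y ∘ₗ ext
  have hfr : Module.finrank ℂ ({i : Fin n // j < i} → ℂ) < Module.finrank ℂ (I → ℂ) := by
    rw [Module.finrank_fintype_fun_eq_card, Module.finrank_fintype_fun_eq_card, Fintype.card_coe]
    refine lt_of_le_of_lt ?_ hcard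
    have hc : Fintype.card {i : Fin n // j < (i : ℕ)} = n - 1 - j := by
      rw [Fintype.card_subtype]
      have : (Finset.univ.filter fun i : Fin n => j < (i : ℕ)) = Finset.Ioi ⟨j, hj⟩ := by
        ext i; simp [Fin.lt_def]
      rw [this, Fin.card_Ioi]
    exact hc.le
  obtain ⟨c, hcF, hc0⟩ := (Submodule.ne_bot_iff _).1 (LinearMap.ker_ne_bot_of_finrank_lt hfr)
  set c' := ext c with hc'
  have hne : c' ≠ 0 := by
    intro h0
    apply hc0
    ext ⟨i, hi⟩
    have := congrFun h0 i
    simpa [hc', ext, hi] using this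
  have hsupp : ∀ i, i ∉ I → c' i = 0 := by
    intro i hi
    simp [hc', ext, hi]
  have hz := h (Y *ᵥ c') ?_
  · rw [nsq_mulVec_of_isometry h1] at hz
    have h4 : (nsq (M *ᵥ (Y *ᵥ c')) : ℂ) = ((∑ i, lam i * ‖c' i‖ ^ 2 : ℝ) : ℂ) := by
      rw [nsq_mulVec, h3, star_mulVec, ← dotProduct_mulVec, mulVec_mulVec, mulVec_mulVec]
      have : Yᴴ * (Y * diagonal (fun i => (lam i : ℂ)) * Yᴴ) * Y =
          diagonal (fun i => (lam i : ℂ)) := by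
        rw [Matrix.mul_assoc, Matrix.mul_assoc (Y * _), h1, Matrix.mul_one, ← Matrix.mul_assoc, h1, Matrix.one_mul]
      rw [this]
      simp only [dotProduct, mulVec_diagonal, Pi.star_apply, Complex.ofReal_sum,
        Complex.ofReal_mul, Complex.ofReal_pow]
      refine Finset.sum_congr rfl fun i _ => ?_
      rw [← Complex.conj_mul' (c' i), RCLike.star_def]
      ring
    have h5 : nsq (M *ᵥ (Y *ᵥ c')) = ∑ i, lam i * ‖c' i‖ ^ 2 := by exact_mod_cast h4
    rw [h5, nsq, Finset.mul_sum] at hz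
    obtain ⟨i, hi⟩ := Function.ne_iff.1 hne
    have hlam : ∀ i ∈ I, s ^ 2 < lam i := by
      intro i hi
      have := (Finset.mem_filter.1 hi).2
      exact (Real.lt_sqrt hs).1 this
    refine absurd hz (not_le.2 (Finset.sum_lt_sum (fun i _ => ?_) ⟨i, Finset.mem_univ i, ?_⟩))
    · by_cases hiI : i ∈ I
      · exact mul_le_mul_of_nonneg_right (hlam i hiI).le (by positivity)
      · simp [hsupp i hiI]
    · have hiI : i ∈ I := by
        by_contra h0
        exact hi (hsupp i h0)
      have : 0 < ‖c' i‖ := norm_pos_iff.2 hi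
      exact mul_lt_mul_of_pos_right (hlam i hiI) (by positivity)
  · intro i hi
    have hFc : F c = 0 := hcF
    exact congrFun hFc ⟨i, hi⟩

end SingularValues

section CanonicalAngles

theorem nsq_append {k c : ℕ} (z : Fin k → ℂ) (e : Fin c → ℂ) :
    nsq (Fin.append z e) = nsq z + nsq e := by
  simp [nsq, Fin.sum_univ_add]

theorem nsq_smul {α : Type*} [Fintype α] (r : ℝ) (z : α → ℂ) :
    nsq ((r : ℂ) • z) = r ^ 2 * nsq z := by
  simp [nsq, mul_pow, Finset.mul_sum]

theorem colsL_mulVec {a k c : ℕ} (U : Matrix (Fin a) (Fin (k + c)) ℂ) (z : Fin k → ℂ) :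
    colsL U *ᵥ z = U *ᵥ Fin.append z 0 := by
  ext i
  simp [mulVec, dotProduct, Fin.sum_univ_add, colsL]

theorem conjTranspose_mulVec_eq_append {a k c : ℕ} (U : Matrix (Fin a) (Fin (k + c)) ℂ)
    (r : Fin a → ℂ) : Uᴴ *ᵥ r = Fin.append ((colsL U)ᴴ *ᵥ r) ((colsR U)ᴴ *ᵥ r) := by
  ext i
  refine Fin.addCases (fun i => ?_) (fun i => ?_) i <;>
    simp [mulVec, dotProduct, colsL, colsR]

theorem conjTranspose_colsL_mul_colsL {a k c : ℕ} {U : Matrix (Fin a) (Fin (k + c)) ℂ}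
    (hU : Uᴴ * U = 1) : (colsL U)ᴴ * colsL U = 1 := by
  ext i j
  have h := congrFun (congrFun hU (Fin.castAdd c i)) (Fin.castAdd c j)
  simpa [mul_apply, colsL, one_apply] using h

theorem nsq_residual_le {a b : ℕ} {Q : Matrix (Fin a) (Fin b) ℂ} (hQ : Qᴴ * Q = 1)
    (v : Fin a → ℂ) : nsq ((1 - Q * Qᴴ) *ᵥ v) ≤ nsq v := by
  have hP : (1 - Q * Qᴴ)ᴴ * (1 - Q * Qᴴ) = 1 - Qᴴᴴ * Qᴴ := by
    rw [conjTranspose_sub, conjTranspose_one, conjTranspose_mul, conjTranspose_conjTranspose,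
      Matrix.sub_mul, Matrix.one_mul, Matrix.mul_sub, Matrix.mul_one, Matrix.mul_assoc Q Qᴴ,
      ← Matrix.mul_assoc Qᴴ Q, hQ, Matrix.one_mul, sub_self, sub_zero]
  have h1 := nsq_mulVec (1 - Q * Qᴴ) v
  rw [hP, sub_mulVec 1 (Qᴴᴴ * Qᴴ), one_mulVec, dotProduct_sub, star_dotProduct_self, ← nsq_mulVec] at h1
  have h2 : nsq ((1 - Q * Qᴴ) *ᵥ v) = nsq v - nsq (Qᴴ *ᵥ v) := by exact_mod_cast h1
  linarith [nsq_nonneg (Qᴴ *ᵥ v)]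

/-- If the range of `Q` contains a graph of slope `κ` over the first `j + 1` columns of `U`,
then the corresponding canonical angle has tangent at most `κ`. -/
theorem sval_residual_le {a b k c : ℕ} {U : Matrix (Fin a) (Fin (k + c)) ℂ} (hU : Uᴴ * U = 1)
    {Q : Matrix (Fin a) (Fin b) ℂ} (hQ : Qᴴ * Q = 1) (j : Fin k) {κ : ℝ} (hκ : 0 ≤ κ)
    (h : ∀ z : Fin k → ℂ, (∀ i : Fin k, (j : ℕ) < i → z i = 0) →
      ∃ e : Fin c → ℂ, nsq e ≤ κ ^ 2 * nsq z ∧ ∃ x, U *ᵥ Fin.append z e = Q *ᵥ x) :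
    sval ((1 - Q * Qᴴ) * colsL U) (k - 1 - (j : ℕ)) ≤ κ / Real.sqrt (1 + κ ^ 2) := by
  refine sval_le _ j.2 (by positivity) fun z hz => ?_
  obtain ⟨e, he, x, hx⟩ := h z hz
  set s : ℝ := 1 / (1 + κ ^ 2) with hs
  have hkill : (1 - Q * Qᴴ) *ᵥ (U *ᵥ Fin.append z e) = 0 := by
    rw [hx, mulVec_mulVec, Matrix.sub_mul, Matrix.one_mul, Matrix.mul_assoc, hQ, Matrix.mul_one,
      sub_self, zero_mulVec]
  have hdecomp : Fin.append z 0 - (s : ℂ) • Fin.append z e =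
      Fin.append (((1 - s : ℝ) : ℂ) • z) (((-s : ℝ) : ℂ) • e) := by
    ext i
    refine Fin.addCases (fun i => ?_) (fun i => ?_) i
    · simp; ring
    · simp
  have heq : ((1 - Q * Qᴴ) * colsL U) *ᵥ z =
      (1 - Q * Qᴴ) *ᵥ (U *ᵥ (Fin.append (((1 - s : ℝ) : ℂ) • z) (((-s : ℝ) : ℂ) • e))) := by
    rw [← hdecomp, mulVec_sub, mulVec_sub, mulVec_smul, mulVec_smul, hkill, smul_zero, sub_zero,
      ← mulVec_mulVec, colsL_mulVec]
  rw [heq]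
  refine (nsq_residual_le hQ _).trans ?_
  rw [nsq_mulVec_of_isometry hU, nsq_append, nsq_smul, nsq_smul, div_pow,
    Real.sq_sqrt (by positivity)]
  have hfin : (1 - s) ^ 2 + (-s) ^ 2 * κ ^ 2 = κ ^ 2 / (1 + κ ^ 2) := by
    rw [hs]; field_simp; ring
  rw [← hfin, add_mul, mul_assoc ((-s) ^ 2)]
  gcongr

/-- The range of a projection contains a graph over the range of `colsL V`. -/
theorem exists_graph {k c : ℕ} {V : Matrix (Fin (k + c)) (Fin (k + c)) ℂ}
    (hV' : V * Vᴴ = 1) {E : Matrix (Fin (k + c)) (Fin (k + c)) ℂ} (hE : E ∈ symProj (Fin (k + c)))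
    {Y : Matrix (Fin k) (Fin k) ℂ} {φ : Fin k → ℝ} (hY : Yᴴ * Y = 1) (hY' : Y * Yᴴ = 1)
    (hΦ : compr (colsL V) E = infl Y (diagR φ)) {X : ℝ} (hφ0 : ∀ l, 0 ≤ φ l)
    (hφ : ∀ l, 1 - φ l ≤ X ^ 2 * φ l) (v : Fin k → ℂ) :
    ∃ f : Fin c → ℂ, nsq f ≤ X ^ 2 * nsq v ∧ ∃ y, V *ᵥ Fin.append v f = E *ᵥ y := by
  have hpos : ∀ l, 0 < φ l := by
    intro l
    refine lt_of_le_of_ne (hφ0 l) fun h => ?_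
    have := hφ l
    rw [← h] at this
    norm_num at this
  set Φi := infl Y (diagR fun l => (φ l)⁻¹) with hΦi
  have hinv : infl Y (diagR φ) * Φi = 1 := by
    rw [hΦi, infl_mul_infl hY]
    have : diagR φ * diagR (fun l => (φ l)⁻¹) = 1 := by
      rw [diagR, diagR, diagonal_mul_diagonal, ← diagonal_one]
      congr 1
      ext l
      rw [← Complex.ofReal_mul, mul_inv_cancel₀ (hpos l).ne', Complex.ofReal_one]
    rw [this, infl, Matrix.mul_one, hY']
  have hΦiH : Φiᴴ = Φi := by
    rw [hΦi, infl, conjTranspose_mul, conjTranspose_mul, conjTranspose_conjTranspose,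
      ← Matrix.mul_assoc]
    congr 2
    rw [diagR, diagonal_conjTranspose]
    congr 1
    ext l
    simp
  set y := colsL V *ᵥ (Φi *ᵥ v) with hy
  set r := E *ᵥ y with hr
  refine ⟨(colsR V)ᴴ *ᵥ r, ?_, y, ?_⟩
  all_goals
    have hv : (colsL V)ᴴ *ᵥ r = v := by
      rw [hr, hy, mulVec_mulVec, mulVec_mulVec, mulVec_mulVec]
      have : (colsL V)ᴴ * E * colsL V * Φi = 1 := by
        rw [← hinv, ← hΦ, compr]
      rw [this, one_mulVec]
    have happ := conjTranspose_mulVec_eq_append V r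
    rw [hv] at happ
  · have h1 : nsq r = nsq v + nsq ((colsR V)ᴴ *ᵥ r) := by
      rw [← nsq_append, ← happ, nsq_mulVec_of_isometry (M := Vᴴ)]
      rw [conjTranspose_conjTranspose, hV']
    have h2 : (nsq r : ℂ) = ((∑ l, (φ l)⁻¹ * ‖(Yᴴ *ᵥ v) l‖ ^ 2 : ℝ) : ℂ) := by
      have hM : (E * colsL V * Φi)ᴴ * (E * colsL V * Φi) = Φi := by
        rw [conjTranspose_mul, conjTranspose_mul, hΦiH, hE.2.1]
        calc Φi * ((colsL V)ᴴ * E) * (E * colsL V * Φi)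
            = Φi * ((colsL V)ᴴ * (E * E) * colsL V * Φi) := by simp only [Matrix.mul_assoc]
          _ = Φi * (infl Y (diagR φ) * Φi) := by rw [hE.2.2, ← hΦ, compr]
          _ = Φi := by rw [hinv, Matrix.mul_one]
      rw [hr, hy, mulVec_mulVec, mulVec_mulVec, nsq_mulVec, hM, hΦi, infl,
        ← mulVec_mulVec, ← mulVec_mulVec, dotProduct_mulVec]
      have hst : star v ᵥ* Y = star (Yᴴ *ᵥ v) := by
        rw [star_mulVec, conjTranspose_conjTranspose]
      rw [hst]
      simp only [dotProduct, diagR, mulVec_diagonal, Pi.star_apply, Complex.ofReal_sum,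
        Complex.ofReal_mul, Complex.ofReal_pow]
      refine Finset.sum_congr rfl fun l _ => ?_
      rw [← Complex.conj_mul', RCLike.star_def]
      ring
    have h3 : nsq r = ∑ l, (φ l)⁻¹ * ‖(Yᴴ *ᵥ v) l‖ ^ 2 := by exact_mod_cast h2
    have h4 : nsq r ≤ (1 + X ^ 2) * nsq v := by
      rw [h3, ← nsq_mulVec_of_isometry (M := Yᴴ) (by rw [conjTranspose_conjTranspose, hY']) v, nsq,
        Finset.mul_sum]
      refine Finset.sum_le_sum fun l _ => mul_le_mul_of_nonneg_right ?_ (by positivity)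
      rw [inv_le_iff_one_le_mul₀ (hpos l)]
      linarith [hφ l]
    linarith
  · rw [← happ, mulVec_mulVec, hV', one_mulVec]

/-- The matrix `D` scales the first `k` coordinates by `s` and the others by at most `s k`. -/
def ActsDiagonally {k c c' : ℕ} (D : Matrix (Fin (k + c)) (Fin (k + c')) ℂ) (s : ℕ → ℝ) : Prop :=
  ∀ v f, ∃ e, D *ᵥ Fin.append v f = Fin.append (fun i : Fin k => (s i : ℂ) * v i) e ∧
    nsq e ≤ s k ^ 2 * nsq f

theorem ActsDiagonally.mul {k c c' c'' : ℕ} {D : Matrix (Fin (k + c)) (Fin (k + c')) ℂ}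
    {D' : Matrix (Fin (k + c')) (Fin (k + c'')) ℂ} {s s' : ℕ → ℝ} (h : ActsDiagonally D s)
    (h' : ActsDiagonally D' s') : ActsDiagonally (D * D') (fun i => s i * s' i) := by
  intro v f
  obtain ⟨e', he', hn'⟩ := h' v f
  obtain ⟨e, he, hn⟩ := h (fun i : Fin k => (s' i : ℂ) * v i) e'
  refine ⟨e, ?_, ?_⟩
  · rw [← mulVec_mulVec, he', he]
    congr 1
    ext i
    push_cast
    ring
  · refine hn.trans ?_
    rw [mul_pow, mul_assoc]
    gcongr

theorem actsDiagonally_diagRect {σ : ℕ → ℝ} (hσ0 : ∀ i, 0 ≤ σ i) (hσm : ∀ i j, i ≤ j → σ j ≤ σ i)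
    (k a b : ℕ) : ActsDiagonally (diagRect σ 0 (k + a) (k + b)) σ := by
  intro v f
  refine ⟨diagRect σ k a b *ᵥ f, ?_, ?_⟩
  · ext i
    refine Fin.addCases (fun i => ?_) (fun i => ?_) i
    · have h1 : ∀ x : Fin b, ((i : ℕ) = k + (x : ℕ)) ↔ False := fun x => by
        have := i.2
        constructor
        · omega
        · exact False.elim
      simp [mulVec, dotProduct, Fin.sum_univ_add, diagRect, h1, ← Fin.ext_iff]
    · have h1 : ∀ x : Fin k, (k + (i : ℕ) = (x : ℕ)) ↔ False := fun x => by
        have := x.2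
        constructor
        · omega
        · exact False.elim
      simp [mulVec, dotProduct, Fin.sum_univ_add, diagRect, h1]
  · have h1 : ∀ i : Fin a, ‖(diagRect σ k a b *ᵥ f) i‖ ^ 2 ≤
        ∑ x : Fin b, if (i : ℕ) = (x : ℕ) then σ k ^ 2 * ‖f x‖ ^ 2 else 0 := by
      intro i
      by_cases hi : (i : ℕ) < b
      · have h2 : ∀ x : Fin b, ((i : ℕ) = (x : ℕ)) ↔ (⟨i, hi⟩ : Fin b) = x := fun x => by
          rw [Fin.ext_iff]
        simp only [mulVec, dotProduct, diagRect, of_apply, h2, ite_mul, zero_mul,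
          Finset.sum_ite_eq, Finset.mem_univ, if_true]
        rw [norm_mul, mul_pow, Complex.norm_real, Real.norm_of_nonneg (hσ0 _)]
        have := hσm k (k + i) (by omega)
        have := hσ0 (k + i)
        gcongr
      · have h2 : ∀ x : Fin b, ((i : ℕ) = (x : ℕ)) ↔ False := fun x => by
          have := x.2
          constructor
          · omega
          · exact False.elim
        simp [mulVec, dotProduct, diagRect, h2]
    rw [nsq, nsq, Finset.mul_sum]
    refine (Finset.sum_le_sum fun i _ => h1 i).trans ?_
    rw [Finset.sum_comm]
    refine Finset.sum_le_sum fun x _ => ?_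
    by_cases hx : (x : ℕ) < a
    · have h2 : ∀ i : Fin a, ((i : ℕ) = (x : ℕ)) ↔ i = ⟨x, hx⟩ := fun i => by
        rw [Fin.ext_iff]
      simp [h2]
    · have h2 : ∀ i : Fin a, ((i : ℕ) = (x : ℕ)) ↔ False := fun i => by
        have := i.2
        constructor
        · omega
        · exact False.elim
      simp only [h2, if_false, Finset.sum_const_zero]
      positivity

theorem conjTranspose_diagRect (σ : ℕ → ℝ) (a b : ℕ) :
    (diagRect σ 0 a b)ᴴ = diagRect σ 0 b a := by
  ext i j
  by_cases h : (j : ℕ) = i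
  · simp [diagRect, h]
  · simp [diagRect, h, Ne.symm h]

/-- Transport of the graph property through a diagonal scaling with a gap. -/
theorem sval_residual_le_of_diagonal {a b g k c c' : ℕ} {U : Matrix (Fin a) (Fin (k + c)) ℂ}
    (hU : Uᴴ * U = 1) {Q : Matrix (Fin a) (Fin b) ℂ} (hQ : Qᴴ * Q = 1)
    {V : Matrix (Fin g) (Fin (k + c')) ℂ} (hV : Vᴴ * V = 1)
    {D : Matrix (Fin (k + c)) (Fin (k + c')) ℂ} {s : ℕ → ℝ} {E : Matrix (Fin g) (Fin g) ℂ}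
    (hs0 : 0 ≤ s k) (hs : ∀ i : Fin k, 0 < s i) (hsm : ∀ i i' : Fin k, i ≤ i' → s i' ≤ s i)
    (hD : ActsDiagonally D s) {X : ℝ} (hX : 0 ≤ X)
    (hf : ∀ v : Fin k → ℂ, ∃ f : Fin c' → ℂ, nsq f ≤ X ^ 2 * nsq v ∧
      ∃ y, V *ᵥ Fin.append v f = E *ᵥ y)
    (hr : ∀ y, ∃ x, (U * D * Vᴴ) *ᵥ (E *ᵥ y) = Q *ᵥ x) (j : Fin k) :
    sval ((1 - Q * Qᴴ) * colsL U) (k - 1 - (j : ℕ)) ≤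
      s k / s j * X / Real.sqrt (1 + (s k / s j * X) ^ 2) := by
  refine sval_residual_le hU hQ j (mul_nonneg (div_nonneg hs0 (hs j).le) hX) fun z hz => ?_
  obtain ⟨f, hfX, y, hy⟩ := hf fun i => ((s i)⁻¹ : ℝ) * z i
  obtain ⟨e, he, hen⟩ := hD (fun i => ((s i)⁻¹ : ℝ) * z i) f
  obtain ⟨x, hx⟩ := hr y
  refine ⟨e, ?_, x, ?_⟩
  · have h1 : nsq (fun i : Fin k => (((s i)⁻¹ : ℝ) : ℂ) * z i) ≤ ((s j)⁻¹) ^ 2 * nsq z := by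
      rw [nsq, nsq, Finset.mul_sum]
      refine Finset.sum_le_sum fun i _ => ?_
      by_cases hij : (j : ℕ) < i
      · simp [hz i hij]
      · have h2 : s j ≤ s i := hsm i j (not_lt.1 hij)
        rw [norm_mul, mul_pow, Complex.norm_real, Real.norm_of_nonneg (inv_nonneg.2 (hs i).le)]
        have hj := hs j
        have hi := hs i
        gcongr
    calc nsq e ≤ s k ^ 2 * (X ^ 2 * (((s j)⁻¹) ^ 2 * nsq z)) := by
          refine hen.trans ?_
          gcongr
          refine hfX.trans ?_
          gcongr
      _ = _ := by ring
  · rw [← hx, ← hy, ← mulVec_mulVec, mulVec_mulVec _ Vᴴ, hV, one_mulVec, ← mulVec_mulVec, he]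
    congr 2
    ext i
    rw [← mul_assoc, ← Complex.ofReal_mul, mul_inv_cancel₀ (hs i).ne', Complex.ofReal_one, one_mul]

/-- The tangent-to-sine map `u ↦ u / √(1 + u²)`. -/
noncomputable def sinOfTan (u : ℝ) : ℝ := u / Real.sqrt (1 + u ^ 2)

theorem actsDiagonally_power {σ : ℕ → ℝ} (hσ0 : ∀ i, 0 ≤ σ i) (hσm : ∀ i j, i ≤ j → σ j ≤ σ i)
    (k a b q : ℕ) : ActsDiagonally ((diagRect σ 0 (k + a) (k + b) *
      (diagRect σ 0 (k + a) (k + b))ᴴ) ^ q * diagRect σ 0 (k + a) (k + b))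
      (fun i => σ i ^ (2 * q + 1)) := by
  induction q with
  | zero => simpa using actsDiagonally_diagRect hσ0 hσm k a b
  | succ q ih =>
    rw [pow_succ', Matrix.mul_assoc, Matrix.mul_assoc, conjTranspose_diagRect]
    rw [conjTranspose_diagRect] at ih
    convert (actsDiagonally_diagRect hσ0 hσm k a b).mul
      ((actsDiagonally_diagRect hσ0 hσm k b a).mul ih) using 2
    ring

theorem gram_pow_mul {a b : ℕ} {U : Matrix (Fin a) (Fin a) ℂ} {V : Matrix (Fin b) (Fin b) ℂ}
    (hU : Uᴴ * U = 1) (hV : Vᴴ * V = 1) (D : Matrix (Fin a) (Fin b) ℂ) (q : ℕ) :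
    (U * D * Vᴴ * (U * D * Vᴴ)ᴴ) ^ q * (U * D * Vᴴ) = U * ((D * Dᴴ) ^ q * D) * Vᴴ := by
  induction q with
  | zero => simp
  | succ q ih =>
    rw [pow_succ', Matrix.mul_assoc, ih, conjTranspose_mul, conjTranspose_mul,
      conjTranspose_conjTranspose, pow_succ']
    calc U * D * Vᴴ * (V * (Dᴴ * Uᴴ)) * (U * ((D * Dᴴ) ^ q * D) * Vᴴ)
        = U * D * (Vᴴ * V) * Dᴴ * (Uᴴ * U) * ((D * Dᴴ) ^ q * D) * Vᴴ := by
          simp only [Matrix.mul_assoc]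
      _ = _ := by
          rw [hU, hV]
          simp only [Matrix.mul_assoc, Matrix.mul_one]

/-- Both families of canonical angles are controlled by the angle between the range of the starting
guess and the leading right singular subspace. -/
theorem sval_angles_le {k m₂ n₂ N q : ℕ} {A : Matrix (Fin (k + m₂)) (Fin (k + n₂)) ℂ}
    {U : Matrix (Fin (k + m₂)) (Fin (k + m₂)) ℂ} {V : Matrix (Fin (k + n₂)) (Fin (k + n₂)) ℂ}
    {σ : ℕ → ℝ} (hU : Uᴴ * U = 1) (hV : Vᴴ * V = 1) (hV' : V * Vᴴ = 1)
    (hσ0 : ∀ i, 0 ≤ σ i) (hσm : ∀ i j, i ≤ j → σ j ≤ σ i)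
    (hA : A = U * diagRect σ 0 (k + m₂) (k + n₂) * Vᴴ) (hrank : 0 < σ (k - 1))
    {G : Matrix (Fin (k + n₂)) (Fin N) ℂ} {Q : Matrix (Fin (k + m₂)) (Fin N) ℂ}
    {R : Matrix (Fin N) (Fin N) ℂ} (hQ : Qᴴ * Q = 1) (hQR : (A * Aᴴ) ^ q * A * G = Q * R)
    {UB : Matrix (Fin N) (Fin N) ℂ} {Vh : Matrix (Fin (k + n₂)) (Fin N) ℂ}
    {Dh : Matrix (Fin N) (Fin N) ℂ} (hUB : UBᴴ * UB = 1) (hUB' : UB * UBᴴ = 1) (hVh : Vhᴴ * Vh = 1)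
    (hB : Qᴴ * A = UB * Dh * Vhᴴ) {E : Matrix (Fin (k + n₂)) (Fin (k + n₂)) ℂ}
    (hE : E ∈ symProj (Fin (k + n₂))) {Z : Matrix (Fin N) (Fin (k + n₂)) ℂ} (hEG : E = G * Z)
    {Y : Matrix (Fin k) (Fin k) ℂ} {φ : Fin k → ℝ} (hY : Yᴴ * Y = 1) (hY' : Y * Yᴴ = 1)
    (hΦ : compr (colsL V) E = infl Y (diagR φ)) {X : ℝ} (hX : 0 ≤ X) (hφ0 : ∀ l, 0 ≤ φ l)
    (hφ : ∀ l, 1 - φ l ≤ X ^ 2 * φ l) (j : Fin k) :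
    sval ((1 - Q * UB * (Q * UB)ᴴ) * colsL U) (k - 1 - (j : ℕ)) ≤
        sinOfTan ((σ k / σ j) ^ (2 * q + 1) * X) ∧
      sval ((1 - Vh * Vhᴴ) * colsL V) (k - 1 - (j : ℕ)) ≤
        sinOfTan ((σ k / σ j) ^ (2 * q + 2) * X) := by
  have hpos : ∀ i : Fin k, 0 < σ i := fun i => hrank.trans_le (hσm _ _ (by omega))
  have hf := exists_graph hV' hE hY hY' hΦ hφ0 hφ
  have hD := actsDiagonally_power hσ0 hσm k m₂ n₂ q
  have hpow := gram_pow_mul hU hV (diagRect σ 0 (k + m₂) (k + n₂)) q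
  rw [← hA] at hpow
  have hrange : (A * Aᴴ) ^ q * A * E = Q * (R * Z) := by
    rw [hEG, ← Matrix.mul_assoc, hQR, Matrix.mul_assoc]
  constructor
  · have hQUB : (Q * UB)ᴴ * (Q * UB) = 1 := by
      rw [conjTranspose_mul, Matrix.mul_assoc, ← Matrix.mul_assoc Qᴴ, hQ, Matrix.one_mul, hUB]
    have h := sval_residual_le_of_diagonal hU hQUB hV (by have := hσ0 k; positivity)
      (fun i => pow_pos (hpos i) _)
      (fun i i' hii => pow_le_pow_left₀ (hσ0 _) (hσm _ _ hii) _) hD hX hf ?_ j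
    · rwa [← div_pow] at h
    · intro y
      refine ⟨(UBᴴ * (R * Z)) *ᵥ y, ?_⟩
      rw [← hpow, mulVec_mulVec, hrange, mulVec_mulVec, Matrix.mul_assoc Q UB,
        ← Matrix.mul_assoc UB, hUB', Matrix.one_mul]
  · have hD' := (actsDiagonally_diagRect hσ0 hσm k n₂ m₂).mul hD
    have h := sval_residual_le_of_diagonal hV hVh hV
      (mul_nonneg (hσ0 k) (pow_nonneg (hσ0 k) _))
      (fun i => mul_pos (hpos i) (pow_pos (hpos i) _))
      (fun i i' hii => mul_le_mul (hσm _ _ hii) (pow_le_pow_left₀ (hσ0 _) (hσm _ _ hii) _)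
        (pow_nonneg (hσ0 _) _) (hσ0 _)) hD' hX hf ?_ j
    · simp only [← pow_succ'] at h
      rwa [← div_pow] at h
    · intro y
      refine ⟨(Dhᴴ * UBᴴ * (R * Z)) *ᵥ y, ?_⟩
      have h1 : Aᴴ * Q = Vh * (Dhᴴ * UBᴴ) := by
        have := congrArg conjTranspose hB
        rwa [conjTranspose_mul, conjTranspose_conjTranspose, conjTranspose_mul, conjTranspose_mul,
          conjTranspose_conjTranspose] at this
      have h2 : V * (diagRect σ 0 (k + n₂) (k + m₂) * ((diagRect σ 0 (k + m₂) (k + n₂) *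
          (diagRect σ 0 (k + m₂) (k + n₂))ᴴ) ^ q * diagRect σ 0 (k + m₂) (k + n₂))) * Vᴴ =
          Aᴴ * ((A * Aᴴ) ^ q * A) := by
        rw [hpow]
        conv_rhs => rw [hA]
        rw [conjTranspose_mul, conjTranspose_mul, conjTranspose_conjTranspose,
          conjTranspose_diagRect]
        simp only [Matrix.mul_assoc]
        rw [← Matrix.mul_assoc Uᴴ U, hU, Matrix.one_mul]
      rw [h2, mulVec_mulVec, Matrix.mul_assoc, hrange, ← Matrix.mul_assoc, h1, mulVec_mulVec]
      simp only [Matrix.mul_assoc]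

end CanonicalAngles

section Gaussian

open MeasureTheory ProbabilityTheory

variable {α β : Type*} [Fintype α] [DecidableEq α] [Fintype β] [DecidableEq β]

/-- The standard Gaussian law on families indexed by the entries of a matrix. -/
noncomputable abbrev gaussFamily (α β : Type*) [Fintype α] [Fintype β] : Measure (α × β → ℝ) :=
  Measure.pi fun _ => gaussianReal 0 1

/-- The matrix with a given family of entries. -/
def entryMatrix (x : α × β → ℝ) : Matrix α β ℝ := of fun i j => x (i, j)

theorem gaussianReal_le_volume : gaussianReal 0 1 ≤ (volume : Measure ℝ) := by
  rw [gaussianReal_of_var_ne_zero 0 one_ne_zero]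
  refine (withDensity_mono (Filter.Eventually.of_forall fun x => ?_)).trans_eq withDensity_one
  rw [gaussianPDF, Pi.one_apply, ENNReal.ofReal_le_one, gaussianPDFReal]
  refine mul_le_one₀ (inv_le_one_of_one_le₀ ?_) (Real.exp_pos _).le ?_
  · rw [Real.one_le_sqrt]
    have := Real.pi_gt_three
    simp
    linarith
  · rw [Real.exp_le_one_iff]
    refine div_nonpos_of_nonpos_of_nonneg (by simp; positivity) (by simp)

theorem pi_gaussianReal_le_volume {ι : Type*} [Fintype ι] :
    (Measure.pi fun _ : ι => gaussianReal 0 1) ≤ (volume : Measure (ι → ℝ)) := by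
  refine Measure.le_iff.2 fun s hs => ?_
  have h : (Measure.pi fun _ : ι => gaussianReal 0 1).toOuterMeasure ≤
      OuterMeasure.pi fun _ : ι => (volume : Measure ℝ).toOuterMeasure := by
    refine OuterMeasure.le_pi.2 fun t _ => ?_
    rw [Measure.coe_toOuterMeasure, Measure.pi_pi]
    exact Finset.prod_le_prod' fun i _ => gaussianReal_le_volume (t i)
  have hv : (volume : Measure (ι → ℝ)) s =
      OuterMeasure.pi (fun _ : ι => (volume : Measure ℝ).toOuterMeasure) s := by
    rw [volume_pi, Measure.pi, toMeasure_apply _ _ hs]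
  rw [hv]
  exact h s

/-- A square Gaussian matrix is almost surely invertible; stated for a square submatrix. -/
theorem ae_det_submatrix_ne_zero (e : β ↪ α) :
    ∀ᵐ x ∂(gaussFamily α β), ((entryMatrix x).submatrix e id).det ≠ 0 := by
  refine Measure.ae_mono' (Measure.absolutelyContinuous_of_le pi_gaussianReal_le_volume) ?_
  have hcont : Continuous fun x : α × β → ℝ => ((entryMatrix x).submatrix e id).det := by
    refine Continuous.matrix_det ?_
    exact continuous_pi fun i => continuous_pi fun j => continuous_apply (e i, j)
  let d : α × β → ℝ := fun ij => if ij.1 = e ij.2 then 1 else 0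
  have hs : MeasurableSet {x : α × β → ℝ | ((entryMatrix x).submatrix e id).det ≠ 0} :=
    (isOpen_ne.preimage hcont).measurableSet
  refine ae_mem_of_ae_add_linearMap_mem (LinearMap.toSpanSingleton ℝ _ d) volume volume hs
    fun y => ?_
  set M := (entryMatrix y).submatrix e id with hM
  have hdet : ∀ t : ℝ, ((entryMatrix (y + t • d)).submatrix e id).det =
      (-M).charpoly.eval t := by
    intro t
    rw [eval_charpoly, sub_neg_eq_add]
    congr 1
    ext i j
    by_cases h : i = j
    · simp [entryMatrix, hM, d, h, add_comm]
    · simp [entryMatrix, hM, d, h, scalar_apply]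
  have hfin : {t : ℝ | (-M).charpoly.eval t = 0}.Finite := by
    refine ((-M).charpoly.roots.toFinset.finite_toSet).subset fun t ht => ?_
    simpa [(charpoly_monic (-M)).ne_zero] using ht
  rw [ae_iff]
  refine measure_mono_null (fun t ht => ?_) (hfin.measure_zero volume)
  have ht' : ((entryMatrix (y + t • d)).submatrix e id).det = 0 := not_not.1 ht
  rw [hdet] at ht'
  exact ht'

theorem ae_det_gram_ne_zero (e : β ↪ α) :
    ∀ᵐ x ∂(gaussFamily α β), ((entryMatrix x)ᵀ * entryMatrix x).det ≠ 0 := by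
  filter_upwards [ae_det_submatrix_ne_zero e] with x hx h0
  obtain ⟨v, hv, hv0⟩ := exists_mulVec_eq_zero_iff.2 h0
  have h1 : entryMatrix x *ᵥ v = 0 := by
    rw [← dotProduct_self_eq_zero, dotProduct_mulVec, vecMul_mulVec, ← dotProduct_mulVec, hv0,
      dotProduct_zero]
  refine hx (exists_mulVec_eq_zero_iff.1 ⟨v, hv, ?_⟩)
  ext i
  exact congrFun h1 (e i)

/-- Left multiplication by an orthogonal matrix, on families of entries. -/
def rotFamily (O : Matrix α α ℝ) (x : α × β → ℝ) : α × β → ℝ :=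
  fun ij => ∑ l, O ij.1 l * x (l, ij.2)

theorem entryMatrix_rotFamily (O : Matrix α α ℝ) (x : α × β → ℝ) :
    entryMatrix (rotFamily O x) = O * entryMatrix x := by
  ext i j
  simp [entryMatrix, rotFamily, mul_apply]

theorem continuous_rotFamily (O : Matrix α α ℝ) :
    Continuous (rotFamily O : (α × β → ℝ) → α × β → ℝ) := by
  unfold rotFamily
  fun_prop

theorem sum_rotFamily_sq {O : Matrix α α ℝ} (hO : O * Oᵀ = 1) (x : α × β → ℝ) :
    ∑ ij, rotFamily O x ij ^ 2 = ∑ ij, x ij ^ 2 := by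
  have hO' : Oᵀ * O = 1 := mul_eq_one_comm.1 hO
  have h : ∀ y : α × β → ℝ, ∑ ij, y ij ^ 2 = ((entryMatrix y)ᵀ * entryMatrix y).trace := by
    intro y
    rw [Fintype.sum_prod_type_right]
    simp [trace, mul_apply, entryMatrix, sq]
  rw [h, h, entryMatrix_rotFamily, transpose_mul, Matrix.mul_assoc, ← Matrix.mul_assoc Oᵀ, hO',
    Matrix.one_mul]

/-- Rotation invariance of the standard Gaussian law. -/
theorem map_rotFamily_gaussFamily {O : Matrix α α ℝ} (hO : O * Oᵀ = 1) :
    (gaussFamily α β).map (rotFamily O) = gaussFamily α β := by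
  let T : EuclideanSpace ℝ (α × β) →ₗ[ℝ] EuclideanSpace ℝ (α × β) :=
    { toFun := fun x => WithLp.toLp 2 (rotFamily O x.ofLp)
      map_add' := fun x y => by
        ext ij; simp [rotFamily, mul_add, Finset.sum_add_distrib]
      map_smul' := fun c x => by
        ext ij; simp [rotFamily, Finset.mul_sum, mul_left_comm] }
  let Ti : EuclideanSpace ℝ (α × β) →ₗᵢ[ℝ] EuclideanSpace ℝ (α × β) :=
    { toLinearMap := T
      norm_map' := fun x => by
        rw [← sq_eq_sq₀ (norm_nonneg _) (norm_nonneg _), EuclideanSpace.real_norm_sq_eq,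
          EuclideanSpace.real_norm_sq_eq]
        exact sum_rotFamily_sq hO x.ofLp }
  let Te := Ti.toLinearIsometryEquiv rfl
  have h1 := stdGaussian_map Te
  rw [← map_pi_eq_stdGaussian, Measure.map_map (by fun_prop) (by fun_prop)] at h1
  have h2 := congrArg (Measure.map (WithLp.ofLp : EuclideanSpace ℝ (α × β) → _)) h1
  rw [Measure.map_map (by fun_prop) (by fun_prop), Measure.map_map (by fun_prop) (by fun_prop)]
    at h2
  have h3 : (WithLp.ofLp : EuclideanSpace ℝ (α × β) → _) ∘ (WithLp.toLp 2) =
      (id : (α × β → ℝ) → _) := rfl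
  rw [h3, Measure.map_id] at h2
  exact h2

/-- The orthogonal projection onto the column space of a real matrix with independent columns,
viewed as a complex matrix. -/
noncomputable def rangeProj (M : Matrix α β ℝ) : Matrix α α ℂ :=
  (M * (Mᵀ * M)⁻¹ * Mᵀ).map (fun x => (x : ℂ))

theorem rangeProj_mem_symProj (M : Matrix α β ℝ) : rangeProj M ∈ symProj α := by
  have hT : (M * (Mᵀ * M)⁻¹ * Mᵀ)ᵀ = M * (Mᵀ * M)⁻¹ * Mᵀ := by
    rw [transpose_mul, transpose_mul, transpose_transpose, transpose_nonsing_inv, transpose_mul,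
      transpose_transpose, Matrix.mul_assoc]
  have hI : M * (Mᵀ * M)⁻¹ * Mᵀ * (M * (Mᵀ * M)⁻¹ * Mᵀ) = M * (Mᵀ * M)⁻¹ * Mᵀ := by
    have h : (Mᵀ * M)⁻¹ * (Mᵀ * M) * (Mᵀ * M)⁻¹ = (Mᵀ * M)⁻¹ := by
      by_cases hu : IsUnit (Mᵀ * M).det
      · rw [nonsing_inv_mul _ hu, Matrix.one_mul]
      · rw [nonsing_inv_apply_not_isUnit _ hu, Matrix.mul_zero]
    calc _ = M * ((Mᵀ * M)⁻¹ * (Mᵀ * M) * (Mᵀ * M)⁻¹) * Mᵀ := by simp only [Matrix.mul_assoc]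
      _ = _ := by rw [h]
  refine ⟨?_, ?_, ?_⟩
  · rw [rangeProj, ← transpose_map, hT]
  · ext i j
    have hij := congrFun (congrFun hT i) j
    simp only [rangeProj, conjTranspose_apply, map_apply, RCLike.star_def, Complex.conj_ofReal]
    rw [← hij, transpose_apply]
  · rw [rangeProj, ← map_ofReal_mul, hI]

theorem rangeProj_mul {O : Matrix α α ℝ} (hO : O * Oᵀ = 1) (M : Matrix α β ℝ) :
    rangeProj (O * M) = conjR O (rangeProj M) := by
  have hO' : Oᵀ * O = 1 := mul_eq_one_comm.1 hO
  have h : (O * M)ᵀ * (O * M) = Mᵀ * M := by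
    rw [transpose_mul, Matrix.mul_assoc, ← Matrix.mul_assoc Oᵀ, hO', Matrix.one_mul]
  rw [rangeProj, h, conjR, rangeProj, ← transpose_map, ← map_ofReal_mul, ← map_ofReal_mul,
    transpose_mul]
  simp only [Matrix.mul_assoc]

theorem trace_rangeProj {M : Matrix α β ℝ} (hM : (Mᵀ * M).det ≠ 0) :
    (rangeProj M).trace = Fintype.card β := by
  have h : (M * (Mᵀ * M)⁻¹ * Mᵀ).trace = Fintype.card β := by
    rw [trace_mul_comm, ← Matrix.mul_assoc, mul_nonsing_inv _ (Ne.isUnit hM), trace_one]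
  have h2 : (rangeProj M).trace = ((M * (Mᵀ * M)⁻¹ * Mᵀ).trace : ℂ) := by
    simp [rangeProj, trace]
  rw [h2, h]
  simp

theorem measurable_rangeProj_entryMatrix :
    Measurable fun (x : α × β → ℝ) (i j : α) => rangeProj (entryMatrix x) i j := by
  have hW : Continuous fun x : α × β → ℝ => entryMatrix x :=
    continuous_pi fun i => continuous_pi fun j => continuous_apply (i, j)
  refine measurable_pi_iff.2 fun i => measurable_pi_iff.2 fun j => ?_
  have h : ∀ x : α × β → ℝ, rangeProj (entryMatrix x) i j =
      ((((entryMatrix x)ᵀ * entryMatrix x).det)⁻¹ * ((entryMatrix x *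
        ((entryMatrix x)ᵀ * entryMatrix x).adjugate * (entryMatrix x)ᵀ) i j) : ℝ) := by
    intro x
    rw [rangeProj, map_apply, inv_def, Ring.inverse_eq_inv', Matrix.mul_smul, Matrix.smul_mul,
      Matrix.smul_apply, smul_eq_mul]
  simp only [h]
  refine Complex.measurable_ofReal.comp ?_
  have hgram := hW.matrix_transpose.matrix_mul hW
  exact (hgram.matrix_det.measurable.inv).mul
    (((hW.matrix_mul hgram.matrix_adjugate).matrix_mul hW.matrix_transpose).matrix_elem i
      j).measurable

theorem measurable_comp_rangeProj {f : Matrix α α ℂ → ℂ} (hf : ContinuousOn f (symProj α)) :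
    Measurable fun x : α × β → ℝ => f (rangeProj (entryMatrix x)) := by
  classical
  let s : Set (α → α → ℂ) := symProj α
  let f' : (α → α → ℂ) → ℂ := f
  have hs : MeasurableSet s := by
    have hc : IsClosed s := isClosed_symProj (ι := α)
    exact hc.measurableSet
  have hf' : ContinuousOn f' s := hf
  have h1 : Measurable (s.piecewise f' fun _ => 0) :=
    hf'.measurable_piecewise continuousOn_const hs
  have h2 := h1.comp (measurable_rangeProj_entryMatrix (α := α) (β := β))
  convert h2 using 2 with x
  exact (Set.piecewise_eq_of_mem s f' _ (rangeProj_mem_symProj (entryMatrix x))).symm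

theorem rotInvariant_rangeProj {Ω : Type*} [MeasurableSpace Ω] {μ : Measure Ω}
    {W : Ω → Matrix α β ℝ} (hmeas : ∀ i j, Measurable fun ω => W ω i j)
    (hlaw : μ.map (fun ω (ij : α × β) => W ω ij.1 ij.2) = gaussFamily α β) :
    RotInvariant μ fun ω => rangeProj (W ω) := by
  have hm : Measurable fun ω (ij : α × β) => W ω ij.1 ij.2 :=
    measurable_pi_iff.2 fun ij => hmeas ij.1 ij.2
  have hint : ∀ f : Matrix α α ℂ → ℂ, ContinuousOn f (symProj α) →
      ∫ ω, f (rangeProj (W ω)) ∂μ = ∫ x, f (rangeProj (entryMatrix x)) ∂(gaussFamily α β) := by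
    intro f hf
    rw [← hlaw, integral_map hm.aemeasurable (measurable_comp_rangeProj hf).aestronglyMeasurable]
    rfl
  refine ⟨fun ω => rangeProj_mem_symProj _, fun f hf => ?_, fun O hO f hf => ?_⟩
  · exact ((measurable_comp_rangeProj hf).comp hm).aestronglyMeasurable
  · have hf' : ContinuousOn (fun E => f (conjR O E)) (symProj α) :=
      hf.comp (continuous_conjR O).continuousOn fun E hE => conjR_mem_symProj hO hE
    rw [hint f hf, hint (fun E => f (conjR O E)) hf']
    conv_rhs => rw [← map_rotFamily_gaussFamily hO,
      integral_map (continuous_rotFamily O).measurable.aemeasurable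
        (measurable_comp_rangeProj hf).aestronglyMeasurable]
    refine integral_congr_ae (Filter.Eventually.of_forall fun x => ?_)
    simp only [entryMatrix_rotFamily, rangeProj_mul hO]

end Gaussian

section Limit

open MeasureTheory ProbabilityTheory Filter

theorem sinOfTan_nonneg {u : ℝ} (hu : 0 ≤ u) : 0 ≤ sinOfTan u :=
  div_nonneg hu (Real.sqrt_nonneg _)

/-- The tangent-to-sine map lies below its tangent lines on the half line. -/
theorem sinOfTan_le_tangent {u b : ℝ} (hu : 0 ≤ u) (hb : 0 ≤ b) :
    sinOfTan u ≤ sinOfTan b + (u - b) / Real.sqrt (1 + b ^ 2) ^ 3 := by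
  unfold sinOfTan
  set s := Real.sqrt (1 + u ^ 2) with hs
  set t := Real.sqrt (1 + b ^ 2) with ht
  have hs0 : 0 < s := Real.sqrt_pos.2 (by positivity)
  have ht0 : 0 < t := Real.sqrt_pos.2 (by positivity)
  have hs2 : s ^ 2 = 1 + u ^ 2 := Real.sq_sqrt (by positivity)
  have ht2 : t ^ 2 = 1 + b ^ 2 := Real.sq_sqrt (by positivity)
  have h1 : b / t + (u - b) / t ^ 3 = (b ^ 3 + u) / t ^ 3 := by
    field_simp
    rw [ht2]
    ring
  rw [h1, div_le_div_iff₀ hs0 (by positivity)]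
  refine (sq_le_sq₀ (by positivity) (by positivity)).1 ?_
  have h2 : (u * t ^ 3) ^ 2 = u ^ 2 * (1 + b ^ 2) ^ 3 := by rw [← ht2]; ring
  have h3 : ((b ^ 3 + u) * s) ^ 2 = (b ^ 3 + u) ^ 2 * (1 + u ^ 2) := by rw [← hs2]; ring
  rw [h2, h3, ← sub_nonneg]
  have h4 : (b ^ 3 + u) ^ 2 * (1 + u ^ 2) - u ^ 2 * (1 + b ^ 2) ^ 3 =
      (u - b) ^ 2 * (u ^ 2 + (2 * b ^ 3 + 2 * b) * u + b ^ 4) := by ring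
  rw [h4]
  positivity

/-- As a function of `X ^ n`, the map `X ↦ sinOfTan (g * X)` lies below a line through any
positive point. -/
theorem exists_sinOfTan_le_linear {g c : ℝ} (hg : 0 ≤ g) (hc : 0 < c) {n : ℕ} (hn : 1 ≤ n) :
    ∃ a : ℝ, 0 ≤ a ∧ ∀ X : ℝ, 0 ≤ X →
      sinOfTan (g * X) ≤ sinOfTan (g * c) + a * (X ^ n - c ^ n) := by
  have hn0 : (0 : ℝ) < n := by exact_mod_cast hn
  set t := Real.sqrt (1 + (g * c) ^ 2) with ht
  have ht0 : 0 < t := Real.sqrt_pos.2 (by positivity)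
  refine ⟨g * c / (t ^ 3 * (n * c ^ n)), by positivity, fun X hX => ?_⟩
  refine (sinOfTan_le_tangent (by positivity) (by positivity : 0 ≤ g * c)).trans ?_
  rw [← ht]
  have hbern := one_add_mul_le_pow (a := X / c - 1) (by have := div_nonneg hX hc.le; linarith) n
  rw [add_sub_cancel, div_pow, le_div_iff₀ (by positivity)] at hbern
  have hX : X - c ≤ c * (X ^ n - c ^ n) / (n * c ^ n) := by
    rw [le_div_iff₀ (by positivity)]
    have : (X - c) * (n * c ^ n) = c * (n * (X / c - 1) * c ^ n) := by field_simp
    rw [this]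
    exact mul_le_mul_of_nonneg_left (by linarith) hc.le
  have := div_le_div_of_nonneg_right (mul_le_mul_of_nonneg_left hX hg) (by positivity : 0 ≤ t ^ 3)
  calc sinOfTan (g * c) + (g * X - g * c) / t ^ 3
      = sinOfTan (g * c) + g * (X - c) / t ^ 3 := by ring
    _ ≤ sinOfTan (g * c) + g * (c * (X ^ n - c ^ n) / (n * c ^ n)) / t ^ 3 := by linarith
    _ = _ := by field_simp

variable {ι κ : Type*} [Fintype ι] [DecidableEq ι] [Fintype κ] [DecidableEq κ]

/-- Bounds on the regularized power sums along a sequence of regularizations tending to zero bound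
the unregularized tangents. -/
theorem exists_diagonalization_of_frequently {V : Matrix ι κ ℂ} (hV : Vᴴ * V = 1)
    {E : Matrix ι ι ℂ} (hE : E ∈ symProj ι) :
    ∃ (Y : Matrix κ κ ℂ) (φ : κ → ℝ), Yᴴ * Y = 1 ∧ Y * Yᴴ = 1 ∧ compr V E = infl Y (diagR φ) ∧
      (∀ l, 0 ≤ φ l) ∧ ∀ (m : ℕ) (X : ℝ), 1 ≤ m → 0 ≤ X →
        (∃ᶠ n : ℕ in atTop, (powSum (1 / ((n : ℝ) + 1)) (compr V E) m).re ≤ X ^ (2 * m)) →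
        ∀ l, 1 - φ l ≤ X ^ 2 * φ l := by
  obtain ⟨Y, φ, h1, h2, h3, h4, h5⟩ := exists_diagonalization hV hE
  refine ⟨Y, φ, h1, h2, h3, h4, fun m X hm hX hfreq l => ?_⟩
  have hlim : Tendsto (fun n : ℕ => X ^ 2 * (φ l + 1 / ((n : ℝ) + 1))) atTop
      (nhds (X ^ 2 * (φ l + 0))) :=
    (tendsto_one_div_add_atTop_nhds_zero_nat.const_add _).const_mul _
  rw [add_zero] at hlim
  refine ge_of_tendsto_of_frequently hlim (hfreq.mono fun n hn => ?_)
  have hε : 0 < 1 / ((n : ℝ) + 1) := by positivity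
  have hS := SpecData.of_diagonalization h1 h2 h3 h4 h5 hε
  rw [hS.powSum_eq, Complex.ofReal_re, pow_mul] at hn
  have hl := (Finset.single_le_sum (fun i _ => pow_nonneg (hS.tau_nonneg i) m)
    (Finset.mem_univ l)).trans hn
  have hτ := le_of_pow_le_pow_left₀ (by omega) (by positivity) hl
  rwa [inv_mul_le_iff₀ (add_pos_of_nonneg_of_pos (h4 l) hε), mul_comm] at hτ

/-- Passage to the limit of vanishing regularization in a uniform moment bound. -/
theorem RotInvariant.exists_limit_moment {Ω : Type*} [MeasurableSpace Ω] {μ : Measure Ω}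
    {P : Ω → Matrix ι ι ℂ} {V : Matrix ι κ ℂ} {m : ℕ} {M : ℝ} (hM : 0 ≤ M)
    (h : ∀ ε : ℝ, 0 < ε → ∃ τ : Ω → κ → ℝ, (∀ ω x, 0 ≤ τ ω x) ∧
      (∀ ω i, powSum ε (compr V (P ω)) i = (pS (τ ω) i : ℝ)) ∧
      Integrable (fun ω => pS (τ ω) m) μ ∧ ∫ ω, pS (τ ω) m ∂μ ≤ M) :
    ∃ S : Ω → ℝ, (∀ ω, 0 ≤ S ω) ∧ Integrable S μ ∧ ∫ ω, S ω ∂μ ≤ M ∧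
      ∀ᵐ ω ∂μ, ∀ t : ℝ, S ω < t →
        ∃ᶠ n : ℕ in atTop, (powSum (1 / ((n : ℝ) + 1)) (compr V (P ω)) m).re ≤ t := by
  choose τ h0 hpow hint hle using fun n : ℕ => h (1 / ((n : ℝ) + 1)) (by positivity)
  have hre : ∀ (n : ℕ) ω, (powSum (1 / ((n : ℝ) + 1)) (compr V (P ω)) m).re = pS (τ n ω) m := by
    intro n ω
    rw [hpow, Complex.ofReal_re]
  have hnn : ∀ n ω, 0 ≤ pS (τ n ω) m := fun n ω =>
    Finset.sum_nonneg fun l _ => pow_nonneg (h0 n ω l) m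
  let f : ℕ → Ω → ℝ≥0∞ := fun n ω => ENNReal.ofReal (pS (τ n ω) m)
  have hf : ∀ n, AEMeasurable (f n) μ := fun n => (hint n).aemeasurable.ennreal_ofReal
  let F : Ω → ℝ≥0∞ := fun ω => liminf (fun n => f n ω) atTop
  have hF : AEMeasurable F μ := by
    simp only [F, liminf_eq_iSup_iInf_of_nat]
    exact AEMeasurable.iSup fun n => AEMeasurable.biInf _ (Set.to_countable _) fun i _ => hf i
  have hFle : ∫⁻ ω, F ω ∂μ ≤ ENNReal.ofReal M := by
    refine (lintegral_liminf_le' hf).trans ?_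
    refine liminf_le_of_frequently_le' (Frequently.of_forall fun n => ?_)
    rw [← ofReal_integral_eq_lintegral_ofReal (hint n) (ae_of_all _ (hnn n))]
    exact ENNReal.ofReal_le_ofReal (hle n)
  have hFtop : ∫⁻ ω, F ω ∂μ ≠ ⊤ := (hFle.trans_lt ENNReal.ofReal_lt_top).ne
  have hFae : ∀ᵐ ω ∂μ, F ω < ⊤ := ae_lt_top' hF hFtop
  refine ⟨fun ω => (F ω).toReal, fun ω => ENNReal.toReal_nonneg,
    integrable_toReal_of_lintegral_ne_top hF hFtop, ?_, ?_⟩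
  · rw [integral_toReal hF hFae]
    exact ENNReal.toReal_le_of_le_ofReal hM hFle
  · filter_upwards [hFae] with ω hω t ht
    have hlt : F ω < ENNReal.ofReal t := by
      rw [← ENNReal.ofReal_toReal hω.ne]
      exact (ENNReal.ofReal_lt_ofReal_iff_of_nonneg ENNReal.toReal_nonneg).2 ht
    refine (frequently_lt_of_liminf_lt (by isBoundedDefault) hlt).mono fun n hn => ?_
    rw [hre]
    exact ((ENNReal.ofReal_lt_ofReal_iff_of_nonneg (hnn n ω)).1 hn).le

/-- Expectation bound for a function dominated by a tangent-to-sine function of a random tangent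
whose `n`-th power has a bounded mean. -/
theorem integral_le_sinOfTan {Ω : Type*} [MeasurableSpace Ω] {μ : Measure Ω}
    [IsProbabilityMeasure μ] {S : Ω → ℝ} (hS0 : ∀ ω, 0 ≤ S ω) (hS : Integrable S μ) {g c : ℝ}
    (hg : 0 ≤ g) (hc : 0 < c) {n : ℕ} (hn : 1 ≤ n) (hSc : ∫ ω, S ω ∂μ ≤ c ^ n) {f : Ω → ℝ}
    (hf : ∀ᵐ ω ∂μ, ∀ X : ℝ, 0 ≤ X → S ω < X ^ n → f ω ≤ sinOfTan (g * X)) :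
    ∫ ω, f ω ∂μ ≤ sinOfTan (g * c) := by
  obtain ⟨a, ha, hlin⟩ := exists_sinOfTan_le_linear hg hc hn
  by_cases hfi : Integrable f μ
  swap
  · rw [integral_undef hfi]
    exact sinOfTan_nonneg (by positivity)
  have hle : ∀ᵐ ω ∂μ, f ω ≤ sinOfTan (g * c) + a * (S ω - c ^ n) := by
    filter_upwards [hf] with ω hω
    have hcont : Tendsto (fun t : ℝ => sinOfTan (g * c) + a * (t - c ^ n)) (nhdsWithin (S ω)
        (Set.Ioi (S ω))) (nhds (sinOfTan (g * c) + a * (S ω - c ^ n))) :=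
      (Continuous.tendsto (by fun_prop) _).mono_left nhdsWithin_le_nhds
    refine ge_of_tendsto hcont ?_
    filter_upwards [self_mem_nhdsWithin] with t ht
    have ht0 : 0 ≤ t := (hS0 ω).trans (le_of_lt ht)
    have hpow : (t ^ ((n : ℝ)⁻¹)) ^ n = t := Real.rpow_inv_natCast_pow ht0 (by omega)
    have h1 := hω (t ^ ((n : ℝ)⁻¹)) (by positivity) (by rw [hpow]; exact ht)
    have h2 := hlin (t ^ ((n : ℝ)⁻¹)) (by positivity)
    rw [hpow] at h2
    exact h1.trans h2
  have hi : Integrable (fun ω => a * (S ω - c ^ n)) μ := (hS.sub (integrable_const _)).const_mul a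
  refine (integral_mono_ae hfi ((integrable_const _).add hi) hle).trans ?_
  change ∫ ω, (sinOfTan (g * c) + a * (S ω - c ^ n)) ∂μ ≤ _
  rw [integral_add (integrable_const _) hi, integral_const_mul,
    integral_sub hS (integrable_const _)]
  simp only [integral_const, probReal_univ, one_smul]
  nlinarith

/-- The moment bound in terms of the Gaussian constant. -/
theorem moment_le_Ce_pow {k ρ n₂ m : ℕ} (hρ : 2 ≤ ρ) (hm : 1 ≤ m) (hmρ : 2 * m - 1 < ρ)
    (h : (catalan (m - 1) : ℝ) * (ρ : ℝ) ^ (2 * m) ≤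
        Real.exp 1 ^ (2 * m) * ((ρ : ℝ) - 2 * m + 1) ^ (2 * m - 1)) :
    ((ρ : ℝ) - 2 * m + 1) * catalan (m - 1) *
      (((k + ρ : ℝ) * n₂) / ((ρ : ℝ) - 2 * m + 1) ^ 2) ^ m ≤ Ce k ρ n₂ ^ (2 * m) := by
  set c : ℝ := (ρ : ℝ) - 2 * m + 1 with hc
  have hc0 : 0 < c := by
    have : 2 * m < ρ + 1 := by omega
    have : (2 * m : ℝ) < ρ + 1 := by exact_mod_cast this
    linarith
  have hρ0 : (0 : ℝ) < ρ := by exact_mod_cast (by omega : 0 < ρ)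
  have hN : (0 : ℝ) ≤ (k + ρ : ℝ) * n₂ := by positivity
  have hCe : Real.exp 1 * Real.sqrt ((k + ρ : ℝ) * n₂) / ρ ≤ Ce k ρ n₂ :=
    le_add_of_nonneg_left (Real.sqrt_nonneg _)
  refine le_trans ?_ (pow_le_pow_left₀ (by positivity) hCe _)
  have hcc : c ^ (2 * m) = c * c ^ (2 * m - 1) := by
    rw [← pow_succ']; congr 1; omega
  rw [div_pow, div_pow, mul_pow (Real.exp 1), pow_mul (Real.sqrt _), Real.sq_sqrt hN, ← pow_mul,
    hcc, mul_div_assoc', div_le_div_iff₀ (by positivity) (by positivity)]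
  have h1 := mul_le_mul_of_nonneg_left h (by positivity : 0 ≤ c * ((k + ρ : ℝ) * n₂) ^ m)
  linarith

theorem Ce_pos {k ρ n₂ : ℕ} (hk : 1 ≤ k) (hρ : 2 ≤ ρ) : 0 < Ce k ρ n₂ := by
  have hk0 : (0 : ℝ) < k := by exact_mod_cast hk
  have hρ0 : (0 : ℝ) < (ρ : ℝ) - 1 := by
    have : (2 : ℝ) ≤ ρ := by exact_mod_cast hρ
    linarith
  exact add_pos_of_pos_of_nonneg (Real.sqrt_pos.2 (div_pos hk0 hρ0)) (by positivity)

theorem le_of_conjTranspose_mul_self_eq_one {a b : ℕ} {M : Matrix (Fin a) (Fin b) ℂ}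
    (hM : Mᴴ * M = 1) : b ≤ a := by
  have h := (rank_mul_le_right Mᴴ M).trans (rank_le_height M)
  rwa [hM, rank_one, Fintype.card_fin] at h

theorem rangeProj_eq_mul {α β : Type*} [Fintype α] [DecidableEq α] [Fintype β] [DecidableEq β]
    (M : Matrix α β ℝ) : rangeProj M =
      M.map (fun x => (x : ℂ)) * ((Mᵀ * M)⁻¹ * Mᵀ).map (fun x => (x : ℂ)) := by
  rw [rangeProj, Matrix.mul_assoc, map_ofReal_mul]

/-- For a Gaussian starting guess there is a random variable controlling a power of the tangent of
the largest angle between the range of the guess and a fixed subspace. -/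
theorem exists_gaussian_tangent {k n₂ ρ : ℕ} (hk : 1 ≤ k) (hρ : 2 ≤ ρ) (hn : ρ ≤ n₂)
    {V : Matrix (Fin (k + n₂)) (Fin k) ℂ} (hV : Vᴴ * V = 1) {Ω : Type*} [MeasurableSpace Ω]
    {μ : Measure Ω} [IsProbabilityMeasure μ] {W : Ω → Matrix (Fin (k + n₂)) (Fin (k + ρ)) ℝ}
    (hmeas : ∀ i j, Measurable fun ω => W ω i j)
    (hdist : ∀ i j, μ.map (fun ω => W ω i j) = gaussianReal 0 1)
    (hindep : iIndepFun (fun (ij : Fin (k + n₂) × Fin (k + ρ)) ω => W ω ij.1 ij.2) μ) :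
    ∃ (m : ℕ) (S : Ω → ℝ), 1 ≤ m ∧ (∀ ω, 0 ≤ S ω) ∧ Integrable S μ ∧
      ∫ ω, S ω ∂μ ≤ Ce k ρ n₂ ^ (2 * m) ∧ ∀ᵐ ω ∂μ, ∀ t : ℝ, S ω < t →
        ∃ᶠ n : ℕ in atTop,
          (powSum (1 / ((n : ℝ) + 1)) (compr V (rangeProj (W ω))) m).re ≤ t := by
  have hlaw : μ.map (fun ω (ij : Fin (k + n₂) × Fin (k + ρ)) => W ω ij.1 ij.2) =
      gaussFamily (Fin (k + n₂)) (Fin (k + ρ)) := by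
    refine ((iIndepFun_iff_map_fun_eq_pi_map
      (f := fun (ij : Fin (k + n₂) × Fin (k + ρ)) ω => W ω ij.1 ij.2)
      fun ij => (hmeas ij.1 ij.2).aemeasurable).1 hindep).trans ?_
    simp only [hdist]
  have hm : Measurable fun ω (ij : Fin (k + n₂) × Fin (k + ρ)) => W ω ij.1 ij.2 :=
    measurable_pi_iff.2 fun ij => hmeas ij.1 ij.2
  have hN : ∀ᵐ ω ∂μ, (rangeProj (W ω)).trace = ((k + ρ : ℝ) : ℂ) := by
    have hdet := ae_det_gram_ne_zero (Fin.castLEEmb (Nat.add_le_add_left hn k))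
    rw [← hlaw] at hdet
    filter_upwards [ae_of_ae_map hm.aemeasurable hdet] with ω hω
    have h := trace_rangeProj (M := W ω) hω
    rw [h, Fintype.card_fin]
    push_cast
    rfl
  obtain ⟨m, hm1, hmρ, hcat⟩ := exists_moment_order hρ
  obtain ⟨S, hS⟩ := RotInvariant.exists_limit_moment (m := m) (V := V)
    (P := fun ω => rangeProj (W ω)) (μ := μ) (pow_nonneg (Ce_pos (n₂ := n₂) hk hρ).le (2 * m))
    fun ε hε => by
      obtain ⟨τ, h0, hpow, hint, hle⟩ := (rotInvariant_rangeProj hmeas hlaw).moment_le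
        (by simp) (by simp) hk hρ hn hm1 hmρ hN hV hε
      exact ⟨τ, h0, hpow, hint, hle.trans (moment_le_Ce_pow hρ hm1 hmρ hcat)⟩
  exact ⟨m, S, hm1, hS⟩

end Limit

/-- Theorem 3.7 (bounds in expectation) for a standard Gaussian starting guess. -/
theorem expected_canonical_angles_gaussian
    {k m₂ n₂ ρ : ℕ} (q : ℕ) (hk : 1 ≤ k) (hρ : 2 ≤ ρ)
    (A : Matrix (Fin (k + m₂)) (Fin (k + n₂)) ℂ)
    (U : Matrix (Fin (k + m₂)) (Fin (k + m₂)) ℂ)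
    (V : Matrix (Fin (k + n₂)) (Fin (k + n₂)) ℂ)
    (σ : ℕ → ℝ)
    (hU : Uᴴ * U = 1) (hU' : U * Uᴴ = 1)
    (hV : Vᴴ * V = 1) (hV' : V * Vᴴ = 1)
    (hσ0 : ∀ i, 0 ≤ σ i) (hσm : ∀ i j, i ≤ j → σ j ≤ σ i)
    (hA : A = U * diagRect σ 0 (k + m₂) (k + n₂) * Vᴴ)
    (hrank : 0 < σ (k - 1)) (hgap : σ k < σ (k - 1))
    {Ωs : Type} [MeasureTheory.MeasureSpace Ωs]
    [MeasureTheory.IsProbabilityMeasure (MeasureTheory.volume : MeasureTheory.Measure Ωs)]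
    (W : Ωs → Matrix (Fin (k + n₂)) (Fin (k + ρ)) ℝ)
    (hmeas : ∀ i j, Measurable fun ω => W ω i j)
    (hdist : ∀ i j, MeasureTheory.Measure.map (fun ω => W ω i j) MeasureTheory.volume =
      ProbabilityTheory.gaussianReal 0 1)
    (hindep : ProbabilityTheory.iIndepFun
      (fun (ij : Fin (k + n₂) × Fin (k + ρ)) ω => W ω ij.1 ij.2) MeasureTheory.volume)
    (Q : Ωs → Matrix (Fin (k + m₂)) (Fin (k + ρ)) ℂ)
    (R : Ωs → Matrix (Fin (k + ρ)) (Fin (k + ρ)) ℂ)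
    (hQ : ∀ ω, (Q ω)ᴴ * Q ω = 1) (hR : ∀ ω, (R ω).BlockTriangular id)
    (hQR : ∀ ω, (A * Aᴴ) ^ q * A * (W ω).map (fun x => (x : ℂ)) = Q ω * R ω)
    (UB : Ωs → Matrix (Fin (k + ρ)) (Fin (k + ρ)) ℂ)
    (Vh : Ωs → Matrix (Fin (k + n₂)) (Fin (k + ρ)) ℂ)
    (σh : Ωs → ℕ → ℝ)
    (hUB : ∀ ω, (UB ω)ᴴ * UB ω = 1) (hUB' : ∀ ω, UB ω * (UB ω)ᴴ = 1)
    (hVh : ∀ ω, (Vh ω)ᴴ * Vh ω = 1)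
    (hσh0 : ∀ ω i, 0 ≤ σh ω i) (hσhm : ∀ ω i j, i ≤ j → σh ω j ≤ σh ω i)
    (hB : ∀ ω, (Q ω)ᴴ * A = UB ω * diagRect (σh ω) 0 (k + ρ) (k + ρ) * (Vh ω)ᴴ)
    :
    ∀ j : Fin k,
      (∫ ω, sval ((1 - Q ω * UB ω * (Q ω * UB ω)ᴴ) * colsL U) (k - 1 - (j : ℕ))) ≤
          (σ k / σ (j : ℕ)) ^ (2 * q + 1) * Ce k ρ n₂ /
            Real.sqrt (1 + (σ k / σ (j : ℕ)) ^ (4 * q + 2) * (Ce k ρ n₂) ^ 2) ∧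
      (∫ ω, sval ((1 - Vh ω * (Vh ω)ᴴ) * colsL V) (k - 1 - (j : ℕ))) ≤
          (σ k / σ (j : ℕ)) ^ (2 * q + 2) * Ce k ρ n₂ /
            Real.sqrt (1 + (σ k / σ (j : ℕ)) ^ (4 * q + 4) * (Ce k ρ n₂) ^ 2) := by
  obtain ⟨ω₀⟩ : Nonempty Ωs := MeasureTheory.nonempty_of_isProbabilityMeasure
    (MeasureTheory.volume : MeasureTheory.Measure Ωs)
  have hn : ρ ≤ n₂ := by
    have := le_of_conjTranspose_mul_self_eq_one (hVh ω₀)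
    omega
  have hVL := conjTranspose_colsL_mul_colsL hV
  obtain ⟨m, S, hm, hS0, hS, hSle, hfreq⟩ :=
    exists_gaussian_tangent hk hρ hn hVL hmeas hdist hindep
  have hCe : 0 < Ce k ρ n₂ := Ce_pos hk hρ
  intro j
  have hγ : 0 ≤ σ k / σ (j : ℕ) := div_nonneg (hσ0 _) (hσ0 _)
  have hbound : ∀ᵐ ω, ∀ X : ℝ, 0 ≤ X → S ω < X ^ (2 * m) →
      sval ((1 - Q ω * UB ω * (Q ω * UB ω)ᴴ) * colsL U) (k - 1 - (j : ℕ)) ≤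
          sinOfTan ((σ k / σ (j : ℕ)) ^ (2 * q + 1) * X) ∧
        sval ((1 - Vh ω * (Vh ω)ᴴ) * colsL V) (k - 1 - (j : ℕ)) ≤
          sinOfTan ((σ k / σ (j : ℕ)) ^ (2 * q + 2) * X) := by
    filter_upwards [hfreq] with ω hω X hX hSX
    have hE := rangeProj_mem_symProj (W ω)
    obtain ⟨Y, φ, hY, hY', hΦ, hφ0, hφ⟩ := exists_diagonalization_of_frequently hVL hE
    exact sval_angles_le hU hV hV' hσ0 hσm hA hrank (hQ ω) (hQR ω) (hUB ω) (hUB' ω) (hVh ω) (hB ω)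
      hE (rangeProj_eq_mul (W ω)) hY hY' hΦ hX hφ0 (hφ m X hm hX (hω _ hSX)) j
  have h1 := integral_le_sinOfTan hS0 hS (pow_nonneg hγ (2 * q + 1)) hCe (by omega) hSle
    (hbound.mono fun ω h X hX hSX => (h X hX hSX).1)
  have h2 := integral_le_sinOfTan hS0 hS (pow_nonneg hγ (2 * q + 2)) hCe (by omega) hSle
    (hbound.mono fun ω h X hX hSX => (h X hX hSX).2)
  rw [sinOfTan, mul_pow, ← pow_mul] at h1 h2
  rw [show 4 * q + 2 = (2 * q + 1) * 2 by ring, show 4 * q + 4 = (2 * q + 2) * 2 by ring]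
  exact ⟨h1, h2⟩
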